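/- arXiv:1309.7118 — 2 statements merged into one kernel-verified Lean document; each statement's English description precedes it below -/
import Mathlib

section
/- Assume condition (G) for some γ ∈ ℕ, d > 0 and L > 0. Let 0 ≤ K < L with [K]+1 ≤ γ, 1 ≤ q ≤ ∞, ℓ ∈ [0,K], and let f be a measurable function on ℝ^N × (0,∞) such that E_{K,q}[f] ∈ L^∞(0,T) for every T > 0 and ∫_0^∞ E_{K,q}[f](s) ds < ∞. With R_K[f](t) := ∫_0^t e^{(t−s)ℒ} [P_K(s)f(·,s)] ds, one has lim_{t→∞} t^{K/d} [ t^{(N/d)(1−1/q)} ‖R_K[f](t)‖_q + t^{−ℓ/d} |||R_K[f](t)|||_ℓ ] = 0. -/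
open MeasureTheory Filter Asymptotics Topology
open scoped ENNReal BigOperators

noncomputable section

/-- Partial derivative in the `i`-th coordinate direction. -/
def pderivE (N : ℕ) (i : Fin N) (f : EuclideanSpace ℝ (Fin N) → ℝ) :
    EuclideanSpace ℝ (Fin N) → ℝ :=
  fun x => fderiv ℝ f x (EuclideanSpace.single i 1)

/-- Multi-index partial derivative `∂_x^α`. -/
def mderivE (N : ℕ) (α : Fin N → ℕ) (f : EuclideanSpace ℝ (Fin N) → ℝ) :
    EuclideanSpace ℝ (Fin N) → ℝ :=
  (List.ofFn fun i : Fin N => (pderivE N i)^[α i]).foldr (fun T h => T h) f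

/-- `x ^ α` for a multi-index `α`. -/
def mpowE (N : ℕ) (α : Fin N → ℕ) (x : EuclideanSpace ℝ (Fin N)) : ℝ :=
  ∏ i, x i ^ α i

/-- `α !` for a multi-index `α`. -/
def mfactE (N : ℕ) (α : Fin N → ℕ) : ℕ := ∏ i, Nat.factorial (α i)

/-- `g_α(x,t) := ((-1)^{|α|}/α!) ∂_x^α G(x, t+1)`. -/
def gA (N : ℕ) (G : EuclideanSpace ℝ (Fin N) → ℝ → ℝ) (α : Fin N → ℕ)
    (x : EuclideanSpace ℝ (Fin N)) (t : ℝ) : ℝ :=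
  ((-1 : ℝ) ^ (∑ i, α i) / (mfactE N α : ℝ)) * mderivE N α (fun y => G y (t + 1)) x

/-- Condition (G) for the kernel `G` with parameters `γ`, `d`, `L`. -/
structure CondG (N : ℕ) (G : EuclideanSpace ℝ (Fin N) → ℝ → ℝ) (γ : ℕ) (d L : ℝ) : Prop where
  smooth : ContDiffOn ℝ γ (fun p : EuclideanSpace ℝ (Fin N) × ℝ => G p.1 p.2) {p | 0 < p.2}
  scaling : ∀ x : EuclideanSpace ℝ (Fin N), ∀ t : ℝ, 0 < t →
      G x t = t ^ (-(N : ℝ) / d) * G ((t ^ (-(1 : ℝ) / d)) • x) 1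
  decay : ∀ j : ℕ, j ≤ γ → ∃ C : ℝ, ∀ x : EuclideanSpace ℝ (Fin N),
      (1 + ‖x‖) ^ ((N : ℝ) + L + j) * ‖iteratedFDeriv ℝ j (fun y => G y 1) x‖ ≤ C
  semigroup : ∀ x : EuclideanSpace ℝ (Fin N), ∀ t s : ℝ, 0 < s → s < t →
      G x t = ∫ y, G (x - y) (t - s) * G y s

/-- `(e^{tℒ}φ)(x) = ∫ G(x-y,t) φ(y) dy`. -/
def sgOp (N : ℕ) (G : EuclideanSpace ℝ (Fin N) → ℝ → ℝ) (t : ℝ)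
    (φ : EuclideanSpace ℝ (Fin N) → ℝ) : EuclideanSpace ℝ (Fin N) → ℝ :=
  fun x => ∫ y, G (x - y) t * φ y

/-- `∫ x^α f(x) dx`. -/
def momE (N : ℕ) (α : Fin N → ℕ) (f : EuclideanSpace ℝ (Fin N) → ℝ) : ℝ :=
  ∫ x, mpowE N α x * f x

/-- Auxiliary fuelled recursion computing the coefficients `M_α(f,t)`. -/
def McoefAux (N : ℕ) (G : EuclideanSpace ℝ (Fin N) → ℝ → ℝ)
    (f : EuclideanSpace ℝ (Fin N) → ℝ) (t : ℝ) : ℕ → (Fin N → ℕ) → ℝ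
  | 0, α => momE N α f
  | n + 1, α => momE N α f -
      ∑ β ∈ (Finset.Iic α).erase α,
        McoefAux N G f t n β * ∫ x, mpowE N α x * gA N G β x t

/-- `M_α(f,t)`, defined inductively on `|α|`:
`M_α(f,t) = ∫ x^α f dx - ∑_{β ≤ α, β ≠ α} M_β(f,t) ∫ x^α g_β(x,t) dx`. -/
def Mcoef (N : ℕ) (G : EuclideanSpace ℝ (Fin N) → ℝ → ℝ)
    (f : EuclideanSpace ℝ (Fin N) → ℝ) (t : ℝ) (α : Fin N → ℕ) : ℝ :=
  McoefAux N G f t (∑ i, α i) α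

/-- The finite set of multi-indices `α` with `|α| ≤ m`. -/
def multiIdx (N m : ℕ) : Finset (Fin N → ℕ) :=
  (Finset.Iic fun _ => m).filter fun α => ∑ i, α i ≤ m

/-- `P_K(t)f := f - ∑_{|α| ≤ K} M_α(f,t) g_α(·,t)`. -/
def PKop (N : ℕ) (G : EuclideanSpace ℝ (Fin N) → ℝ → ℝ) (K : ℝ) (t : ℝ)
    (f : EuclideanSpace ℝ (Fin N) → ℝ) : EuclideanSpace ℝ (Fin N) → ℝ :=
  fun x => f x - ∑ α ∈ multiIdx N ⌊K⌋₊, Mcoef N G f t α * gA N G α x t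

/-- The weighted `L¹` norm `|||φ|||_k = ∫ (1+|x|^k) ‖φ(x)‖ dx`, valued in `ℝ≥0∞`. -/
def wnorm (N : ℕ) {E' : Type*} [NormedAddCommGroup E'] (k : ℝ)
    (φ : EuclideanSpace ℝ (Fin N) → E') : ℝ≥0∞ :=
  ∫⁻ x, ENNReal.ofReal ((1 + ‖x‖ ^ k) * ‖φ x‖)

/-- Membership in `L¹_k = L¹(ℝ^N, (1+|x|^k)dx)`. -/
def MemL1k (N : ℕ) (k : ℝ) (φ : EuclideanSpace ℝ (Fin N) → ℝ) : Prop :=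
  AEStronglyMeasurable φ (volume : Measure (EuclideanSpace ℝ (Fin N))) ∧ wnorm N k φ < ⊤

/-- `E_{K,q}[f](t) = (1+t)^{K/d}[t^{(N/d)(1-1/q)} ‖f(t)‖_q + ‖f(t)‖_1] + |||f(t)|||_K`. -/
def Efun (N : ℕ) (d K : ℝ) (q : ℝ≥0∞) (f : EuclideanSpace ℝ (Fin N) → ℝ → ℝ) (t : ℝ) :
    ℝ≥0∞ :=
  ENNReal.ofReal ((1 + t) ^ (K / d)) *
      (ENNReal.ofReal (t ^ (((N : ℝ) / d) * (1 - q.toReal⁻¹))) *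
          eLpNorm (fun x => f x t) q volume +
        eLpNorm (fun x => f x t) 1 volume) +
    wnorm N K (fun x => f x t)

/-- `t^{(N/d)(1-1/q)} ‖w(t)‖_q + t^{-ℓ/d} |||w(t)|||_ℓ`. -/
def DistQ (N : ℕ) (d : ℝ) (q : ℝ≥0∞) (ℓ : ℝ) (w : EuclideanSpace ℝ (Fin N) → ℝ → ℝ)
    (t : ℝ) : ℝ≥0∞ :=
  ENNReal.ofReal (t ^ (((N : ℝ) / d) * (1 - q.toReal⁻¹))) * eLpNorm (fun x => w x t) q volume +
    ENNReal.ofReal (t ^ (-ℓ / d)) * wnorm N ℓ (fun x => w x t)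

end

theorem eLpNormEssSup_le_iff_ae {X : Type*} [MeasurableSpace X] {μ : Measure X} {w : X → ℝ≥0∞}
    {a : ℝ≥0∞} : eLpNormEssSup w μ ≤ a ↔ ∀ᵐ x ∂μ, w x ≤ a := by
  constructor
  · intro h
    filter_upwards [enorm_ae_le_eLpNormEssSup w μ] with x hx
    exact (by simpa using hx : w x ≤ eLpNormEssSup w μ).trans h
  · intro h
    refine essSup_le_of_ae_le a ?_
    filter_upwards [h] with x hx
    simpa using hx

theorem measurable_eLpNorm_section {X Y : Type*} [MeasurableSpace X] [MeasurableSpace Y]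
    {μ : Measure X} [SFinite μ] {F : X × Y → ℝ≥0∞} (hF : Measurable F) (q : ℝ≥0∞) :
    Measurable fun y => eLpNorm (fun x => F (x, y)) q μ := by
  rcases eq_or_ne q 0 with rfl | hq0
  · simp
  rcases eq_or_ne q ⊤ with rfl | hq
  · refine measurable_of_Iic fun a => ?_
    have hs : MeasurableSet {z : Y × X | a < F (z.2, z.1)} :=
      measurableSet_lt measurable_const (hF.comp measurable_swap)
    have := measurable_measure_prodMk_left (ν := μ) hs (measurableSet_singleton 0)
    convert this using 1
    ext y
    simp only [Set.mem_preimage, Set.mem_Iic, Set.mem_singleton_iff, eLpNorm_exponent_top]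
    rw [eLpNormEssSup_le_iff_ae]
    simp only [ae_iff, not_le]
    rfl
  · simp_rw [eLpNorm_eq_lintegral_rpow_enorm_toReal hq0 hq]
    refine Measurable.pow_const ?_ _
    simp only [enorm_eq_self]
    exact (hF.pow_const _).lintegral_prod_left'

/-- Minkowski's integral inequality. -/
theorem eLpNorm_lintegral_le {X Y : Type*} [MeasurableSpace X] [MeasurableSpace Y]
    {μ : Measure X} {ν : Measure Y} [SFinite μ] [SFinite ν] {F : X × Y → ℝ≥0∞}
    (hF : Measurable F) {q : ℝ≥0∞} (hq1 : 1 ≤ q) :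
    eLpNorm (fun x => ∫⁻ y, F (x, y) ∂ν) q μ ≤ ∫⁻ y, eLpNorm (fun x => F (x, y)) q μ ∂ν := by
  set w : Y → ℝ≥0∞ := fun y => eLpNorm (fun x => F (x, y)) q μ with hw
  have hwm : Measurable w := measurable_eLpNorm_section hF q
  have hFy (y : Y) : Measurable fun x => F (x, y) := by fun_prop
  have hFx (x : X) : Measurable fun y => F (x, y) := by fun_prop
  rcases eq_or_ne q ⊤ with rfl | hq
  · rw [eLpNorm_exponent_top, eLpNormEssSup_le_iff_ae]
    have h1 : ∀ᵐ y ∂ν, ∀ᵐ x ∂μ, F (x, y) ≤ w y := by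
      refine .of_forall fun y => ?_
      have := enorm_ae_le_eLpNormEssSup (fun x => F (x, y)) μ
      simpa [hw] using this
    have h2 := (Measure.ae_ae_comm (μ := ν) (ν := μ) (p := fun y x => F (x, y) ≤ w y)
      (measurableSet_le (hF.comp measurable_swap) (hwm.comp measurable_fst))).1 h1
    filter_upwards [h2] with x hx
    simpa using lintegral_mono_ae hx
  have hq0 : q ≠ 0 := fun h => by simp [h] at hq1
  set p := q.toReal with hp
  have hp1 : 1 ≤ p := by
    rw [hp]; simpa using ENNReal.toReal_mono hq hq1
  have hp0 : 0 < p := by linarith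
  have hwp (y : Y) : ∫⁻ x, F (x, y) ^ p ∂μ = w y ^ p := by
    simp only [hw, eLpNorm_eq_lintegral_rpow_enorm_toReal hq0 hq, enorm_eq_self]
    rw [← ENNReal.rpow_mul, one_div, inv_mul_cancel₀ hp0.ne', ENNReal.rpow_one]
  rcases eq_or_ne (∫⁻ y, w y ∂ν) ⊤ with hinf | hfin
  · rw [hinf]; exact le_top
  rw [eLpNorm_eq_lintegral_rpow_enorm_toReal hq0 hq]
  simp only [enorm_eq_self]
  rw [← hp, one_div, ENNReal.rpow_inv_le_iff hp0]
  rcases hp1.eq_or_lt with h1 | h1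
  · rw [← h1]
    simp only [ENNReal.rpow_one]
    rw [lintegral_lintegral_swap (f := fun x y => F (x, y)) hF.aemeasurable]
    refine lintegral_mono fun y => ?_
    have := hwp y
    rw [← h1] at this
    simp only [ENNReal.rpow_one] at this
    exact this.le
  have hconj := Real.HolderConjugate.conjExponent h1
  set p' := p.conjExponent with hp'
  have hp'0 : 0 < p' := hconj.symm.pos
  have hzero : ∀ᵐ x ∂μ, ∀ᵐ y ∂ν, w y = 0 → F (x, y) = 0 := by
    refine (Measure.ae_ae_comm (μ := ν) (ν := μ) (p := fun y x => w y = 0 → F (x, y) = 0)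
      ?_).1 (.of_forall fun y => ?_)
    · have := ((measurableSet_singleton (0 : ℝ≥0∞)).preimage (hwm.comp measurable_fst)).compl.union
        ((measurableSet_singleton (0 : ℝ≥0∞)).preimage (hF.comp measurable_swap))
      convert this using 1
      ext ⟨y, x⟩
      simp [imp_iff_not_or]
    · by_cases h : w y = 0
      · have := (eLpNorm_eq_zero_iff (hFy y).aestronglyMeasurable hq0).1 h
        filter_upwards [this] with x hx _ using hx
      · exact .of_forall fun x hx => (h hx).elim
  have hwtop : ∀ᵐ y ∂ν, w y < ⊤ := ae_lt_top hwm hfin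
  have key : ∀ᵐ x ∂μ, (∫⁻ y, F (x, y) ∂ν) ^ p ≤
      (∫⁻ y, F (x, y) ^ p * w y ^ (1 - p) ∂ν) * (∫⁻ y, w y ∂ν) ^ (p - 1) := by
    filter_upwards [hzero] with x hx
    have e1 : ∫⁻ y, F (x, y) ∂ν =
        ∫⁻ y, ((fun y => F (x, y) * w y ^ (-(1 / p'))) * fun y => w y ^ (1 / p')) y ∂ν := by
      refine lintegral_congr_ae ?_
      filter_upwards [hx, hwtop] with y hy hy'
      simp only [Pi.mul_apply]
      by_cases h0 : w y = 0
      · simp [hy h0]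
      · rw [mul_assoc, ← ENNReal.rpow_add _ _ h0 hy'.ne]
        simp
    have e2 := ENNReal.lintegral_mul_le_Lp_mul_Lq ν hconj
      (f := fun y => F (x, y) * w y ^ (-(1 / p'))) (g := fun y => w y ^ (1 / p'))
      (by fun_prop) (by fun_prop)
    rw [← e1] at e2
    have e3 := ENNReal.rpow_le_rpow e2 hp0.le
    refine e3.trans_eq ?_
    have hpp : p / p' = p - 1 := hconj.div_conj_eq_sub_one
    rw [ENNReal.mul_rpow_of_nonneg _ _ hp0.le, ← ENNReal.rpow_mul, ← ENNReal.rpow_mul,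
      one_div_mul_cancel hp0.ne', ENNReal.rpow_one]
    congr 1
    · refine lintegral_congr fun y => ?_
      rw [ENNReal.mul_rpow_of_nonneg _ _ hp0.le, ← ENNReal.rpow_mul]
      congr 2
      rw [← neg_sub, ← hpp]; ring
    · simp_rw [← ENNReal.rpow_mul, one_div_mul_cancel hp'0.ne', ENNReal.rpow_one]
      rw [← hpp]
      congr 1; ring
  calc ∫⁻ x, (∫⁻ y, F (x, y) ∂ν) ^ p ∂μ
      ≤ ∫⁻ x, (∫⁻ y, F (x, y) ^ p * w y ^ (1 - p) ∂ν) * (∫⁻ y, w y ∂ν) ^ (p - 1) ∂μ :=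
        lintegral_mono_ae key
    _ = (∫⁻ x, ∫⁻ y, F (x, y) ^ p * w y ^ (1 - p) ∂ν ∂μ) * (∫⁻ y, w y ∂ν) ^ (p - 1) := by
        rw [lintegral_mul_const'' _ ?_]
        have : Measurable fun z : X × Y => F z ^ p * w z.2 ^ (1 - p) := by fun_prop
        exact this.lintegral_prod_right'.aemeasurable
    _ = (∫⁻ y, w y ^ p * w y ^ (1 - p) ∂ν) * (∫⁻ y, w y ∂ν) ^ (p - 1) := by
        rw [lintegral_lintegral_swap]
        · congr 2
          ext y
          rw [lintegral_mul_const _ (by fun_prop), hwp]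
        · have : Measurable fun z : X × Y => F z ^ p * w z.2 ^ (1 - p) := by fun_prop
          exact this.aemeasurable
    _ ≤ (∫⁻ y, w y ∂ν) * (∫⁻ y, w y ∂ν) ^ (p - 1) := by
        gcongr with y
        rcases eq_or_ne (w y) 0 with h0 | h0
        · simp [h0, ENNReal.zero_rpow_of_pos hp0]
        rcases eq_or_ne (w y) ⊤ with ht | ht
        · simp [ht]
        rw [← ENNReal.rpow_add _ _ h0 ht]
        simp
    _ = (∫⁻ y, w y ∂ν) ^ p := by
        rcases eq_or_ne (∫⁻ y, w y ∂ν) 0 with h0 | h0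
        · simp [h0, ENNReal.zero_rpow_of_pos hp0]
        conv_lhs => enter [1]; rw [← ENNReal.rpow_one (∫⁻ y, w y ∂ν)]
        rw [← ENNReal.rpow_add _ _ h0 hfin]
        simp

/-- If the `L¹` norm and the sup norm rescaled by `c ^ (-1)` are at most `M`, then so is the
`L^q` norm rescaled accordingly. -/
theorem eLpNorm_le_of_lintegral_le_of_sup_le {X : Type*} [MeasurableSpace X] {μ : Measure X}
    {w : X → ℝ≥0∞} {M : ℝ≥0∞} {c : ℝ} (hc : 0 < c)
    (h1 : ∫⁻ x, w x ∂μ ≤ M) (h2 : ∀ x, ENNReal.ofReal c * w x ≤ M) {q : ℝ≥0∞} (hq1 : 1 ≤ q) :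
    ENNReal.ofReal (c ^ (1 - q.toReal⁻¹)) * eLpNorm w q μ ≤ M := by
  rcases eq_or_ne M ⊤ with rfl | hM
  · exact le_top
  have hc0 : ENNReal.ofReal c ≠ 0 := by simpa using hc
  rcases eq_or_ne q ⊤ with rfl | hq
  · simp only [ENNReal.toReal_top, inv_zero, sub_zero, Real.rpow_one, eLpNorm_exponent_top]
    rw [mul_comm, ← ENNReal.le_div_iff_mul_le (Or.inl hc0) (by simp), eLpNormEssSup_le_iff_ae]
    refine .of_forall fun x => ?_
    rw [ENNReal.le_div_iff_mul_le (Or.inl hc0) (by simp), mul_comm]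
    exact h2 x
  have hq0 : q ≠ 0 := fun h => by simp [h] at hq1
  set p := q.toReal with hp
  have hp1 : 1 ≤ p := by
    rw [hp]; simpa using ENNReal.toReal_mono hq hq1
  have hp0 : 0 < p := by linarith
  rw [eLpNorm_eq_lintegral_rpow_enorm_toReal hq0 hq, ← hp]
  simp only [enorm_eq_self]
  rw [← ENNReal.rpow_le_rpow_iff hp0, ENNReal.mul_rpow_of_nonneg _ _ hp0.le, ← ENNReal.rpow_mul,
    one_div_mul_cancel hp0.ne', ENNReal.rpow_one, ENNReal.ofReal_rpow_of_pos (by positivity),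
    ← Real.rpow_mul hc.le, sub_mul, inv_mul_cancel₀ hp0.ne', one_mul,
    ← lintegral_const_mul' _ _ ENNReal.ofReal_ne_top]
  have hsplit (a : ℝ≥0∞) (ha : a ≠ ⊤) : a ^ p = a ^ (p - 1) * a := by
    rcases eq_or_ne a 0 with h0 | h0
    · simp [h0, ENNReal.zero_rpow_of_pos hp0]
    conv_rhs => enter [2]; rw [← ENNReal.rpow_one a]
    rw [← ENNReal.rpow_add _ _ h0 ha]
    simp
  calc ∫⁻ x, ENNReal.ofReal (c ^ (p - 1)) * w x ^ p ∂μ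
      ≤ ∫⁻ x, M ^ (p - 1) * w x ∂μ := by
        refine lintegral_mono fun x => ?_
        have hwx : w x ≠ ⊤ := by
          intro h
          have := h2 x
          rw [h, ENNReal.mul_top hc0] at this
          exact hM (top_le_iff.1 this)
        rw [hsplit _ hwx, ← mul_assoc, ← ENNReal.ofReal_rpow_of_pos hc,
          ← ENNReal.mul_rpow_of_nonneg _ _ (by linarith)]
        gcongr
        exact h2 x
    _ = M ^ (p - 1) * ∫⁻ x, w x ∂μ :=
        lintegral_const_mul' _ _ (ENNReal.rpow_ne_top_of_nonneg (by linarith) hM)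
    _ ≤ M ^ (p - 1) * M := by gcongr
    _ = M ^ p := (hsplit M hM).symm

/-- `h` is of class `C^k` and its derivatives of order `j ≤ k` are `O((1 + |x|)^{-(a + j)})`. -/
structure DecayE {N : ℕ} (k : ℕ) (a : ℝ) (h : EuclideanSpace ℝ (Fin N) → ℝ) : Prop where
  contDiff : ContDiff ℝ k h
  bound : ∀ j ≤ k, ∃ C : ℝ, ∀ x, (1 + ‖x‖) ^ (a + j) * ‖iteratedFDeriv ℝ j h x‖ ≤ C

namespace DecayE

variable {N : ℕ} {k : ℕ} {a : ℝ} {h : EuclideanSpace ℝ (Fin N) → ℝ}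

theorem mono {k' : ℕ} (H : DecayE k a h) (hk : k' ≤ k) : DecayE k' a h :=
  ⟨H.contDiff.of_le (by exact_mod_cast hk), fun j hj => H.bound j (hj.trans hk)⟩

theorem pderivE (H : DecayE (k + 1) a h) (i : Fin N) : DecayE k (a + 1) (pderivE N i h) := by
  have hc : ContDiff ℝ k (fderiv ℝ h) := H.contDiff.fderiv_right (by norm_cast)
  refine ⟨hc.clm_apply contDiff_const, fun j hj => ?_⟩
  obtain ⟨C, hC⟩ := H.bound (j + 1) (by omega)
  refine ⟨C, fun x => le_trans ?_ (hC x)⟩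
  have h1 : ‖iteratedFDeriv ℝ j (_root_.pderivE N i h) x‖ ≤ ‖iteratedFDeriv ℝ (j + 1) h x‖ := by
    have := norm_iteratedFDeriv_clm_apply_const (𝕜 := ℝ) (f := fderiv ℝ h)
      (c := EuclideanSpace.single i (1 : ℝ)) (x := x) (n := j) hc.contDiffAt (by exact_mod_cast hj)
    rw [norm_iteratedFDeriv_fderiv] at this
    simp only [PiLp.norm_single, norm_one, one_mul] at this
    exact this
  have h2 : a + 1 + (j : ℝ) = a + ((j + 1 : ℕ) : ℝ) := by push_cast; ring
  rw [h2]
  gcongr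

theorem iterate_pderivE (n : ℕ) (H : DecayE (k + n) a h) (i : Fin N) :
    DecayE k (a + n) ((_root_.pderivE N i)^[n] h) := by
  induction n generalizing k with
  | zero => simpa using H
  | succ n ih =>
    rw [Function.iterate_succ_apply']
    have := (ih (k := k + 1) (by convert H using 1; ring)).pderivE i
    convert this using 1
    push_cast; ring

theorem foldr_pderivE (β : Fin N → ℕ) (l : List (Fin N)) (H : DecayE (k + (l.map β).sum) a h) :
    DecayE k (a + ((l.map β).sum : ℕ)) (l.foldr (fun i g => (_root_.pderivE N i)^[β i] g) h) := by
  induction l generalizing k with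
  | nil => simpa using H
  | cons i l ih =>
    have := (ih (k := k + β i) (by convert H using 1; simp; ring)).iterate_pderivE (β i) i
    rw [List.foldr_cons]
    convert this using 1
    simp only [List.map_cons, List.sum_cons]
    push_cast; ring

end DecayE

theorem mderivE_eq_foldr (N : ℕ) (β : Fin N → ℕ) (h : EuclideanSpace ℝ (Fin N) → ℝ) :
    mderivE N β h = (List.finRange N).foldr (fun i g => (pderivE N i)^[β i] g) h := by
  rw [mderivE, List.ofFn_eq_map, List.foldr_map]

theorem DecayE.mderivE {N k : ℕ} {a : ℝ} {h : EuclideanSpace ℝ (Fin N) → ℝ} (β : Fin N → ℕ)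
    (H : DecayE (k + ∑ i, β i) a h) : DecayE k (a + (∑ i, β i : ℕ)) (mderivE N β h) := by
  rw [mderivE_eq_foldr]
  have : ∑ i, β i = ((List.finRange N).map β).sum := by rw [Fin.sum_univ_def]
  rw [this] at H ⊢
  exact H.foldr_pderivE β _

theorem DecayE.exists_norm_le {N k : ℕ} {a : ℝ} {h : EuclideanSpace ℝ (Fin N) → ℝ}
    (H : DecayE k a h) {j : ℕ} (hj : j ≤ k) :
    ∃ C : ℝ, 0 ≤ C ∧ ∀ x, ‖iteratedFDeriv ℝ j h x‖ ≤ C * (1 + ‖x‖) ^ (-(a + j)) := by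
  obtain ⟨C, hC⟩ := H.bound j hj
  refine ⟨C, le_trans (by positivity) (hC 0), fun x => ?_⟩
  rw [Real.rpow_neg (by positivity), ← div_eq_mul_inv, le_div_iff₀ (by positivity), mul_comm]
  exact hC x

theorem DecayE.exists_abs_le {N k : ℕ} {a : ℝ} {h : EuclideanSpace ℝ (Fin N) → ℝ}
    (H : DecayE k a h) : ∃ C : ℝ, 0 ≤ C ∧ ∀ x, |h x| ≤ C * (1 + ‖x‖) ^ (-a) := by
  simpa using H.exists_norm_le (Nat.zero_le k)

theorem integrable_rpow_mul_decay {N : ℕ} {a b : ℝ} (hab : b + N < a) :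
    Integrable fun x : EuclideanSpace ℝ (Fin N) => (1 + ‖x‖) ^ b * (1 + ‖x‖) ^ (-a) := by
  have := integrable_one_add_norm (E := EuclideanSpace ℝ (Fin N)) (μ := volume) (r := a - b)
    (by simp; linarith)
  convert this using 2 with x
  rw [← Real.rpow_add (by positivity)]
  congr 1; ring

theorem DecayE.integrable_mul {N k : ℕ} {a b C : ℝ} {h p : EuclideanSpace ℝ (Fin N) → ℝ}
    (H : DecayE k a h) (hp : Continuous p) (hpb : ∀ x, |p x| ≤ C * (1 + ‖x‖) ^ b)
    (hab : b + N < a) : Integrable fun x => p x * h x := by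
  obtain ⟨C', hC', hb⟩ := H.exists_abs_le
  refine ((integrable_rpow_mul_decay hab).const_mul (C * C')).mono'
    (hp.mul H.contDiff.continuous).aestronglyMeasurable (.of_forall fun x => ?_)
  rw [norm_mul, Real.norm_eq_abs, Real.norm_eq_abs]
  calc |p x| * |h x| ≤ (C * (1 + ‖x‖) ^ b) * (C' * (1 + ‖x‖) ^ (-a)) := by
        gcongr
        · exact (abs_nonneg _).trans (hpb x)
        · exact hpb x
        · exact hb x
    _ = _ := by ring

theorem continuous_mpowE (N : ℕ) (α : Fin N → ℕ) : Continuous (mpowE N α) := by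
  unfold mpowE; fun_prop

theorem abs_mpowE_le (N : ℕ) (α : Fin N → ℕ) (x : EuclideanSpace ℝ (Fin N)) :
    |mpowE N α x| ≤ ‖x‖ ^ (∑ i, α i) := by
  rw [mpowE, Finset.abs_prod, ← Finset.prod_pow_eq_pow_sum]
  refine Finset.prod_le_prod (fun _ _ => abs_nonneg _) fun i _ => ?_
  rw [abs_pow]
  gcongr
  exact PiLp.norm_apply_le x i

theorem abs_mpowE_le_rpow (N : ℕ) (α : Fin N → ℕ) (x : EuclideanSpace ℝ (Fin N)) :
    |mpowE N α x| ≤ 1 * (1 + ‖x‖) ^ (((∑ i, α i : ℕ)) : ℝ) := by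
  rw [one_mul, Real.rpow_natCast]
  exact (abs_mpowE_le N α x).trans (by gcongr; linarith)

theorem DecayE.integrable_mpowE_mul {N k : ℕ} {a : ℝ} {h : EuclideanSpace ℝ (Fin N) → ℝ}
    (H : DecayE k a h) (α : Fin N → ℕ) (hα : ((∑ i, α i : ℕ) : ℝ) + N < a) :
    Integrable fun x => mpowE N α x * h x :=
  H.integrable_mul (continuous_mpowE N α) (abs_mpowE_le_rpow N α) hα

theorem differentiable_mpowE (N : ℕ) (α : Fin N → ℕ) : Differentiable ℝ (mpowE N α) := by
  unfold mpowE; fun_prop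

theorem fderiv_mpowE_single (N : ℕ) (α : Fin N → ℕ) (i : Fin N) (x : EuclideanSpace ℝ (Fin N)) :
    fderiv ℝ (mpowE N α) x (EuclideanSpace.single i 1) =
      α i * mpowE N (Function.update α i (α i - 1)) x := by
  rw [← (differentiable_mpowE N α x).lineDeriv_eq_fderiv, lineDeriv]
  have h1 (β : Fin N → ℕ) (z : EuclideanSpace ℝ (Fin N)) :
      mpowE N β z = z i ^ β i * ∏ j ∈ Finset.univ.erase i, z j ^ β j :=
    (Finset.mul_prod_erase Finset.univ (fun j => z j ^ β j) (Finset.mem_univ i)).symm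
  have h2 (t : ℝ) : mpowE N α (x + t • EuclideanSpace.single i 1) =
      (x i + t) ^ α i * ∏ j ∈ Finset.univ.erase i, x j ^ α j := by
    rw [h1]
    congr 1
    · simp
    · refine Finset.prod_congr rfl fun j hj => ?_
      simp [Finset.ne_of_mem_erase hj]
  simp_rw [h2]
  have h3 : HasDerivAt (fun t : ℝ => (x i + t) ^ α i) (α i * (x i + 0) ^ (α i - 1) * 1) 0 :=
    ((hasDerivAt_id (0 : ℝ)).const_add (x i)).pow (α i)
  rw [(h3.mul_const _).deriv, h1]
  simp only [add_zero, mul_one, Function.update_self, mul_assoc]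
  congr 2
  refine Finset.prod_congr rfl fun j hj => ?_
  rw [Function.update_of_ne (Finset.ne_of_mem_erase hj)]

theorem sum_update_le {N : ℕ} (α : Fin N → ℕ) (i : Fin N) (n : ℕ) :
    ∑ j, Function.update α i (α i - n) j ≤ ∑ j, α j := by
  refine Finset.sum_le_sum fun j _ => ?_
  by_cases hj : j = i
  · subst hj; simp
  · simp [hj]

theorem momE_pderivE {N : ℕ} {a : ℝ} {h : EuclideanSpace ℝ (Fin N) → ℝ} (H : DecayE 1 a h)
    (α : Fin N → ℕ) (hα : ((∑ i, α i : ℕ) : ℝ) + N < a) (i : Fin N) :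
    momE N α (pderivE N i h) = -(α i * momE N (Function.update α i (α i - 1)) h) := by
  unfold momE
  have hα' : ((∑ j, Function.update α i (α i - 1) j : ℕ) : ℝ) + N < a := by
    have : ((∑ j, Function.update α i (α i - 1) j : ℕ) : ℝ) ≤ (∑ i, α i : ℕ) := by
      exact_mod_cast sum_update_le α i 1
    linarith
  have := integral_mul_fderiv_eq_neg_fderiv_mul_of_integrable (μ := volume) (f := mpowE N α)
    (g := h) (v := EuclideanSpace.single i 1) ?_ ?_ (H.integrable_mpowE_mul α hα)
    (fun x _ => differentiable_mpowE N α x)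
    (fun x _ => (H.contDiff.differentiable (by simp)) x)
  · rw [← integral_const_mul]
    simp only [pderivE]
    rw [this]
    simp_rw [fderiv_mpowE_single, mul_assoc]
  · simp_rw [fderiv_mpowE_single, mul_assoc]
    exact (H.integrable_mpowE_mul _ hα').const_mul _
  · exact (H.pderivE i).integrable_mpowE_mul α (by linarith)

theorem momE_iterate_pderivE {N : ℕ} {a : ℝ} {h : EuclideanSpace ℝ (Fin N) → ℝ} (i : Fin N) (n : ℕ)
    (H : DecayE n a h) (α : Fin N → ℕ) (hα : ((∑ i, α i : ℕ) : ℝ) + N < a) :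
    momE N α ((pderivE N i)^[n] h) =
      (-1) ^ n * (α i).descFactorial n * momE N (Function.update α i (α i - n)) h := by
  induction n generalizing α with
  | zero => simp
  | succ n ih =>
    have h1 : ((∑ j, Function.update α i (α i - 1) j : ℕ) : ℝ) ≤ (∑ i, α i : ℕ) := by
      exact_mod_cast sum_update_le α i 1
    rw [Function.iterate_succ_apply', momE_pderivE (a := a + n) ?_ α ?_ i,
      ih (H.mono (by omega)) _ (by linarith)]
    · rcases Nat.eq_zero_or_pos (α i) with h0 | h0
      · simp [h0]
      · obtain ⟨m, hm⟩ := Nat.exists_eq_succ_of_ne_zero h0.ne'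
        simp only [Function.update_self, Function.update_idem, hm, Nat.succ_eq_add_one,
          Nat.add_sub_cancel, Nat.succ_descFactorial_succ, Nat.reduceSubDiff]
        push_cast
        ring
    · exact (H.mono (by omega)).iterate_pderivE n i
    · have : (0 : ℝ) ≤ n := by positivity
      linarith

theorem momE_foldr_pderivE {N : ℕ} {a : ℝ} {h : EuclideanSpace ℝ (Fin N) → ℝ} (β : Fin N → ℕ)
    (l : List (Fin N)) (hl : l.Nodup) (H : DecayE (l.map β).sum a h) (α : Fin N → ℕ)
    (hα : ((∑ i, α i : ℕ) : ℝ) + N < a) :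
    momE N α (l.foldr (fun i g => (pderivE N i)^[β i] g) h) =
      (l.map fun i => (-1 : ℝ) ^ β i * (α i).descFactorial (β i)).prod *
        momE N (fun i => if i ∈ l then α i - β i else α i) h := by
  induction l generalizing α with
  | nil => simp
  | cons i l ih =>
    simp only [List.nodup_cons] at hl
    simp only [List.map_cons, List.sum_cons] at H
    have h1 : ((∑ j, Function.update α i (α i - β i) j : ℕ) : ℝ) ≤ (∑ i, α i : ℕ) := by
      exact_mod_cast sum_update_le α i (β i)
    rw [List.foldr_cons, momE_iterate_pderivE (a := a + ((l.map β).sum : ℕ)) i (β i)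
      (H.foldr_pderivE β l) α ?_, ih hl.2 (H.mono (by omega)) _ (by linarith), List.map_cons,
      List.prod_cons, ← mul_assoc]
    · congr 1
      · congr 2
        refine List.map_congr_left fun j hj => ?_
        rw [Function.update_of_ne (fun e : j = i => hl.1 (e ▸ hj))]
      · congr 1
        funext j
        by_cases hj : j = i
        · subst hj; simp [hl.1]
        · simp [hj]
    · have : (0 : ℝ) ≤ ((l.map β).sum : ℕ) := by positivity
      linarith

theorem momE_mderivE {N : ℕ} {a : ℝ} {h : EuclideanSpace ℝ (Fin N) → ℝ} (β : Fin N → ℕ)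
    (H : DecayE (∑ i, β i) a h) (α : Fin N → ℕ) (hα : ((∑ i, α i : ℕ) : ℝ) + N < a) :
    momE N α (mderivE N β h) =
      (-1) ^ (∑ i, β i) * (∏ i, (α i).descFactorial (β i) : ℕ) * momE N (α - β) h := by
  have hs : ∑ i, β i = ((List.finRange N).map β).sum := by rw [Fin.sum_univ_def]
  rw [hs] at H
  rw [mderivE_eq_foldr, momE_foldr_pderivE β _ (List.nodup_finRange N) H α hα, ← Fin.prod_univ_def,
    Finset.prod_mul_distrib, Finset.prod_pow_eq_pow_sum]
  push_cast
  congr 2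
  ext i
  simp

theorem pderivE_const_mul_comp_smul (N : ℕ) (i : Fin N) (c b : ℝ)
    (h : EuclideanSpace ℝ (Fin N) → ℝ) :
    pderivE N i (fun x => c * h (b • x)) = fun x => (c * b) * pderivE N i h (b • x) := by
  ext x
  unfold pderivE
  have h1 : (fun x => c * h (b • x)) = c • fun x => h (b • x) := rfl
  rw [h1, fderiv_const_smul_field, Pi.smul_apply, fderiv_comp_smul]
  simp [mul_assoc]

theorem mderivE_const_mul_comp_smul (N : ℕ) (β : Fin N → ℕ) (c b : ℝ)
    (h : EuclideanSpace ℝ (Fin N) → ℝ) :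
    mderivE N β (fun x => c * h (b • x)) =
      fun x => (c * b ^ (∑ i, β i)) * mderivE N β h (b • x) := by
  have hs : ∑ i, β i = ((List.finRange N).map β).sum := by rw [Fin.sum_univ_def]
  rw [mderivE_eq_foldr, mderivE_eq_foldr, hs]
  induction List.finRange N with
  | nil => simp
  | cons i l ih =>
    have hit (n : ℕ) (c : ℝ) (g : EuclideanSpace ℝ (Fin N) → ℝ) :
        (pderivE N i)^[n] (fun x => c * g (b • x)) =
          fun x => (c * b ^ n) * (pderivE N i)^[n] g (b • x) := by
      induction n generalizing c g with
      | zero => simp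
      | succ n ih =>
        rw [Function.iterate_succ_apply, pderivE_const_mul_comp_smul, ih]
        ext x
        rw [Function.iterate_succ_apply]
        ring
    simp only [List.foldr_cons, ih, hit, List.map_cons, List.sum_cons]
    ext x
    ring

namespace CondG

variable {N γ : ℕ} {d L : ℝ} {G : EuclideanSpace ℝ (Fin N) → ℝ → ℝ}

theorem decayE (hG : CondG N G γ d L) : DecayE γ (N + L) fun y => G y 1 := by
  refine ⟨?_, hG.decay⟩
  have h1 : ContDiff ℝ γ fun x : EuclideanSpace ℝ (Fin N) => (x, (1 : ℝ)) := by fun_prop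
  have h2 : ContDiffOn ℝ γ ((fun p : EuclideanSpace ℝ (Fin N) × ℝ => G p.1 p.2) ∘ fun x => (x, 1))
      Set.univ := hG.smooth.comp h1.contDiffOn (by intro x _; simp)
  exact contDiffOn_univ.1 h2

theorem eq_scaled (hG : CondG N G γ d L) (x : EuclideanSpace ℝ (Fin N)) {t : ℝ} (ht : 0 < t) :
    G x t = ((t ^ (1 / d)) ^ N)⁻¹ * G ((t ^ (1 / d))⁻¹ • x) 1 := by
  rw [hG.scaling x t ht]
  congr 2
  · rw [← Real.rpow_natCast, ← Real.rpow_mul ht.le, ← Real.rpow_neg ht.le]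
    congr 1; ring
  · rw [← Real.rpow_neg ht.le]
    congr 2; ring

theorem integral_mul_self (hG : CondG N G γ d L) (hd : 0 < d) (hL : 0 < L)
    (x : EuclideanSpace ℝ (Fin N)) : G x 1 = (∫ y, G y 1) * G x 1 := by
  have hH := hG.decayE
  have hc : Continuous fun y => G y 1 := hH.contDiff.continuous
  obtain ⟨C, hC0, hC⟩ := hH.exists_abs_le
  have hCb (y : EuclideanSpace ℝ (Fin N)) : |G y 1| ≤ C := by
    refine (hC y).trans ?_
    have : (1 + ‖y‖) ^ (-((N : ℝ) + L)) ≤ 1 :=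
      Real.rpow_le_one_of_one_le_of_nonpos (by linarith [norm_nonneg y])
        (by have : (0 : ℝ) ≤ N := by positivity
            linarith)
    nlinarith
  have hGint : Integrable fun y => G y 1 := by
    simpa using hH.integrable_mul (p := fun _ => (1 : ℝ)) (C := 1) (b := 0) continuous_const
      (fun x => by simp) (by linarith)
  have hr (s : ℝ) (hs : 0 < s) (hs1 : s < 1) :
      ∫ z, (((1 - s) ^ (1 / d)) ^ N)⁻¹ * G (((1 - s) ^ (1 / d))⁻¹ • (x - s ^ (1 / d) • z)) 1 *
        G z 1 = G x 1 := by
    have hrs : 0 < s ^ (1 / d) := Real.rpow_pos_of_pos hs _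
    rw [hG.semigroup x 1 s hs hs1]
    set r := s ^ (1 / d) with hr
    have h1 := Measure.integral_comp_smul (volume : Measure (EuclideanSpace ℝ (Fin N)))
      (fun z => (((1 - s) ^ (1 / d)) ^ N)⁻¹ * G (((1 - s) ^ (1 / d))⁻¹ • (x - r • z)) 1 *
        G z 1) r⁻¹
    rw [abs_of_pos (by positivity), finrank_euclideanSpace_fin, smul_eq_mul, inv_pow, inv_inv] at h1
    have h2 := (eq_inv_mul_iff_mul_eq₀ (by positivity)).2 h1.symm
    rw [← integral_const_mul] at h2
    rw [h2]
    refine integral_congr_ae (.of_forall fun y => ?_)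
    simp only
    rw [hG.eq_scaled (x - y) (sub_pos.2 hs1), hG.eq_scaled y hs, ← hr, smul_smul,
      mul_inv_cancel₀ hrs.ne', one_smul]
    ring
  have hinv : 0 < 1 / d := by positivity
  have ht1 : Tendsto (fun s : ℝ => (1 - s) ^ (1 / d)) (𝓝[>] 0) (𝓝 1) := by
    have : ContinuousAt (fun s : ℝ => (1 - s) ^ (1 / d)) 0 :=
      ContinuousAt.rpow_const (by fun_prop) (by simp)
    have := this.tendsto.mono_left (nhdsWithin_le_nhds (s := Set.Ioi 0))
    simpa using this
  have ht0 : Tendsto (fun s : ℝ => s ^ (1 / d)) (𝓝[>] 0) (𝓝 0) := by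
    have : ContinuousAt (fun s : ℝ => s ^ (1 / d)) 0 :=
      ContinuousAt.rpow_const (by fun_prop) (Or.inr hinv.le)
    have := this.tendsto.mono_left (nhdsWithin_le_nhds (s := Set.Ioi 0))
    simpa [Real.zero_rpow hinv.ne', Real.zero_rpow (inv_pos.2 hd).ne'] using this
  have hlim : Tendsto (fun s : ℝ => ∫ z, (((1 - s) ^ (1 / d)) ^ N)⁻¹ *
      G (((1 - s) ^ (1 / d))⁻¹ • (x - s ^ (1 / d) • z)) 1 * G z 1) (𝓝[>] 0)
      (𝓝 (∫ z, G x 1 * G z 1)) := by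
    have hbd : ∀ᶠ s : ℝ in 𝓝[>] 0, (((1 - s) ^ (1 / d)) ^ N)⁻¹ < 2 := by
      have : Tendsto (fun s : ℝ => (((1 - s) ^ (1 / d)) ^ N)⁻¹) (𝓝[>] 0) (𝓝 1) := by
        simpa using (ht1.pow N).inv₀ (by simp)
      exact this.eventually_lt_const (by norm_num)
    have hpos : ∀ᶠ s : ℝ in 𝓝[>] 0, 0 < (1 - s) ^ (1 / d) := ht1.eventually_const_lt one_pos
    refine tendsto_integral_filter_of_dominated_convergence (fun z => 2 * C * |G z 1|) ?_ ?_ ?_ ?_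
    · refine .of_forall fun s => Continuous.aestronglyMeasurable ?_
      exact (continuous_const.mul (hc.comp (by fun_prop))).mul hc
    · filter_upwards [hbd, hpos] with s hs hs0
      refine .of_forall fun z => ?_
      rw [norm_mul, norm_mul, Real.norm_eq_abs, Real.norm_eq_abs, Real.norm_eq_abs,
        abs_of_pos (by positivity : 0 < (((1 - s) ^ (1 / d)) ^ N)⁻¹)]
      gcongr
      exact hCb _
    · exact hGint.abs.const_mul _
    · refine .of_forall fun z => Tendsto.mul_const _ ?_
      have h1 : Tendsto (fun s : ℝ => (((1 - s) ^ (1 / d)) ^ N)⁻¹) (𝓝[>] 0) (𝓝 1) := by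
        simpa using (ht1.pow N).inv₀ (by simp)
      have h2 : Tendsto (fun s : ℝ => ((1 - s) ^ (1 / d))⁻¹ • (x - s ^ (1 / d) • z))
          (𝓝[>] 0) (𝓝 x) := by
        simpa using (ht1.inv₀ (by simp)).smul (tendsto_const_nhds.sub (ht0.smul_const z))
      simpa using h1.mul ((hc.tendsto x).comp h2)
  have hconst : Tendsto (fun s : ℝ => ∫ z, (((1 - s) ^ (1 / d)) ^ N)⁻¹ *
      G (((1 - s) ^ (1 / d))⁻¹ • (x - s ^ (1 / d) • z)) 1 * G z 1) (𝓝[>] 0) (𝓝 (G x 1)) := by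
    refine tendsto_const_nhds.congr' ?_
    filter_upwards [Ioo_mem_nhdsGT (zero_lt_one' ℝ)] with s hs
    exact (hr s hs.1 hs.2).symm
  exact (tendsto_nhds_unique hconst hlim).trans (by rw [integral_const_mul, mul_comm])

/-- Either the kernel vanishes identically or it has total mass one. -/
theorem eq_zero_or_integral_eq_one (hG : CondG N G γ d L) (hd : 0 < d) (hL : 0 < L) :
    (∀ x t, 0 < t → G x t = 0) ∨ ∫ y, G y 1 = 1 := by
  by_cases h : ∀ x, G x 1 = 0
  · left
    intro x t ht
    rw [hG.eq_scaled x ht, h, mul_zero]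
  · right
    push Not at h
    obtain ⟨x, hx⟩ := h
    exact mul_right_cancel₀ hx ((hG.integral_mul_self hd hL x).symm.trans (one_mul _).symm)

theorem gA_scaled (hG : CondG N G γ d L) (α : Fin N → ℕ) (x : EuclideanSpace ℝ (Fin N)) {t : ℝ}
    (ht : 0 < 1 + t) :
    gA N G α x t = ((((1 + t) ^ (1 / d)) ^ N)⁻¹ * (((1 + t) ^ (1 / d))⁻¹) ^ (∑ i, α i)) *
      gA N G α (((1 + t) ^ (1 / d))⁻¹ • x) 0 := by
  have h1 : (fun y => G y (t + 1)) = fun y =>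
      (((1 + t) ^ (1 / d)) ^ N)⁻¹ * G (((1 + t) ^ (1 / d))⁻¹ • y) 1 := by
    ext y
    rw [add_comm, hG.eq_scaled y ht]
  unfold gA
  rw [h1, mderivE_const_mul_comp_smul N α _ _ fun y => G y 1, zero_add]
  ring

theorem decayE_gA (hG : CondG N G γ d L) (α : Fin N → ℕ) (hα : ∑ i, α i ≤ γ) :
    DecayE 0 (N + L + (∑ i, α i : ℕ)) fun x => gA N G α x 0 := by
  have h1 : DecayE 0 (N + L + (∑ i, α i : ℕ)) (mderivE N α fun y => G y 1) :=
    DecayE.mderivE α (hG.decayE.mono (by omega))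
  unfold gA
  rw [zero_add]
  refine ⟨contDiff_const.mul h1.contDiff, fun j hj => ?_⟩
  obtain rfl : j = 0 := by omega
  obtain ⟨C, hC⟩ := h1.bound 0 le_rfl
  refine ⟨|(-1 : ℝ) ^ (∑ i, α i) / (mfactE N α : ℝ)| * C, fun x => ?_⟩
  have := mul_le_mul_of_nonneg_left (hC x) (abs_nonneg ((-1 : ℝ) ^ (∑ i, α i) / (mfactE N α : ℝ)))
  refine le_trans (le_of_eq ?_) this
  simp only [norm_iteratedFDeriv_zero, norm_mul, Real.norm_eq_abs]
  ring

end CondG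

theorem mpowE_smul (N : ℕ) (α : Fin N → ℕ) (c : ℝ) (x : EuclideanSpace ℝ (Fin N)) :
    mpowE N α (c • x) = c ^ (∑ i, α i) * mpowE N α x := by
  simp [mpowE, mul_pow, Finset.prod_mul_distrib, Finset.prod_pow_eq_pow_sum]

namespace CondG

variable {N γ : ℕ} {d L : ℝ} {G : EuclideanSpace ℝ (Fin N) → ℝ → ℝ}

theorem integral_mpowE_mul_gA_zero (hG : CondG N G γ d L) (α β : Fin N → ℕ)
    (hα : ((∑ i, α i : ℕ) : ℝ) < L) (hβ : ∑ i, β i ≤ γ) :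
    ∫ x, mpowE N α x * gA N G β x 0 =
      ((∏ i, (α i).descFactorial (β i) : ℕ) / mfactE N β : ℝ) * momE N (α - β) fun y => G y 1 := by
  have h1 := momE_mderivE β (hG.decayE.mono hβ) α (by linarith)
  unfold gA
  rw [zero_add]
  simp_rw [mul_left_comm (mpowE N α _)]
  rw [integral_const_mul]
  rw [momE] at h1
  rw [h1]
  have : ((-1 : ℝ) ^ (∑ i, β i)) * (-1) ^ (∑ i, β i) = 1 := by
    rw [← mul_pow]; simp
  linear_combination (1 / (mfactE N β : ℝ)) * ((∏ i, (α i).descFactorial (β i) : ℕ) : ℝ) *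
    (momE N (α - β) fun y => G y 1) * this

theorem integral_mpowE_mul_gA_scaled (hG : CondG N G γ d L) (α β : Fin N → ℕ) {t : ℝ}
    (ht : 0 < 1 + t) :
    ∫ x, mpowE N α x * gA N G β x t =
      ((1 + t) ^ (1 / d)) ^ (∑ i, α i) * (((1 + t) ^ (1 / d))⁻¹) ^ (∑ i, β i) *
        ∫ x, mpowE N α x * gA N G β x 0 := by
  have hτ : 0 < (1 + t) ^ (1 / d) := Real.rpow_pos_of_pos ht _
  simp_rw [hG.gA_scaled β _ ht]
  set τ := (1 + t) ^ (1 / d)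
  have h1 := Measure.integral_comp_smul (volume : Measure (EuclideanSpace ℝ (Fin N)))
    (fun z => mpowE N α (τ • z) * gA N G β z 0) τ⁻¹
  simp_rw [smul_smul, mul_inv_cancel₀ hτ.ne', one_smul, mpowE_smul] at h1
  simp_rw [mul_left_comm (mpowE N α _)]
  rw [integral_const_mul, h1, abs_of_pos (by positivity), finrank_euclideanSpace_fin, smul_eq_mul]
  simp_rw [mul_assoc]
  rw [integral_const_mul, inv_pow τ N, inv_inv]
  have hτN : (τ ^ N)⁻¹ * τ ^ N = 1 := inv_mul_cancel₀ (by positivity)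
  linear_combination τ⁻¹ ^ (∑ i, β i) * τ ^ (∑ i, α i) * (∫ x, mpowE N α x * gA N G β x 0) * hτN

theorem integral_mpowE_mul_gA_self (hG : CondG N G γ d L) (hmass : ∫ y, G y 1 = 1)
    (α : Fin N → ℕ) (hα : ((∑ i, α i : ℕ) : ℝ) < L) (hα' : ∑ i, α i ≤ γ) {t : ℝ}
    (ht : 0 < 1 + t) : ∫ x, mpowE N α x * gA N G α x t = 1 := by
  have hτ : 0 < (1 + t) ^ (1 / d) := Real.rpow_pos_of_pos ht _
  rw [hG.integral_mpowE_mul_gA_scaled α α ht, hG.integral_mpowE_mul_gA_zero α α hα hα']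
  have h1 : momE N (α - α) (fun y => G y 1) = 1 := by
    simp [momE, mpowE, hmass]
  have h2 : (mfactE N α : ℝ) ≠ 0 := by
    simp [mfactE, Finset.prod_ne_zero_iff, Nat.factorial_ne_zero]
  simp_rw [h1, Nat.descFactorial_self]
  change _ * ((mfactE N α : ℝ) / _ * 1) = 1
  rw [div_self h2, ← mul_pow, mul_inv_cancel₀ hτ.ne']
  simp

theorem integral_mpowE_mul_gA_of_not_le (hG : CondG N G γ d L)
    (α β : Fin N → ℕ) (hα : ((∑ i, α i : ℕ) : ℝ) < L) (hβ : ∑ i, β i ≤ γ) (hβα : ¬ β ≤ α) {t : ℝ}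
    (ht : 0 < 1 + t) : ∫ x, mpowE N α x * gA N G β x t = 0 := by
  rw [hG.integral_mpowE_mul_gA_scaled α β ht, hG.integral_mpowE_mul_gA_zero α β hα hβ]
  obtain ⟨i, hi⟩ : ∃ i, α i < β i := by
    simpa [Pi.le_def] using hβα
  rw [Finset.prod_eq_zero (Finset.mem_univ i) (Nat.descFactorial_eq_zero_iff_lt.2 hi)]
  simp

end CondG

theorem sum_lt_of_mem_erase {N : ℕ} {α β : Fin N → ℕ} (hβ : β ∈ (Finset.Iic α).erase α) :
    ∑ i, β i < ∑ i, α i := by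
  rw [Finset.mem_erase, Finset.mem_Iic] at hβ
  obtain ⟨i, hi⟩ := (Pi.lt_def.1 (lt_of_le_of_ne hβ.2 hβ.1)).2
  exact Finset.sum_lt_sum (fun j _ => hβ.2 j) ⟨i, Finset.mem_univ i, hi⟩

theorem McoefAux_succ (N : ℕ) (G : EuclideanSpace ℝ (Fin N) → ℝ → ℝ)
    (f : EuclideanSpace ℝ (Fin N) → ℝ) (t : ℝ) (n : ℕ) (α : Fin N → ℕ) (hn : ∑ i, α i ≤ n) :
    McoefAux N G f t (n + 1) α = McoefAux N G f t n α := by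
  induction n generalizing α with
  | zero =>
    have h0 : (Finset.Iic α).erase α = ∅ := by
      rw [Finset.eq_empty_iff_forall_notMem]
      intro β hβ
      have := sum_lt_of_mem_erase hβ
      omega
    simp [McoefAux, h0]
  | succ n ih =>
    rw [McoefAux, McoefAux]
    congr 1
    refine Finset.sum_congr rfl fun β hβ => ?_
    rw [ih β (by have := sum_lt_of_mem_erase hβ; omega)]

theorem McoefAux_eq_Mcoef (N : ℕ) (G : EuclideanSpace ℝ (Fin N) → ℝ → ℝ)
    (f : EuclideanSpace ℝ (Fin N) → ℝ) (t : ℝ) (n : ℕ) (α : Fin N → ℕ) (hn : ∑ i, α i ≤ n) :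
    McoefAux N G f t n α = Mcoef N G f t α := by
  induction n, hn using Nat.le_induction with
  | base => rfl
  | succ n hn ih => rw [McoefAux_succ N G f t n α hn, ih]

theorem Mcoef_eq (N : ℕ) (G : EuclideanSpace ℝ (Fin N) → ℝ → ℝ)
    (f : EuclideanSpace ℝ (Fin N) → ℝ) (t : ℝ) (α : Fin N → ℕ) :
    Mcoef N G f t α = momE N α f -
      ∑ β ∈ (Finset.Iic α).erase α, Mcoef N G f t β * ∫ x, mpowE N α x * gA N G β x t := by
  rw [← McoefAux_eq_Mcoef N G f t (∑ i, α i + 1) α (by omega), McoefAux]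
  congr 1
  refine Finset.sum_congr rfl fun β hβ => ?_
  rw [McoefAux_eq_Mcoef N G f t _ β (sum_lt_of_mem_erase hβ).le]

theorem mem_multiIdx {N m : ℕ} {α : Fin N → ℕ} : α ∈ multiIdx N m ↔ ∑ i, α i ≤ m := by
  simp only [multiIdx, Finset.mem_filter, Finset.mem_Iic, and_iff_right_iff_imp]
  intro h i
  exact (Finset.single_le_sum (f := α) (fun _ _ => Nat.zero_le _) (Finset.mem_univ i)).trans h

/-- The moments of order at most `K` of `P_K(t) f` vanish. -/
theorem CondG.integral_mpowE_mul_PKop {N γ : ℕ} {d L K : ℝ}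
    {G : EuclideanSpace ℝ (Fin N) → ℝ → ℝ} (hG : CondG N G γ d L) (hmass : ∫ y, G y 1 = 1)
    (hK0 : 0 ≤ K) (hKL : K < L) (hKγ : ⌊K⌋₊ ≤ γ) {t : ℝ} (ht : 0 < 1 + t)
    {f : EuclideanSpace ℝ (Fin N) → ℝ}
    (α : Fin N → ℕ) (hα : ∑ i, α i ≤ ⌊K⌋₊) (hf : Integrable fun x => mpowE N α x * f x) :
    ∫ x, mpowE N α x * PKop N G K t f x = 0 := by
  have hle : ((∑ i, α i : ℕ) : ℝ) < L :=
    lt_of_le_of_lt (le_trans (by exact_mod_cast hα) (Nat.floor_le hK0)) hKL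
  have hgint (β : Fin N → ℕ) (hβ : ∑ i, β i ≤ ⌊K⌋₊) :
      Integrable fun x => mpowE N α x * gA N G β x t := by
    have hτ : 0 < (1 + t) ^ (1 / d) := Real.rpow_pos_of_pos ht _
    simp_rw [hG.gA_scaled β _ ht]
    set τ := (1 + t) ^ (1 / d)
    have h0 : Integrable fun x => mpowE N α x * gA N G β x 0 :=
      (hG.decayE_gA β (hβ.trans hKγ)).integrable_mpowE_mul α (by
        have : (0 : ℝ) ≤ (∑ i, β i : ℕ) := by positivity
        linarith)
    have h1 := (h0.comp_smul (inv_ne_zero hτ.ne')).const_mul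
      (τ ^ (∑ i, α i) * ((τ ^ N)⁻¹ * τ⁻¹ ^ ∑ i, β i))
    refine h1.congr (.of_forall fun x => ?_)
    simp only [mpowE_smul]
    have h2 : τ ^ (∑ i, α i) * τ⁻¹ ^ (∑ i, α i) = 1 := by
      rw [← mul_pow, mul_inv_cancel₀ hτ.ne', one_pow]
    linear_combination ((τ ^ N)⁻¹ * τ⁻¹ ^ ∑ i, β i) * mpowE N α x * gA N G β (τ⁻¹ • x) 0 * h2
  unfold PKop
  simp_rw [mul_sub, Finset.mul_sum, mul_left_comm (mpowE N α _)]
  rw [integral_sub hf, integral_finsetSum]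
  · simp_rw [integral_const_mul]
    have hsub : Finset.Iic α ⊆ multiIdx N ⌊K⌋₊ := fun β hβ =>
      mem_multiIdx.2 ((Finset.sum_le_sum fun i _ => Finset.mem_Iic.1 hβ i).trans hα)
    rw [← Finset.sum_subset hsub, ← Finset.add_sum_erase _ _ (Finset.mem_Iic.2 le_rfl),
      hG.integral_mpowE_mul_gA_self hmass α hle (hα.trans hKγ) ht, Mcoef_eq N G f t α, momE]
    · ring
    · intro β hβ hβα
      rw [hG.integral_mpowE_mul_gA_of_not_le α β hle ((mem_multiIdx.1 hβ).trans hKγ)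
        (by simpa using hβα) ht, mul_zero]
  · exact fun β hβ => (hgint β (mem_multiIdx.1 hβ)).const_mul _
  · exact integrable_finsetSum _ fun β hβ => (hgint β (mem_multiIdx.1 hβ)).const_mul _

/-- The shifted radial weight `(ρ + ‖x‖) ^ K`. -/
noncomputable def radWeight {N : ℕ} (K ρ : ℝ) (x : EuclideanSpace ℝ (Fin N)) : ℝ≥0∞ :=
  ENNReal.ofReal ((ρ + ‖x‖) ^ K)

/-- The `L¹` norm with weight `(ρ + ‖x‖) ^ K`. -/
noncomputable def radNorm {N : ℕ} (K ρ : ℝ) (φ : EuclideanSpace ℝ (Fin N) → ℝ) : ℝ≥0∞ :=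
  ∫⁻ x, radWeight K ρ x * ‖φ x‖ₑ

theorem measurable_radWeight {N : ℕ} (K ρ : ℝ) :
    Measurable (radWeight K ρ : EuclideanSpace ℝ (Fin N) → ℝ≥0∞) := by
  unfold radWeight; fun_prop

theorem radWeight_eq_scaled {N : ℕ} (K : ℝ) {ρ : ℝ} (hρ : 0 < ρ) (x : EuclideanSpace ℝ (Fin N)) :
    radWeight K ρ x = ENNReal.ofReal (ρ ^ K) * radWeight K 1 (ρ⁻¹ • x) := by
  have := norm_nonneg x
  rw [radWeight, radWeight, ← ENNReal.ofReal_mul (by positivity),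
    ← Real.mul_rpow hρ.le (by positivity), norm_smul, norm_inv, Real.norm_of_nonneg hρ.le]
  congr 2
  field_simp

theorem lintegral_comp_inv_smul {N : ℕ} (F : EuclideanSpace ℝ (Fin N) → ℝ≥0∞) {c : ℝ}
    (hc : 0 < c) : ∫⁻ x, F (c⁻¹ • x) = ENNReal.ofReal (c ^ N) * ∫⁻ x, F x := by
  have h1 := Measure.map_addHaar_smul (volume : Measure (EuclideanSpace ℝ (Fin N)))
    (inv_ne_zero hc.ne')
  have h2 : MeasurableEmbedding fun x : EuclideanSpace ℝ (Fin N) => c⁻¹ • x :=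
    (Homeomorph.smulOfNeZero c⁻¹ (inv_ne_zero hc.ne')).measurableEmbedding
  rw [← h2.lintegral_map F]
  erw [h1]
  rw [lintegral_smul_measure, finrank_euclideanSpace_fin, inv_pow, inv_inv,
    abs_of_pos (by positivity), smul_eq_mul]

theorem lintegral_radWeight_mul_comp_inv_smul {N : ℕ} (K : ℝ)
    (F : EuclideanSpace ℝ (Fin N) → ℝ≥0∞) {ρ : ℝ} (hρ : 0 < ρ) :
    ∫⁻ x, radWeight K ρ x * F (ρ⁻¹ • x) =
      ENNReal.ofReal (ρ ^ (K + N)) * ∫⁻ x, radWeight K 1 x * F x := by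
  simp_rw [radWeight_eq_scaled K hρ, mul_assoc]
  rw [lintegral_const_mul' _ _ ENNReal.ofReal_ne_top,
    lintegral_comp_inv_smul (fun x => radWeight K 1 x * F x) hρ, ← mul_assoc,
    ← ENNReal.ofReal_mul (by positivity), Real.rpow_add hρ, Real.rpow_natCast]

theorem DecayE.lintegral_radWeight_lt_top {N k : ℕ} {a K : ℝ}
    {h : EuclideanSpace ℝ (Fin N) → ℝ} (H : DecayE k a h) (hab : K + N < a) :
    ∫⁻ x, radWeight K 1 x * ‖h x‖ₑ < ⊤ := by
  have h1 : Continuous fun x : EuclideanSpace ℝ (Fin N) => (1 + ‖x‖) ^ K :=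
    (continuous_const.add continuous_norm).rpow_const
      fun x => Or.inl (by positivity : (1 : ℝ) + ‖x‖ ≠ 0)
  have h2 := (H.integrable_mul (p := fun x => (1 + ‖x‖) ^ K) (C := 1) (b := K) h1
    (fun x => by
      have := norm_nonneg x
      rw [one_mul, abs_of_nonneg (by positivity)]) hab).hasFiniteIntegral
  refine lt_of_le_of_lt (le_of_eq (lintegral_congr fun x => ?_)) h2
  have := norm_nonneg x
  rw [enorm_mul, radWeight, Real.enorm_of_nonneg (r := (1 + ‖x‖) ^ K) (by positivity)]

theorem DecayE.exists_enorm_le {N k : ℕ} {a : ℝ} {h : EuclideanSpace ℝ (Fin N) → ℝ}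
    (H : DecayE k a h) (ha : 0 ≤ a) : ∃ C : ℝ, ∀ x, ‖h x‖ₑ ≤ ENNReal.ofReal C := by
  obtain ⟨C, hC0, hC⟩ := H.exists_abs_le
  refine ⟨C, fun x => ?_⟩
  rw [Real.enorm_eq_ofReal_abs]
  refine ENNReal.ofReal_le_ofReal ((hC x).trans (mul_le_of_le_one_right hC0 ?_))
  exact Real.rpow_le_one_of_one_le_of_nonpos (by linarith [norm_nonneg x]) (by linarith)

namespace CondG

variable {N γ : ℕ} {d L : ℝ} {G : EuclideanSpace ℝ (Fin N) → ℝ → ℝ}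

theorem enorm_gA_scaled (hG : CondG N G γ d L) (α : Fin N → ℕ) (x : EuclideanSpace ℝ (Fin N))
    {t : ℝ} (ht : 0 < 1 + t) :
    ‖gA N G α x t‖ₑ = ENNReal.ofReal (((1 + t) ^ (1 / d)) ^ (-((N : ℝ) + (∑ i, α i : ℕ)))) *
      ‖gA N G α (((1 + t) ^ (1 / d))⁻¹ • x) 0‖ₑ := by
  have hτ : 0 < (1 + t) ^ (1 / d) := Real.rpow_pos_of_pos ht _
  rw [hG.gA_scaled α x ht, enorm_mul, Real.enorm_of_nonneg (by positivity), neg_add,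
    Real.rpow_add hτ, Real.rpow_neg hτ.le, Real.rpow_neg hτ.le, Real.rpow_natCast,
    Real.rpow_natCast, inv_pow]

/-- Weighted `L¹` estimate for the profiles `g_α`. -/
theorem exists_radNorm_gA_le (hG : CondG N G γ d L) (α : Fin N → ℕ) (hα : ∑ i, α i ≤ γ) {K : ℝ}
    (hK : K < L) : ∃ C : ℝ≥0∞, C ≠ ⊤ ∧ ∀ t, 0 < 1 + t →
      radNorm K ((1 + t) ^ (1 / d)) (fun x => gA N G α x t) =
        C * ENNReal.ofReal (((1 + t) ^ (1 / d)) ^ (K - (∑ i, α i : ℕ))) := by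
  refine ⟨∫⁻ x, radWeight K 1 x * ‖gA N G α x 0‖ₑ,
    ((hG.decayE_gA α hα).lintegral_radWeight_lt_top (by
      have : (0 : ℝ) ≤ (∑ i, α i : ℕ) := by positivity
      linarith)).ne, fun t ht => ?_⟩
  have hτ : 0 < (1 + t) ^ (1 / d) := Real.rpow_pos_of_pos ht _
  unfold radNorm
  simp_rw [hG.enorm_gA_scaled α _ ht]
  set τ := (1 + t) ^ (1 / d)
  simp_rw [mul_left_comm (radWeight K τ _)]
  rw [lintegral_const_mul' _ _ ENNReal.ofReal_ne_top,
    lintegral_radWeight_mul_comp_inv_smul K (fun x => ‖gA N G α x 0‖ₑ) hτ, ← mul_assoc,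
    ← ENNReal.ofReal_mul (by positivity), ← Real.rpow_add hτ, mul_comm]
  congr 3
  ring

/-- `L^q` estimate for the profiles `g_α`. -/
theorem exists_eLpNorm_gA_le (hG : CondG N G γ d L) (hL : 0 < L) (α : Fin N → ℕ)
    (hα : ∑ i, α i ≤ γ) {q : ℝ≥0∞} (hq : 1 ≤ q) : ∃ C : ℝ≥0∞, C ≠ ⊤ ∧ ∀ t, 0 < 1 + t →
      ENNReal.ofReal (((1 + t) ^ (1 / d)) ^ (N * (1 - q.toReal⁻¹))) *
          eLpNorm (fun x => gA N G α x t) q volume ≤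
        C * ENNReal.ofReal (((1 + t) ^ (1 / d)) ^ (-((∑ i, α i : ℕ) : ℝ))) := by
  obtain ⟨C, hC, h1⟩ := hG.exists_radNorm_gA_le α hα (K := 0) hL
  obtain ⟨C', h2⟩ := (hG.decayE_gA α hα).exists_enorm_le (by positivity)
  refine ⟨max C (ENNReal.ofReal C'), by simp [hC], fun t ht => ?_⟩
  have hτ : 0 < (1 + t) ^ (1 / d) := Real.rpow_pos_of_pos ht _
  have h1 := h1 t ht
  simp_rw [radNorm, radWeight, Real.rpow_zero, ENNReal.ofReal_one, one_mul, zero_sub] at h1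
  have h3 (x) := hG.enorm_gA_scaled α x ht
  set τ := (1 + t) ^ (1 / d)
  rw [← eLpNorm_enorm, Real.rpow_mul hτ.le, Real.rpow_natCast]
  refine eLpNorm_le_of_lintegral_le_of_sup_le (by positivity) ?_ (fun x => ?_) hq
  · rw [h1]; gcongr; exact le_max_left _ _
  · rw [h3, ← mul_assoc, ← ENNReal.ofReal_mul (by positivity), ← Real.rpow_natCast,
      ← Real.rpow_add hτ, neg_add, add_neg_cancel_left, mul_comm]
    gcongr
    exact (h2 _).trans (le_max_right _ _)

/-- Estimate for the coefficients `M_α` in terms of the weighted norm. -/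
theorem exists_enorm_Mcoef_le (hG : CondG N G γ d L) {K : ℝ} (α : Fin N → ℕ)
    (hα : ((∑ i, α i : ℕ) : ℝ) ≤ K) :
    ∃ C : ℝ≥0∞, C ≠ ⊤ ∧ ∀ t, 0 < 1 + t → ∀ f : EuclideanSpace ℝ (Fin N) → ℝ,
      ENNReal.ofReal (((1 + t) ^ (1 / d)) ^ (K - (∑ i, α i : ℕ))) * ‖Mcoef N G f t α‖ₑ ≤
        C * radNorm K ((1 + t) ^ (1 / d)) f := by
  induction hn : ∑ i, α i using Nat.strong_induction_on generalizing α with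
  | _ n ih =>
    subst hn
    have hβ (β : Fin N → ℕ) : ∃ C : ℝ≥0∞, C ≠ ⊤ ∧ (β ∈ (Finset.Iic α).erase α →
        ∀ t, 0 < 1 + t → ∀ f : EuclideanSpace ℝ (Fin N) → ℝ,
        ENNReal.ofReal (((1 + t) ^ (1 / d)) ^ (K - (∑ i, β i : ℕ))) * ‖Mcoef N G f t β‖ₑ ≤
        C * radNorm K ((1 + t) ^ (1 / d)) f) := by
      by_cases h : β ∈ (Finset.Iic α).erase α
      · have hlt := sum_lt_of_mem_erase h
        have hlt' : ((∑ i, β i : ℕ) : ℝ) < (∑ i, α i : ℕ) := by exact_mod_cast hlt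
        obtain ⟨C, hC, h'⟩ := ih _ hlt β (by linarith) rfl
        exact ⟨C, hC, fun _ => h'⟩
      · exact ⟨0, by simp, fun h' => absurd h' h⟩
    choose C hC hCb using hβ
    refine ⟨1 + ∑ β ∈ (Finset.Iic α).erase α, C β * ‖∫ x, mpowE N α x * gA N G β x 0‖ₑ, ?_, ?_⟩
    · simp [ENNReal.sum_eq_top, ENNReal.mul_eq_top, hC]
    intro t ht f
    have hτ : 0 < (1 + t) ^ (1 / d) := Real.rpow_pos_of_pos ht _
    rw [Mcoef_eq, add_mul, one_mul, Finset.sum_mul]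
    have hscal (β : Fin N → ℕ) := hG.integral_mpowE_mul_gA_scaled α β ht
    have hCb' (β : Fin N → ℕ) (hβ : β ∈ (Finset.Iic α).erase α) := hCb β hβ t ht f
    set τ := (1 + t) ^ (1 / d)
    refine (mul_le_mul_right (enorm_sub_le.trans (add_le_add_right (enorm_sum_le _ _) _)) _).trans ?_
    rw [mul_add, Finset.mul_sum]
    refine add_le_add ?_ (Finset.sum_le_sum fun β hβ => ?_)
    · refine (mul_le_mul_right (enorm_integral_le_lintegral_enorm _) _).trans ?_
      rw [← lintegral_const_mul' _ _ ENNReal.ofReal_ne_top]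
      refine lintegral_mono fun x => ?_
      rw [enorm_mul, ← mul_assoc]
      gcongr
      have hx := norm_nonneg x
      rw [radWeight, Real.enorm_eq_ofReal_abs, ← ENNReal.ofReal_mul (by positivity)]
      apply ENNReal.ofReal_le_ofReal
      calc τ ^ (K - (∑ i, α i : ℕ)) * |mpowE N α x|
          ≤ (τ + ‖x‖) ^ (K - (∑ i, α i : ℕ)) * (τ + ‖x‖) ^ ((∑ i, α i : ℕ) : ℝ) := by
            rw [Real.rpow_natCast]
            refine mul_le_mul (Real.rpow_le_rpow hτ.le (by linarith) (by linarith))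
              ((abs_mpowE_le N α x).trans (pow_le_pow_left₀ hx (by linarith) _))
              (abs_nonneg _) (by positivity)
        _ = (τ + ‖x‖) ^ K := by
            rw [← Real.rpow_add (by positivity), sub_add_cancel]
    · rw [hscal, enorm_mul, enorm_mul,
        Real.enorm_of_nonneg (r := τ ^ (∑ i, α i) * τ⁻¹ ^ ∑ i, β i) (by positivity)]
      have h1 : ENNReal.ofReal (τ ^ (K - (∑ i, α i : ℕ))) *
          ENNReal.ofReal (τ ^ (∑ i, α i) * τ⁻¹ ^ ∑ i, β i) =
          ENNReal.ofReal (τ ^ (K - (∑ i, β i : ℕ))) := by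
        rw [← ENNReal.ofReal_mul (by positivity), Real.rpow_sub hτ, Real.rpow_sub hτ,
          Real.rpow_natCast, Real.rpow_natCast]
        congr 1
        rw [inv_pow]
        field_simp
      calc _ = (ENNReal.ofReal (τ ^ (K - (∑ i, α i : ℕ))) *
            ENNReal.ofReal (τ ^ (∑ i, α i) * τ⁻¹ ^ ∑ i, β i)) * ‖Mcoef N G f t β‖ₑ *
              ‖∫ x, mpowE N α x * gA N G β x 0‖ₑ := by ring
        _ ≤ C β * radNorm K τ f * ‖∫ x, mpowE N α x * gA N G β x 0‖ₑ := by
            rw [h1]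
            exact mul_le_mul_left (hCb' β hβ) _
        _ = _ := by ring

end CondG

theorem one_sub_inv_toReal_nonneg {q : ℝ≥0∞} (hq : 1 ≤ q) : 0 ≤ 1 - q.toReal⁻¹ := by
  rcases eq_or_ne q ⊤ with rfl | h
  · simp
  · have : 1 ≤ q.toReal := by simpa using ENNReal.toReal_mono h hq
    linarith [inv_le_one_of_one_le₀ this]

theorem radWeight_le_two_rpow_mul {N : ℕ} {K ρ : ℝ} (hK : 0 ≤ K) (hρ : 0 ≤ ρ)
    (x : EuclideanSpace ℝ (Fin N)) :
    radWeight K ρ x ≤ ENNReal.ofReal (2 ^ K) * (ENNReal.ofReal (ρ ^ K) +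
      ENNReal.ofReal (‖x‖ ^ K)) := by
  have hx := norm_nonneg x
  rw [radWeight, ← ENNReal.ofReal_add (by positivity) (by positivity),
    ← ENNReal.ofReal_mul (by positivity)]
  apply ENNReal.ofReal_le_ofReal
  rcases le_total ρ ‖x‖ with h | h
  · calc (ρ + ‖x‖) ^ K ≤ (2 * ‖x‖) ^ K := by gcongr; linarith
      _ = 2 ^ K * ‖x‖ ^ K := Real.mul_rpow (by norm_num) hx
      _ ≤ _ := by gcongr; linarith [Real.rpow_nonneg hρ K]
  · calc (ρ + ‖x‖) ^ K ≤ (2 * ρ) ^ K := by gcongr; linarith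
      _ = 2 ^ K * ρ ^ K := Real.mul_rpow (by norm_num) hρ
      _ ≤ _ := by gcongr; linarith [Real.rpow_nonneg hx K]

theorem radNorm_le_Efun {N : ℕ} {d K : ℝ} (hK : 0 ≤ K) (q : ℝ≥0∞)
    (f : EuclideanSpace ℝ (Fin N) → ℝ → ℝ) {t : ℝ} (ht : 0 < 1 + t)
    (hf : AEMeasurable fun x => f x t) :
    radNorm K ((1 + t) ^ (1 / d)) (fun x => f x t) ≤
      ENNReal.ofReal (2 ^ K) * Efun N d K q f t := by
  have hτ : 0 < (1 + t) ^ (1 / d) := Real.rpow_pos_of_pos ht _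
  have h1 : (1 + t) ^ (K / d) = ((1 + t) ^ (1 / d)) ^ K := by
    rw [← Real.rpow_mul ht.le]; congr 1; ring
  unfold Efun
  rw [h1]
  set τ := (1 + t) ^ (1 / d)
  calc radNorm K τ (fun x => f x t)
      ≤ ∫⁻ x, ENNReal.ofReal (2 ^ K) * (ENNReal.ofReal (τ ^ K) * ‖f x t‖ₑ +
          ENNReal.ofReal (‖x‖ ^ K) * ‖f x t‖ₑ) := by
        refine lintegral_mono fun x => ?_
        rw [← add_mul, ← mul_assoc]
        gcongr
        exact radWeight_le_two_rpow_mul hK hτ.le x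
    _ = ENNReal.ofReal (2 ^ K) * (ENNReal.ofReal (τ ^ K) * (∫⁻ x, ‖f x t‖ₑ) +
          ∫⁻ x, ENNReal.ofReal (‖x‖ ^ K) * ‖f x t‖ₑ) := by
        rw [lintegral_const_mul' _ _ ENNReal.ofReal_ne_top,
          lintegral_add_left' (hf.enorm.const_mul _),
          lintegral_const_mul' _ _ ENNReal.ofReal_ne_top]
    _ ≤ _ := by
        rw [eLpNorm_one_eq_lintegral_enorm, wnorm]
        gcongr with x
        · exact le_add_self
        · rw [Real.enorm_eq_ofReal_abs, ← ENNReal.ofReal_mul (by positivity), Real.norm_eq_abs]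
          gcongr
          linarith

namespace CondG

variable {N γ : ℕ} {d L : ℝ} {G : EuclideanSpace ℝ (Fin N) → ℝ → ℝ}

theorem continuous_gA (hG : CondG N G γ d L) (α : Fin N → ℕ) (hα : ∑ i, α i ≤ γ) {t : ℝ}
    (ht : 0 < 1 + t) : Continuous fun x => gA N G α x t := by
  simp_rw [hG.gA_scaled α _ ht]
  exact continuous_const.mul ((hG.decayE_gA α hα).contDiff.continuous.comp (by fun_prop))

theorem sum_le_floor {α : Fin N → ℕ} {K : ℝ} (hK0 : 0 ≤ K) (hα : α ∈ multiIdx N ⌊K⌋₊) :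
    ((∑ i, α i : ℕ) : ℝ) ≤ K :=
  le_trans (by exact_mod_cast mem_multiIdx.1 hα) (Nat.floor_le hK0)

theorem exists_radNorm_PKop_le (hG : CondG N G γ d L) {K : ℝ} (hK0 : 0 ≤ K)
    (hKL : K < L) (hKγ : ⌊K⌋₊ ≤ γ) : ∃ C : ℝ≥0∞, C ≠ ⊤ ∧ ∀ t, 0 < 1 + t →
      ∀ f : EuclideanSpace ℝ (Fin N) → ℝ,
      radNorm K ((1 + t) ^ (1 / d)) (PKop N G K t f) ≤ C * radNorm K ((1 + t) ^ (1 / d)) f := by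
  have hex (α : Fin N → ℕ) : ∃ C : ℝ≥0∞, C ≠ ⊤ ∧ (α ∈ multiIdx N ⌊K⌋₊ → ∀ t, 0 < 1 + t →
      ∀ f : EuclideanSpace ℝ (Fin N) → ℝ, ‖Mcoef N G f t α‖ₑ *
        radNorm K ((1 + t) ^ (1 / d)) (fun x => gA N G α x t) ≤
        C * radNorm K ((1 + t) ^ (1 / d)) f) := by
    by_cases hα : α ∈ multiIdx N ⌊K⌋₊
    · obtain ⟨C, hC, h1⟩ := hG.exists_enorm_Mcoef_le α (sum_le_floor hK0 hα)
      obtain ⟨C', hC', h2⟩ := hG.exists_radNorm_gA_le α ((mem_multiIdx.1 hα).trans hKγ) hKL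
      refine ⟨C' * C, ENNReal.mul_ne_top hC' hC, fun _ t ht f => ?_⟩
      rw [h2 t ht]
      calc _ = C' * (ENNReal.ofReal (((1 + t) ^ (1 / d)) ^ (K - (∑ i, α i : ℕ))) *
            ‖Mcoef N G f t α‖ₑ) := by ring
        _ ≤ C' * (C * radNorm K ((1 + t) ^ (1 / d)) f) := mul_le_mul_right (h1 t ht f) _
        _ = _ := by ring
    · exact ⟨0, by simp, fun h => absurd h hα⟩
  choose C hC hCb using hex
  refine ⟨1 + ∑ α ∈ multiIdx N ⌊K⌋₊, C α, by simp [ENNReal.sum_eq_top, hC], fun t ht f => ?_⟩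
  have hm (α : Fin N → ℕ) (hα : α ∈ multiIdx N ⌊K⌋₊) : Measurable fun x => ‖gA N G α x t‖ₑ :=
    (hG.continuous_gA α ((mem_multiIdx.1 hα).trans hKγ) ht).measurable.enorm
  have hCb' (α : Fin N → ℕ) (hα : α ∈ multiIdx N ⌊K⌋₊) := hCb α hα t ht f
  set τ := (1 + t) ^ (1 / d)
  calc radNorm K τ (PKop N G K t f)
      ≤ ∫⁻ x, (radWeight K τ x * ‖f x‖ₑ + ∑ α ∈ multiIdx N ⌊K⌋₊,
          ‖Mcoef N G f t α‖ₑ * (radWeight K τ x * ‖gA N G α x t‖ₑ)) := by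
        refine lintegral_mono fun x => ?_
        simp_rw [mul_left_comm _ (radWeight K τ x), ← Finset.mul_sum, ← mul_add, ← enorm_mul]
        gcongr
        exact enorm_sub_le.trans (add_le_add_right (enorm_sum_le _ _) _)
    _ = radNorm K τ f + ∑ α ∈ multiIdx N ⌊K⌋₊, ‖Mcoef N G f t α‖ₑ *
          radNorm K τ (fun x => gA N G α x t) := by
        have hm' (α : Fin N → ℕ) (hα : α ∈ multiIdx N ⌊K⌋₊) : Measurable fun x =>
            ‖Mcoef N G f t α‖ₑ * (radWeight K τ x * ‖gA N G α x t‖ₑ) :=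
          ((measurable_radWeight K τ).mul (hm α hα)).const_mul _
        rw [lintegral_add_right _ (Finset.measurable_fun_sum _ hm'), lintegral_finsetSum _ hm']
        simp_rw [lintegral_const_mul' _ _ enorm_ne_top]
        rfl
    _ ≤ _ := by
        rw [add_mul, one_mul, Finset.sum_mul]
        exact add_le_add_right (Finset.sum_le_sum hCb') _

theorem exists_eLpNorm_PKop_le (hG : CondG N G γ d L) (hd : 0 < d) (hL : 0 < L) {K : ℝ}
    (hK0 : 0 ≤ K) (hKγ : ⌊K⌋₊ ≤ γ) {q : ℝ≥0∞} (hq : 1 ≤ q) :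
    ∃ C : ℝ≥0∞, C ≠ ⊤ ∧ ∀ f : EuclideanSpace ℝ (Fin N) → ℝ → ℝ, ∀ t, 0 < t →
      Measurable (fun x => f x t) →
      ENNReal.ofReal (((1 + t) ^ (1 / d)) ^ K) *
        (ENNReal.ofReal (t ^ (((N : ℝ) / d) * (1 - q.toReal⁻¹))) *
          eLpNorm (PKop N G K t fun x => f x t) q volume) ≤ C * Efun N d K q f t := by
  have hex (α : Fin N → ℕ) : ∃ C : ℝ≥0∞, C ≠ ⊤ ∧ (α ∈ multiIdx N ⌊K⌋₊ → ∀ t, 0 < t →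
      ∀ f : EuclideanSpace ℝ (Fin N) → ℝ,
      ENNReal.ofReal (((1 + t) ^ (1 / d)) ^ K) *
        (ENNReal.ofReal (t ^ (((N : ℝ) / d) * (1 - q.toReal⁻¹))) *
          (‖Mcoef N G f t α‖ₑ * eLpNorm (fun x => gA N G α x t) q volume)) ≤
        C * radNorm K ((1 + t) ^ (1 / d)) f) := by
    by_cases hα : α ∈ multiIdx N ⌊K⌋₊
    · obtain ⟨C, hC, h1⟩ := hG.exists_enorm_Mcoef_le α (sum_le_floor hK0 hα)
      obtain ⟨C', hC', h2⟩ := hG.exists_eLpNorm_gA_le hL α ((mem_multiIdx.1 hα).trans hKγ) hq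
      refine ⟨C' * C, ENNReal.mul_ne_top hC' hC, fun _ t ht f => ?_⟩
      have ht1 : 0 < 1 + t := by linarith
      have hτ : 0 < (1 + t) ^ (1 / d) := Real.rpow_pos_of_pos ht1 _
      have h0 : t ^ (((N : ℝ) / d) * (1 - q.toReal⁻¹)) ≤
          ((1 + t) ^ (1 / d)) ^ (N * (1 - q.toReal⁻¹)) := by
        have := one_sub_inv_toReal_nonneg hq
        rw [← Real.rpow_mul ht1.le, show 1 / d * (N * (1 - q.toReal⁻¹)) =
          ((N : ℝ) / d) * (1 - q.toReal⁻¹) by ring]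
        exact Real.rpow_le_rpow ht.le (by linarith) (by positivity)
      have h1 := h1 t ht1 f
      have h2 := h2 t ht1
      set τ := (1 + t) ^ (1 / d)
      calc _ ≤ ENNReal.ofReal (τ ^ K) * (ENNReal.ofReal (τ ^ (N * (1 - q.toReal⁻¹))) *
            (‖Mcoef N G f t α‖ₑ * eLpNorm (fun x => gA N G α x t) q volume)) := by gcongr
        _ = ENNReal.ofReal (τ ^ K) * ‖Mcoef N G f t α‖ₑ *
            (ENNReal.ofReal (τ ^ (N * (1 - q.toReal⁻¹))) *
              eLpNorm (fun x => gA N G α x t) q volume) := by ring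
        _ ≤ ENNReal.ofReal (τ ^ K) * ‖Mcoef N G f t α‖ₑ *
            (C' * ENNReal.ofReal (τ ^ (-((∑ i, α i : ℕ) : ℝ)))) := mul_le_mul_right h2 _
        _ = C' * ((ENNReal.ofReal (τ ^ K) * ENNReal.ofReal (τ ^ (-((∑ i, α i : ℕ) : ℝ)))) *
            ‖Mcoef N G f t α‖ₑ) := by ring
        _ ≤ C' * (C * radNorm K τ f) := by
            rw [← ENNReal.ofReal_mul (by positivity), ← Real.rpow_add hτ, ← sub_eq_add_neg]
            exact mul_le_mul_right h1 _
        _ = _ := by ring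
    · exact ⟨0, by simp, fun h => absurd h hα⟩
  choose C hC hCb using hex
  refine ⟨1 + ∑ α ∈ multiIdx N ⌊K⌋₊, C α * ENNReal.ofReal (2 ^ K), ?_, fun f t ht hf => ?_⟩
  · simp [ENNReal.sum_eq_top, ENNReal.mul_eq_top, hC]
  have ht1 : 0 < 1 + t := by linarith
  have hm (α : Fin N → ℕ) (hα : α ∈ multiIdx N ⌊K⌋₊) :
      AEStronglyMeasurable (fun x => gA N G α x t) volume :=
    (hG.continuous_gA α ((mem_multiIdx.1 hα).trans hKγ) ht1).aestronglyMeasurable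
  have hCb' (α : Fin N → ℕ) (hα : α ∈ multiIdx N ⌊K⌋₊) := hCb α hα t ht fun x => f x t
  have hrad := radNorm_le_Efun (d := d) hK0 q f ht1 hf.aemeasurable
  have hself : ENNReal.ofReal (((1 + t) ^ (1 / d)) ^ K) *
      (ENNReal.ofReal (t ^ (((N : ℝ) / d) * (1 - q.toReal⁻¹))) *
          eLpNorm (fun x => f x t) q volume) ≤ Efun N d K q f t := by
    have h1 : (1 + t) ^ (K / d) = ((1 + t) ^ (1 / d)) ^ K := by
      rw [← Real.rpow_mul ht1.le]; congr 1; ring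
    unfold Efun
    rw [h1]
    exact (mul_le_mul_right le_self_add _).trans le_self_add
  set τ := (1 + t) ^ (1 / d)
  set c := ENNReal.ofReal (t ^ (((N : ℝ) / d) * (1 - q.toReal⁻¹)))
  have hnorm : eLpNorm (PKop N G K t fun x => f x t) q volume ≤ eLpNorm (fun x => f x t) q volume +
      ∑ α ∈ multiIdx N ⌊K⌋₊, ‖Mcoef N G (fun x => f x t) t α‖ₑ *
        eLpNorm (fun x => gA N G α x t) q volume := by
    have hs (α : Fin N → ℕ) (hα : α ∈ multiIdx N ⌊K⌋₊) :
        AEStronglyMeasurable (Mcoef N G (fun x => f x t) t α • fun x => gA N G α x t) volume :=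
      (hm α hα).const_smul _
    have heq : (PKop N G K t fun x => f x t) = (fun x => f x t) - ∑ α ∈ multiIdx N ⌊K⌋₊,
        (Mcoef N G (fun x => f x t) t α • fun x => gA N G α x t) := by
      ext x
      simp [PKop]
    rw [heq]
    refine (eLpNorm_sub_le hf.aestronglyMeasurable (Finset.aestronglyMeasurable_sum _ hs) hq).trans
      (add_le_add_right ((eLpNorm_sum_le hs hq).trans (Finset.sum_le_sum fun α _ => ?_)) _)
    rw [eLpNorm_const_smul]
  calc _ ≤ ENNReal.ofReal (τ ^ K) * (c * (eLpNorm (fun x => f x t) q volume +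
      ∑ α ∈ multiIdx N ⌊K⌋₊, ‖Mcoef N G (fun x => f x t) t α‖ₑ *
        eLpNorm (fun x => gA N G α x t) q volume)) := by gcongr
    _ = ENNReal.ofReal (τ ^ K) * (c * eLpNorm (fun x => f x t) q volume) +
      ∑ α ∈ multiIdx N ⌊K⌋₊, ENNReal.ofReal (τ ^ K) * (c *
        (‖Mcoef N G (fun x => f x t) t α‖ₑ * eLpNorm (fun x => gA N G α x t) q volume)) := by
        rw [mul_add, mul_add, Finset.mul_sum, Finset.mul_sum]
    _ ≤ Efun N d K q f t + ∑ α ∈ multiIdx N ⌊K⌋₊, C α * ENNReal.ofReal (2 ^ K) *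
        Efun N d K q f t := by
        refine add_le_add hself (Finset.sum_le_sum fun α hα => (hCb' α hα).trans ?_)
        rw [mul_assoc]
        gcongr
    _ = _ := by rw [add_mul, one_mul, Finset.sum_mul]

end CondG

namespace CondG

variable {N γ : ℕ} {d L : ℝ} {G : EuclideanSpace ℝ (Fin N) → ℝ → ℝ}

theorem exists_measurable_gA (hG : CondG N G γ d L) (α : Fin N → ℕ) (hα : ∑ i, α i ≤ γ) :
    ∃ g : EuclideanSpace ℝ (Fin N) × ℝ → ℝ, Measurable g ∧
      ∀ x t, 0 < t → g (x, t) = gA N G α x t := by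
  refine ⟨fun p => ((((1 + p.2) ^ (1 / d)) ^ N)⁻¹ * (((1 + p.2) ^ (1 / d))⁻¹) ^ (∑ i, α i)) *
      gA N G α (((1 + p.2) ^ (1 / d))⁻¹ • p.1) 0, ?_, fun x t ht => ?_⟩
  · have h1 : Measurable fun x => gA N G α x 0 :=
      (hG.decayE_gA α hα).contDiff.continuous.measurable
    have h2 : Measurable fun p : EuclideanSpace ℝ (Fin N) × ℝ =>
      ((1 + p.2) ^ (1 / d))⁻¹ • p.1 := by fun_prop
    exact Measurable.mul (by fun_prop) (h1.comp h2)
  · exact (hG.gA_scaled α x (by linarith)).symm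

theorem exists_measurable_McoefAux (hG : CondG N G γ d L)
    {f : EuclideanSpace ℝ (Fin N) → ℝ → ℝ}
    (hf : Measurable fun p : EuclideanSpace ℝ (Fin N) × ℝ => f p.1 p.2) (n : ℕ) (α : Fin N → ℕ) :
    ∃ M : ℝ → ℝ, Measurable M ∧ ∀ t, 0 < t → M t = McoefAux N G (fun x => f x t) t n α := by
  have hmom (α : Fin N → ℕ) : Measurable fun t => momE N α fun x => f x t := by
    have h1 : Measurable fun p : ℝ × EuclideanSpace ℝ (Fin N) => mpowE N α p.2 * f p.2 p.1 :=
      ((continuous_mpowE N α).measurable.comp measurable_snd).mul (hf.comp measurable_swap)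
    exact h1.stronglyMeasurable.integral_prod_right.measurable
  induction n generalizing α with
  | zero => exact ⟨_, hmom α, fun t _ => rfl⟩
  | succ n ih =>
    choose M hM hMe using ih
    refine ⟨fun t => (momE N α fun x => f x t) - ∑ β ∈ (Finset.Iic α).erase α, M β t *
      (((1 + t) ^ (1 / d)) ^ (∑ i, α i) * (((1 + t) ^ (1 / d))⁻¹) ^ (∑ i, β i) *
        ∫ x, mpowE N α x * gA N G β x 0), ?_, fun t ht => ?_⟩
    · refine (hmom α).sub (Finset.measurable_fun_sum _ fun β _ => (hM β).mul ?_)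
      fun_prop
    · rw [McoefAux]
      simp only
      congr 1
      refine Finset.sum_congr rfl fun β _ => ?_
      rw [hMe β t ht, hG.integral_mpowE_mul_gA_scaled α β (t := t) (by linarith)]

theorem exists_measurable_PKop (hG : CondG N G γ d L) {K : ℝ} (hKγ : ⌊K⌋₊ ≤ γ)
    {f : EuclideanSpace ℝ (Fin N) → ℝ → ℝ}
    (hf : Measurable fun p : EuclideanSpace ℝ (Fin N) × ℝ => f p.1 p.2) :
    ∃ φ : EuclideanSpace ℝ (Fin N) × ℝ → ℝ, Measurable φ ∧
      ∀ y s, 0 < s → φ (y, s) = PKop N G K s (fun x => f x s) y := by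
  have hg (α : Fin N → ℕ) : ∃ g : EuclideanSpace ℝ (Fin N) × ℝ → ℝ, Measurable g ∧
      (α ∈ multiIdx N ⌊K⌋₊ → ∀ x t, 0 < t → g (x, t) = gA N G α x t) := by
    by_cases hα : α ∈ multiIdx N ⌊K⌋₊
    · obtain ⟨g, h1, h2⟩ := hG.exists_measurable_gA α ((mem_multiIdx.1 hα).trans hKγ)
      exact ⟨g, h1, fun _ => h2⟩
    · exact ⟨0, measurable_zero, fun h => absurd h hα⟩
  choose g hg hge using hg
  choose M hM hMe using fun α : Fin N → ℕ => hG.exists_measurable_McoefAux hf (∑ i, α i) α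
  refine ⟨fun p => f p.1 p.2 - ∑ α ∈ multiIdx N ⌊K⌋₊, M α p.2 * g α p, ?_, fun y s hs => ?_⟩
  · exact hf.sub (Finset.measurable_fun_sum _ fun α _ => ((hM α).comp measurable_snd).mul (hg α))
  · simp only [PKop]
    congr 1
    refine Finset.sum_congr rfl fun α hα => ?_
    rw [hMe α s hs, hge α hα y s hs, Mcoef]

end CondG

/-- Taylor remainder of order `m` of `h` at `x` in the direction `-y`. -/
noncomputable def taylorRem {N : ℕ} (m : ℕ) (h : EuclideanSpace ℝ (Fin N) → ℝ)
    (x y : EuclideanSpace ℝ (Fin N)) : ℝ :=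
  h (x - y) - ∑ j ∈ Finset.range (m + 1), (j.factorial : ℝ)⁻¹ * iteratedFDeriv ℝ j h x fun _ => -y

/-- The modulus `min (‖y‖ ^ K) (‖y‖ ^ (m + 1) * ρ ^ (K - (m + 1)))`. -/
noncomputable def taylorMod {N : ℕ} (K : ℝ) (m : ℕ) (ρ : ℝ) (y : EuclideanSpace ℝ (Fin N)) : ℝ :=
  min (‖y‖ ^ K) (‖y‖ ^ (m + 1) * ρ ^ (K - (m + 1)))

theorem prod_apply_eq_mpowE {N j : ℕ} (r : Fin j → Fin N) (y : EuclideanSpace ℝ (Fin N)) :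
    ∏ k, y (r k) = mpowE N (fun i => (Finset.univ.filter fun k => r k = i).card) y := by
  unfold mpowE
  rw [← Finset.prod_fiberwise Finset.univ r]
  refine Finset.prod_congr rfl fun i _ => ?_
  rw [Finset.prod_congr rfl (g := fun _ => y i) fun k hk => by rw [(Finset.mem_filter.1 hk).2],
    Finset.prod_const]

theorem sum_card_fiber {N j : ℕ} (r : Fin j → Fin N) :
    ∑ i, (Finset.univ.filter fun k => r k = i).card = j := by
  simpa using (Finset.card_eq_sum_card_fiberwise (f := r) (s := Finset.univ) (t := Finset.univ)
    (fun _ _ => Finset.mem_coe.2 (Finset.mem_univ _))).symm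

theorem multilinear_apply_eq_sum {N j : ℕ}
    (M : ContinuousMultilinearMap ℝ (fun _ : Fin j => EuclideanSpace ℝ (Fin N)) ℝ)
    (y : EuclideanSpace ℝ (Fin N)) :
    M (fun _ => y) = ∑ r : Fin j → Fin N,
      mpowE N (fun i => (Finset.univ.filter fun k => r k = i).card) y *
        M fun k => EuclideanSpace.single (r k) 1 := by
  have h1 : y = ∑ i, y i • EuclideanSpace.single i (1 : ℝ) := by
    ext k
    simp [Pi.single_apply]
  conv_lhs => rw [h1]
  rw [M.map_sum]
  refine Finset.sum_congr rfl fun r _ => ?_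
  rw [M.map_smul_univ, prod_apply_eq_mpowE, smul_eq_mul]

/-- Homogeneous polynomials of degree at most `m` integrate to zero against functions whose moments
up to order `m` vanish. -/
theorem integral_multilinear_mul_eq_zero {N m j : ℕ} (hj : j ≤ m)
    {φ : EuclideanSpace ℝ (Fin N) → ℝ}
    (hφ : ∀ α : Fin N → ℕ, ∑ i, α i ≤ m → Integrable (fun x => mpowE N α x * φ x) ∧
      ∫ x, mpowE N α x * φ x = 0)
    (M : ContinuousMultilinearMap ℝ (fun _ : Fin j => EuclideanSpace ℝ (Fin N)) ℝ) (c : ℝ) :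
    Integrable (fun y => M (fun _ => c • y) * φ y) ∧ ∫ y, M (fun _ => c • y) * φ y = 0 := by
  have h1 (y : EuclideanSpace ℝ (Fin N)) : M (fun _ => c • y) * φ y = ∑ r : Fin j → Fin N,
      (c ^ j * M fun k => EuclideanSpace.single (r k) 1) *
      (mpowE N (fun i => (Finset.univ.filter fun k => r k = i).card) y * φ y) := by
    rw [multilinear_apply_eq_sum, Finset.sum_mul]
    refine Finset.sum_congr rfl fun r _ => ?_
    rw [mpowE_smul, sum_card_fiber]
    ring
  have h2 (r : Fin j → Fin N) := hφ (fun i => (Finset.univ.filter fun k => r k = i).card)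
    ((sum_card_fiber r).trans_le hj)
  simp_rw [h1]
  refine ⟨integrable_finsetSum _ fun r _ => (h2 r).1.const_mul _, ?_⟩
  rw [integral_finsetSum _ fun r _ => (h2 r).1.const_mul _]
  refine Finset.sum_eq_zero fun r _ => ?_
  rw [integral_const_mul, (h2 r).2, mul_zero]

theorem continuous_taylorRem {N m : ℕ} {h : EuclideanSpace ℝ (Fin N) → ℝ} (hh : ContDiff ℝ m h) :
    Continuous fun p : EuclideanSpace ℝ (Fin N) × EuclideanSpace ℝ (Fin N) =>
      taylorRem m h p.1 p.2 := by
  have h0 : Continuous h := hh.continuous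
  unfold taylorRem
  refine Continuous.sub (by fun_prop) (continuous_finsetSum _ fun j hj => ?_)
  have h1 : Continuous (iteratedFDeriv ℝ j h) :=
    hh.continuous_iteratedFDeriv (by exact_mod_cast Finset.mem_range_succ_iff.1 hj)
  refine continuous_const.mul ?_
  exact (h1.comp continuous_fst).eval (by fun_prop)

theorem measurable_taylorMod {N : ℕ} (K : ℝ) (m : ℕ) (ρ : ℝ) :
    Measurable (taylorMod K m ρ : EuclideanSpace ℝ (Fin N) → ℝ) := by
  unfold taylorMod; fun_prop

theorem taylorMod_one_of_le_one {N : ℕ} {K : ℝ} {m : ℕ} (hKm : K < m + 1)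
    {y : EuclideanSpace ℝ (Fin N)} (hy : ‖y‖ ≤ 1) : taylorMod K m 1 y = ‖y‖ ^ (m + 1) := by
  rw [taylorMod, Real.one_rpow, mul_one, min_eq_right]
  rw [← Real.rpow_natCast]
  exact Real.rpow_le_rpow_of_exponent_ge_of_imp (norm_nonneg y) hy (by push_cast; linarith)
    fun _ h => by push_cast at h; linarith

theorem taylorMod_one_of_one_le {N : ℕ} {K : ℝ} {m : ℕ} (hKm : K < m + 1)
    {y : EuclideanSpace ℝ (Fin N)} (hy : 1 ≤ ‖y‖) : taylorMod K m 1 y = ‖y‖ ^ K := by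
  rw [taylorMod, Real.one_rpow, mul_one, min_eq_left]
  rw [← Real.rpow_natCast]
  exact Real.rpow_le_rpow_of_exponent_le hy (by push_cast; linarith)

theorem rpow_mul_taylorMod_inv_smul {N : ℕ} (K : ℝ) (m : ℕ) {r : ℝ} (hr : 0 < r)
    (y : EuclideanSpace ℝ (Fin N)) : r ^ K * taylorMod K m 1 (r⁻¹ • y) = taylorMod K m r y := by
  have hy := norm_nonneg y
  have hr' : 0 < r ^ K := by positivity
  have hr'' : r ^ ((m : ℝ) + 1) = r ^ (m + 1) := by exact_mod_cast Real.rpow_natCast r (m + 1)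
  rw [taylorMod, taylorMod, mul_min_of_nonneg _ _ (by positivity), norm_smul, norm_inv,
    Real.norm_of_nonneg hr.le, Real.one_rpow, Real.mul_rpow (by positivity) hy,
    Real.inv_rpow hr.le, Real.rpow_sub hr, hr'']
  congr 1
  · field_simp
  · field_simp
    rw [div_pow, div_mul_cancel₀ _ (by positivity)]

/-- Pointwise bound of the Taylor remainder for small increments. -/
theorem DecayE.exists_abs_taylorRem_le {N m : ℕ} {a : ℝ} {h : EuclideanSpace ℝ (Fin N) → ℝ}
    (H : DecayE (m + 1) a h) (ha : 0 ≤ a) : ∃ C : ℝ, 0 ≤ C ∧ ∀ x y, ‖y‖ ≤ 1 →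
      |taylorRem m h x y| ≤ C * ‖y‖ ^ (m + 1) * (1 + ‖x‖) ^ (-a) := by
  obtain ⟨C, hC0, hC⟩ := H.exists_norm_le le_rfl
  refine ⟨C * 2 ^ (a + (m + 1 : ℕ)), by positivity, fun x y hy => ?_⟩
  have hT := map_add_eq_sum_add_integral_iteratedFDeriv (f := h) (x := x) (y := -y) (n := m)
    (fun t _ => by exact_mod_cast H.contDiff.contDiffAt)
  have hT' : taylorRem m h x y = (m.factorial : ℝ)⁻¹ • ∫ t in (0 : ℝ)..1,
      (1 - t) ^ m • iteratedFDeriv ℝ (m + 1) h (x + t • -y) fun _ => -y := by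
    rw [taylorRem, sub_eq_add_neg x y, hT]
    simp
  have hbd : ∀ t ∈ Set.uIoc (0 : ℝ) 1,
      ‖(1 - t) ^ m • iteratedFDeriv ℝ (m + 1) h (x + t • -y) fun _ => -y‖ ≤
      C * 2 ^ (a + (m + 1 : ℕ)) * ‖y‖ ^ (m + 1) * (1 + ‖x‖) ^ (-a) := by
    intro t ht
    rw [Set.uIoc_of_le zero_le_one] at ht
    have hx := norm_nonneg x
    have h1 : |(1 - t) ^ m| ≤ 1 := by
      rw [abs_pow]
      exact pow_le_one₀ (abs_nonneg _) (abs_le.2 ⟨by linarith [ht.2], by linarith [ht.1]⟩)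
    have h2 : ‖iteratedFDeriv ℝ (m + 1) h (x + t • -y) fun _ => -y‖ ≤
        ‖iteratedFDeriv ℝ (m + 1) h (x + t • -y)‖ * ‖y‖ ^ (m + 1) := by
      simpa using (iteratedFDeriv ℝ (m + 1) h (x + t • -y)).le_opNorm fun _ => -y
    have h3 : (1 + ‖x‖) / 2 ≤ 1 + ‖x + t • -y‖ := by
      have e1 : ‖t • -y‖ ≤ 1 := by
        rw [norm_smul, norm_neg, Real.norm_of_nonneg ht.1.le]
        nlinarith [ht.1, ht.2, norm_nonneg y]
      have e2 : ‖x‖ ≤ ‖x + t • -y‖ + ‖t • -y‖ := by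
        simpa using norm_sub_le (x + t • -y) (t • -y)
      have e3 := norm_nonneg (x + t • -y)
      linarith
    have h4 : (1 + ‖x + t • -y‖) ^ (-(a + (m + 1 : ℕ))) ≤
        2 ^ (a + (m + 1 : ℕ)) * (1 + ‖x‖) ^ (-a) := by
      calc (1 + ‖x + t • -y‖) ^ (-(a + (m + 1 : ℕ))) ≤ ((1 + ‖x‖) / 2) ^ (-(a + (m + 1 : ℕ))) :=
            Real.rpow_le_rpow_of_nonpos (by positivity) h3 (by
              have : (0 : ℝ) ≤ (m + 1 : ℕ) := by positivity
              linarith)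
        _ = 2 ^ (a + (m + 1 : ℕ)) * (1 + ‖x‖) ^ (-(a + (m + 1 : ℕ))) := by
            rw [Real.div_rpow (by positivity) (by norm_num), Real.rpow_neg (x := (2 : ℝ))
              (by norm_num), div_inv_eq_mul, mul_comm]
        _ ≤ _ := by
            gcongr
            · linarith
            · have : (0 : ℝ) ≤ (m + 1 : ℕ) := by positivity
              linarith
    rw [norm_smul, Real.norm_eq_abs]
    calc |(1 - t) ^ m| * ‖iteratedFDeriv ℝ (m + 1) h (x + t • -y) fun _ => -y‖
        ≤ 1 * ((C * (2 ^ (a + (m + 1 : ℕ)) * (1 + ‖x‖) ^ (-a))) * ‖y‖ ^ (m + 1)) := by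
          gcongr
          refine h2.trans ?_
          gcongr
          exact (hC _).trans (by gcongr)
      _ = _ := by ring
  have h5 := intervalIntegral.norm_integral_le_of_norm_le_const hbd
  have h6 : |(m.factorial : ℝ)⁻¹| ≤ 1 := by
    rw [abs_of_nonneg (by positivity)]
    exact inv_le_one_of_one_le₀ (by exact_mod_cast Nat.factorial_pos m)
  rw [hT', smul_eq_mul, abs_mul, ← Real.norm_eq_abs (∫ _ in _.._, _)]
  calc _ ≤ 1 * _ := mul_le_mul h6 h5 (norm_nonneg _) (by positivity)
    _ = _ := by simp

/-- Pointwise bound of the Taylor remainder for large increments. -/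
theorem DecayE.exists_abs_taylorRem_le' {N m : ℕ} {a K : ℝ} {h : EuclideanSpace ℝ (Fin N) → ℝ}
    (H : DecayE m a h) (hmK : m ≤ K) : ∃ C : ℝ, 0 ≤ C ∧ ∀ x y, 1 ≤ ‖y‖ →
      |taylorRem m h x y| ≤ |h (x - y)| + C * ‖y‖ ^ K * (1 + ‖x‖) ^ (-a) := by
  have hex (j : ℕ) : ∃ C : ℝ, 0 ≤ C ∧ (j ≤ m → ∀ x, ‖iteratedFDeriv ℝ j h x‖ ≤
      C * (1 + ‖x‖) ^ (-(a + j))) := by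
    by_cases hj : j ≤ m
    · obtain ⟨C, h1, h2⟩ := H.exists_norm_le hj
      exact ⟨C, h1, fun _ => h2⟩
    · exact ⟨0, le_rfl, fun h => absurd h hj⟩
  choose C hC0 hC using hex
  refine ⟨∑ j ∈ Finset.range (m + 1), C j, Finset.sum_nonneg fun j _ => hC0 j, fun x y hy => ?_⟩
  have hx := norm_nonneg x
  refine (abs_sub _ _).trans (add_le_add_right ?_ _)
  refine (Finset.abs_sum_le_sum_abs _ _).trans ?_
  rw [Finset.sum_mul, Finset.sum_mul]
  refine Finset.sum_le_sum fun j hj => ?_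
  have hj' := Finset.mem_range_succ_iff.1 hj
  have h2 : |iteratedFDeriv ℝ j h x fun _ => -y| ≤ ‖iteratedFDeriv ℝ j h x‖ * ‖y‖ ^ j := by
    simpa using (iteratedFDeriv ℝ j h x).le_opNorm fun _ => -y
  have h6 : |(j.factorial : ℝ)⁻¹| ≤ 1 := by
    rw [abs_of_nonneg (by positivity)]
    exact inv_le_one_of_one_le₀ (by exact_mod_cast Nat.factorial_pos j)
  have h7 : ‖y‖ ^ j ≤ ‖y‖ ^ K := by
    rw [← Real.rpow_natCast]
    exact Real.rpow_le_rpow_of_exponent_le hy (le_trans (by exact_mod_cast hj') hmK)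
  have h8 : (1 + ‖x‖) ^ (-(a + j)) ≤ (1 + ‖x‖) ^ (-a) :=
    Real.rpow_le_rpow_of_exponent_le (by linarith) (by
      have : (0 : ℝ) ≤ j := by positivity
      linarith)
  rw [abs_mul]
  calc _ ≤ 1 * ((C j * (1 + ‖x‖) ^ (-a)) * ‖y‖ ^ K) := by
        refine mul_le_mul h6 (h2.trans ?_) (abs_nonneg _) zero_le_one
        have := hC0 j
        gcongr
        exact (hC j hj' x).trans (by gcongr)
    _ = _ := by ring

theorem ofReal_rpow_mul_radWeight_add_le {N : ℕ} {K ρ : ℝ} (hK : 0 ≤ K) (hρ : 0 ≤ ρ)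
    (x y : EuclideanSpace ℝ (Fin N)) :
    ENNReal.ofReal (ρ ^ K) * radWeight K ρ (x + y) ≤ radWeight K ρ x * radWeight K ρ y := by
  have hx := norm_nonneg x
  have hy := norm_nonneg y
  have hxy := norm_nonneg (x + y)
  have h := norm_add_le x y
  unfold radWeight
  rw [← ENNReal.ofReal_mul (by positivity), ← ENNReal.ofReal_mul (by positivity),
    ← Real.mul_rpow hρ (by positivity), ← Real.mul_rpow (by positivity) (by positivity)]
  exact ENNReal.ofReal_le_ofReal (Real.rpow_le_rpow (by positivity) (by nlinarith) hK)

theorem lintegral_radWeight_mul_decay_lt_top {N : ℕ} {a K : ℝ} (hab : K + N < a) :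
    ∫⁻ x : EuclideanSpace ℝ (Fin N), radWeight K 1 x * ENNReal.ofReal ((1 + ‖x‖) ^ (-a)) < ⊤ := by
  refine lt_of_le_of_lt (le_of_eq (lintegral_congr fun x => ?_))
    (integrable_rpow_mul_decay (N := N) hab).hasFiniteIntegral
  have := norm_nonneg x
  rw [radWeight, ← ENNReal.ofReal_mul (by positivity), Real.enorm_of_nonneg (by positivity)]

/-- Uniform and weighted `L¹` bounds of the Taylor remainder of a decaying function. -/
theorem DecayE.exists_taylorRem_le {N m : ℕ} {a K : ℝ} {h : EuclideanSpace ℝ (Fin N) → ℝ}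
    (H : DecayE (m + 1) a h) (hK0 : 0 ≤ K) (hmK : m ≤ K) (hKm : K < m + 1) (hab : K + N < a) :
    ∃ C : ℝ≥0∞, C ≠ ⊤ ∧ ∀ y, (∀ x, ‖taylorRem m h x y‖ₑ ≤ C * ENNReal.ofReal (taylorMod K m 1 y)) ∧
      ∫⁻ x, radWeight K 1 x * ‖taylorRem m h x y‖ₑ ≤ C * ENNReal.ofReal (taylorMod K m 1 y) := by
  have ha : 0 ≤ a := by
    have : (0 : ℝ) ≤ N := by positivity
    linarith
  obtain ⟨C₁, hC₁, h1⟩ := H.exists_abs_taylorRem_le ha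
  obtain ⟨C₂, hC₂, h2⟩ := (H.mono (Nat.le_succ m)).exists_abs_taylorRem_le' hmK
  obtain ⟨C₃, h3⟩ := H.exists_enorm_le ha
  set W := ∫⁻ x : EuclideanSpace ℝ (Fin N), radWeight K 1 x * ENNReal.ofReal ((1 + ‖x‖) ^ (-a))
  have hW : W ≠ ⊤ := (lintegral_radWeight_mul_decay_lt_top hab).ne
  set W' := ∫⁻ x : EuclideanSpace ℝ (Fin N), radWeight K 1 x * ‖h x‖ₑ
  have hW' : W' ≠ ⊤ := (H.lintegral_radWeight_lt_top hab).ne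
  have hdec (x : EuclideanSpace ℝ (Fin N)) : ENNReal.ofReal ((1 + ‖x‖) ^ (-a)) ≤ 1 := by
    rw [← ENNReal.ofReal_one]
    exact ENNReal.ofReal_le_ofReal (Real.rpow_le_one_of_one_le_of_nonpos
      (by linarith [norm_nonneg x]) (by linarith))
  refine ⟨ENNReal.ofReal C₁ * (1 + W) + (ENNReal.ofReal C₃ + ENNReal.ofReal (2 ^ K) * W' +
    ENNReal.ofReal C₂ * (1 + W)), ?_, fun y => ?_⟩
  · simp [ENNReal.mul_eq_top, hW, hW']
  rcases le_total ‖y‖ 1 with hy | hy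
  · rw [taylorMod_one_of_le_one hKm hy]
    have hT (x) : ‖taylorRem m h x y‖ₑ ≤ ENNReal.ofReal C₁ * ENNReal.ofReal (‖y‖ ^ (m + 1)) *
        ENNReal.ofReal ((1 + ‖x‖) ^ (-a)) := by
      have := norm_nonneg x
      rw [← ENNReal.ofReal_mul (by positivity), ← ENNReal.ofReal_mul (by positivity),
        Real.enorm_eq_ofReal_abs]
      exact ENNReal.ofReal_le_ofReal (h1 x y hy)
    refine ⟨fun x => (hT x).trans ?_, ?_⟩
    · rw [mul_right_comm]
      gcongr
      refine le_trans ?_ le_self_add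
      gcongr
      exact (hdec x).trans le_self_add
    · calc _ ≤ ∫⁻ x, ENNReal.ofReal C₁ * ENNReal.ofReal (‖y‖ ^ (m + 1)) *
            (radWeight K 1 x * ENNReal.ofReal ((1 + ‖x‖) ^ (-a))) := by
            refine lintegral_mono fun x => ?_
            rw [mul_left_comm]
            exact mul_le_mul_right (hT x) _
        _ = ENNReal.ofReal C₁ * ENNReal.ofReal (‖y‖ ^ (m + 1)) * W :=
            lintegral_const_mul' _ _ (ENNReal.mul_ne_top ENNReal.ofReal_ne_top
              ENNReal.ofReal_ne_top)
        _ ≤ _ := by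
            rw [mul_right_comm]
            gcongr
            refine le_trans ?_ le_self_add
            gcongr
            exact le_add_self
  · rw [taylorMod_one_of_one_le hKm hy]
    have hyK : 1 ≤ ENNReal.ofReal (‖y‖ ^ K) := by
      rw [← ENNReal.ofReal_one]
      exact ENNReal.ofReal_le_ofReal (Real.one_le_rpow hy hK0)
    have hT (x) : ‖taylorRem m h x y‖ₑ ≤ ‖h (x - y)‖ₑ +
        ENNReal.ofReal C₂ * ENNReal.ofReal (‖y‖ ^ K) * ENNReal.ofReal ((1 + ‖x‖) ^ (-a)) := by
      have := norm_nonneg x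
      rw [← ENNReal.ofReal_mul (by positivity), ← ENNReal.ofReal_mul (by positivity),
        Real.enorm_eq_ofReal_abs, Real.enorm_eq_ofReal_abs, ← ENNReal.ofReal_add (abs_nonneg _)
        (by positivity)]
      exact ENNReal.ofReal_le_ofReal (h2 x y hy)
    refine ⟨fun x => (hT x).trans ?_, ?_⟩
    · calc _ ≤ ENNReal.ofReal C₃ * ENNReal.ofReal (‖y‖ ^ K) +
            ENNReal.ofReal C₂ * ENNReal.ofReal (‖y‖ ^ K) * 1 := by
            gcongr
            · calc _ ≤ ENNReal.ofReal C₃ * 1 := by rw [mul_one]; exact h3 _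
                _ ≤ _ := by gcongr
            · exact hdec x
        _ = (ENNReal.ofReal C₃ + ENNReal.ofReal C₂ * 1) * ENNReal.ofReal (‖y‖ ^ K) := by ring
        _ ≤ _ := by
            refine mul_le_mul_left (le_trans (add_le_add le_self_add ?_) le_add_self) _
            exact mul_le_mul_right le_self_add _
    · have hmeas : Measurable fun x => radWeight K 1 x * ‖h (x - y)‖ₑ :=
        (measurable_radWeight K 1).mul
          (H.contDiff.continuous.comp (continuous_id.sub continuous_const)).measurable.enorm
      have hshift : ∫⁻ x, radWeight K 1 x * ‖h (x - y)‖ₑ ≤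
          ENNReal.ofReal (2 ^ K) * W' * ENNReal.ofReal (‖y‖ ^ K) := by
        have hy2 : radWeight K 1 y ≤ ENNReal.ofReal (2 ^ K) * ENNReal.ofReal (‖y‖ ^ K) := by
          rw [← ENNReal.ofReal_mul (by positivity), ← Real.mul_rpow (by norm_num) (norm_nonneg y),
            radWeight]
          gcongr
          linarith
        calc _ = ∫⁻ x, radWeight K 1 (x + y) * ‖h x‖ₑ := by
              rw [← lintegral_add_right_eq_self _ y]
              simp
          _ ≤ ∫⁻ x, (ENNReal.ofReal (2 ^ K) * ENNReal.ofReal (‖y‖ ^ K)) *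
              (radWeight K 1 x * ‖h x‖ₑ) := by
              refine lintegral_mono fun x => ?_
              rw [← mul_assoc, mul_comm (_ * _) (radWeight K 1 x)]
              gcongr
              have := ofReal_rpow_mul_radWeight_add_le hK0 zero_le_one x y
              rw [Real.one_rpow, ENNReal.ofReal_one, one_mul] at this
              exact this.trans (mul_le_mul_right hy2 _)
          _ = _ := by
              rw [lintegral_const_mul' _ _ (ENNReal.mul_ne_top ENNReal.ofReal_ne_top
                ENNReal.ofReal_ne_top)]
              ring
      calc _ ≤ ∫⁻ x, (radWeight K 1 x * ‖h (x - y)‖ₑ + ENNReal.ofReal C₂ *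
            ENNReal.ofReal (‖y‖ ^ K) * (radWeight K 1 x * ENNReal.ofReal ((1 + ‖x‖) ^ (-a)))) := by
            refine lintegral_mono fun x => ?_
            refine (mul_le_mul_right (hT x) _).trans (le_of_eq ?_)
            ring
        _ = (∫⁻ x, radWeight K 1 x * ‖h (x - y)‖ₑ) + ENNReal.ofReal C₂ *
            ENNReal.ofReal (‖y‖ ^ K) * W := by
            rw [lintegral_add_left hmeas, lintegral_const_mul' _ _
              (ENNReal.mul_ne_top ENNReal.ofReal_ne_top ENNReal.ofReal_ne_top)]
        _ ≤ ENNReal.ofReal (2 ^ K) * W' * ENNReal.ofReal (‖y‖ ^ K) + ENNReal.ofReal C₂ *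
            ENNReal.ofReal (‖y‖ ^ K) * W := by gcongr
        _ = (ENNReal.ofReal (2 ^ K) * W' + ENNReal.ofReal C₂ * W) * ENNReal.ofReal (‖y‖ ^ K) := by
            ring
        _ ≤ _ := by
            refine mul_le_mul_left (le_trans (add_le_add le_add_self ?_) le_add_self) _
            exact mul_le_mul_right le_add_self _

/-- The semigroup applied to a function with vanishing moments is controlled by the Taylor
remainder of the kernel. -/
theorem CondG.enorm_sgOp_le {N γ m : ℕ} {d L : ℝ} {G : EuclideanSpace ℝ (Fin N) → ℝ → ℝ}
    (hG : CondG N G γ d L) (hL : 0 < L) {φ : EuclideanSpace ℝ (Fin N) → ℝ}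
    (hφ : ∀ α : Fin N → ℕ, ∑ i, α i ≤ m → Integrable (fun x => mpowE N α x * φ x) ∧
      ∫ x, mpowE N α x * φ x = 0) {u : ℝ} (hu : 0 < u) (x : EuclideanSpace ℝ (Fin N)) :
    ‖sgOp N G u φ x‖ₑ ≤ ∫⁻ y, ENNReal.ofReal (((u ^ (1 / d)) ^ N)⁻¹) *
      ‖taylorRem m (fun z => G z 1) ((u ^ (1 / d))⁻¹ • x) ((u ^ (1 / d))⁻¹ • y)‖ₑ * ‖φ y‖ₑ := by
  have hr : 0 < u ^ (1 / d) := Real.rpow_pos_of_pos hu _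
  unfold sgOp
  simp_rw [hG.eq_scaled _ hu]
  set r := u ^ (1 / d)
  set H := fun z => G z 1
  have hφ0 : Integrable φ := by simpa [mpowE] using (hφ 0 (by simp)).1
  obtain ⟨C, hC⟩ := hG.decayE.exists_enorm_le (by positivity)
  have hH : Continuous H := hG.decayE.contDiff.continuous
  have h0 : Integrable fun y => H (r⁻¹ • (x - y)) * φ y := by
    refine hφ0.bdd_mul (c := |C|) (hH.comp (by fun_prop)).aestronglyMeasurable
      (.of_forall fun y => ?_)
    have := hC (r⁻¹ • (x - y))
    rw [← ofReal_norm] at this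
    exact ((ENNReal.ofReal_le_ofReal_iff (abs_nonneg C)).1
      (this.trans (ENNReal.ofReal_le_ofReal (le_abs_self C))))
  have h1 (j : ℕ) (hj : j ∈ Finset.range (m + 1)) := integral_multilinear_mul_eq_zero
    (Finset.mem_range_succ_iff.1 hj) hφ (iteratedFDeriv ℝ j H (r⁻¹ • x)) (-r⁻¹)
  have h2 : ∫ y, H (r⁻¹ • (x - y)) * φ y = ∫ y, taylorRem m H (r⁻¹ • x) (r⁻¹ • y) * φ y := by
    have h3 (y) : taylorRem m H (r⁻¹ • x) (r⁻¹ • y) * φ y = H (r⁻¹ • (x - y)) * φ y -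
        ∑ j ∈ Finset.range (m + 1), (j.factorial : ℝ)⁻¹ *
          (iteratedFDeriv ℝ j H (r⁻¹ • x) (fun _ => -r⁻¹ • y) * φ y) := by
      rw [taylorRem, sub_mul, smul_sub, Finset.sum_mul]
      simp_rw [neg_smul, mul_assoc]
    simp_rw [h3]
    rw [integral_sub h0 (integrable_finsetSum _ fun j hj => (h1 j hj).1.const_mul _),
      integral_finsetSum _ fun j hj => (h1 j hj).1.const_mul _,
      Finset.sum_eq_zero fun j hj => by rw [integral_const_mul, (h1 j hj).2, mul_zero], sub_zero]
  simp_rw [mul_assoc]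
  rw [integral_const_mul, h2, enorm_mul, Real.enorm_of_nonneg (r := (r ^ N)⁻¹) (by positivity),
    lintegral_const_mul' _ _ ENNReal.ofReal_ne_top]
  gcongr
  refine (enorm_integral_le_lintegral_enorm _).trans (le_of_eq ?_)
  simp_rw [enorm_mul]

theorem lintegral_mul_lintegral_le {X Y : Type*} [MeasurableSpace X] [MeasurableSpace Y]
    {μ : Measure X} {ν : Measure Y} [SFinite μ] [SFinite ν] {w : X → ℝ≥0∞} {k : X × Y → ℝ≥0∞}
    {g b : Y → ℝ≥0∞} (hw : Measurable w) (hk : Measurable k) (hg : Measurable g)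
    (h : ∀ᵐ y ∂ν, ∫⁻ x, w x * k (x, y) ∂μ ≤ b y) :
    ∫⁻ x, w x * ∫⁻ y, k (x, y) * g y ∂ν ∂μ ≤ ∫⁻ y, b y * g y ∂ν := by
  have hm : Measurable fun p : X × Y => w p.1 * (k p * g p.2) := by fun_prop
  have h1 (x : X) : w x * ∫⁻ y, k (x, y) * g y ∂ν = ∫⁻ y, w x * (k (x, y) * g y) ∂ν :=
    (lintegral_const_mul _ (by fun_prop)).symm
  simp_rw [h1]
  rw [lintegral_lintegral_swap hm.aemeasurable]
  refine lintegral_mono_ae ?_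
  filter_upwards [h] with y hy
  simp_rw [← mul_assoc]
  rw [lintegral_mul_const _ (by fun_prop)]
  gcongr

theorem taylorMod_le_of_le {N : ℕ} {K c r ρ : ℝ} {m : ℕ} (hKm : K < m + 1)
    (hρ : 0 < ρ) (hc : 1 ≤ c) (h : ρ ≤ c * r) (y : EuclideanSpace ℝ (Fin N)) :
    taylorMod K m r y ≤ c ^ (m + 1 - K) * taylorMod K m ρ y := by
  have hc1 : 1 ≤ c ^ (m + 1 - K) := Real.one_le_rpow hc (by linarith)
  have hc0 : 0 < c := by linarith
  have hy := norm_nonneg y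
  rw [taylorMod, taylorMod, mul_min_of_nonneg _ _ (by positivity)]
  refine min_le_min (le_mul_of_one_le_left (by positivity) hc1) ?_
  rw [mul_left_comm]
  gcongr
  calc r ^ (K - (m + 1)) ≤ (c⁻¹ * ρ) ^ (K - (m + 1)) := by
        refine Real.rpow_le_rpow_of_nonpos (by positivity) ?_ (by linarith)
        rw [inv_mul_le_iff₀ hc0]
        exact h
    _ = _ := by
        rw [Real.mul_rpow (by positivity) hρ.le, Real.inv_rpow hc0.le, ← Real.rpow_neg hc0.le]
        congr 2
        ring

/-- Uniform and weighted `L¹` bounds of the rescaled Taylor remainder. -/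
theorem DecayE.exists_scaled_taylorRem_le {N m : ℕ} {a K c : ℝ}
    {h : EuclideanSpace ℝ (Fin N) → ℝ}
    (H : DecayE (m + 1) a h) (hK0 : 0 ≤ K) (hmK : m ≤ K) (hKm : K < m + 1) (hab : K + N < a)
    (hc : 1 ≤ c) :
    ∃ C : ℝ≥0∞, C ≠ ⊤ ∧ ∀ r ρ : ℝ, 0 < r → 0 < ρ → ρ ≤ c * r → ∀ y,
      (∀ x, ENNReal.ofReal (ρ ^ (K + N)) *
        (ENNReal.ofReal (r ^ N)⁻¹ * ‖taylorRem m h (r⁻¹ • x) (r⁻¹ • y)‖ₑ) ≤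
        C * ENNReal.ofReal (taylorMod K m ρ y)) ∧
      ∫⁻ x, radWeight K ρ x *
        (ENNReal.ofReal (r ^ N)⁻¹ * ‖taylorRem m h (r⁻¹ • x) (r⁻¹ • y)‖ₑ) ≤
        C * ENNReal.ofReal (taylorMod K m ρ y) := by
  obtain ⟨C, hC, h1⟩ := H.exists_taylorRem_le hK0 hmK hKm hab
  have hc0 : 0 < c := by linarith
  refine ⟨ENNReal.ofReal (c ^ (K + N)) * (C * ENNReal.ofReal (c ^ (m + 1 - K))),
    by finiteness, fun r ρ hr hρ hρr y => ?_⟩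
  have hmod : C * (ENNReal.ofReal (r ^ K) * ENNReal.ofReal (taylorMod K m 1 (r⁻¹ • y))) ≤
      C * ENNReal.ofReal (c ^ (m + 1 - K)) * ENNReal.ofReal (taylorMod K m ρ y) := by
    rw [mul_assoc, ← ENNReal.ofReal_mul (by positivity), ← ENNReal.ofReal_mul (by positivity),
      rpow_mul_taylorMod_inv_smul K m hr]
    gcongr
    exact taylorMod_le_of_le hKm hρ hc hρr y
  have hpow : ENNReal.ofReal (r ^ (K + N)) * ENNReal.ofReal (r ^ N)⁻¹ = ENNReal.ofReal (r ^ K) := by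
    rw [← ENNReal.ofReal_mul (by positivity), Real.rpow_add hr, Real.rpow_natCast]
    congr 1
    field_simp
  refine ⟨fun x => ?_, ?_⟩
  · calc _ ≤ ENNReal.ofReal (c ^ (K + N)) * ENNReal.ofReal (r ^ (K + N)) *
          (ENNReal.ofReal (r ^ N)⁻¹ * (C * ENNReal.ofReal (taylorMod K m 1 (r⁻¹ • y)))) := by
          rw [← ENNReal.ofReal_mul (by positivity), ← Real.mul_rpow hc0.le hr.le]
          gcongr
          exact (h1 _).1 _
      _ = ENNReal.ofReal (c ^ (K + N)) * (C * ((ENNReal.ofReal (r ^ (K + N)) *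
          ENNReal.ofReal (r ^ N)⁻¹) * ENNReal.ofReal (taylorMod K m 1 (r⁻¹ • y)))) := by ring
      _ ≤ _ := by
          rw [hpow, mul_assoc]
          exact mul_le_mul_right hmod _
  · have hw (x : EuclideanSpace ℝ (Fin N)) :
        radWeight K ρ x ≤ ENNReal.ofReal (c ^ (K + N)) * radWeight K r x := by
      have hx := norm_nonneg x
      unfold radWeight
      rw [← ENNReal.ofReal_mul (by positivity)]
      apply ENNReal.ofReal_le_ofReal
      calc (ρ + ‖x‖) ^ K ≤ (c * (r + ‖x‖)) ^ K := by
            refine Real.rpow_le_rpow (by positivity) ?_ hK0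
            nlinarith
        _ = c ^ K * (r + ‖x‖) ^ K := Real.mul_rpow hc0.le (by positivity)
        _ ≤ _ := by
            gcongr
            linarith [(Nat.cast_nonneg N : (0 : ℝ) ≤ N)]
    calc _ ≤ ∫⁻ x, ENNReal.ofReal (c ^ (K + N)) * ENNReal.ofReal (r ^ N)⁻¹ * (radWeight K r x *
          ‖taylorRem m h (r⁻¹ • x) (r⁻¹ • y)‖ₑ) := by
          refine lintegral_mono fun x => ?_
          refine (mul_le_mul_left (hw x) _).trans (le_of_eq ?_)
          ring
      _ = ENNReal.ofReal (c ^ (K + N)) * ENNReal.ofReal (r ^ N)⁻¹ *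
          (ENNReal.ofReal (r ^ (K + N)) * ∫⁻ x, radWeight K 1 x *
          ‖taylorRem m h x (r⁻¹ • y)‖ₑ) := by
          rw [lintegral_const_mul' _ _ (by finiteness), lintegral_radWeight_mul_comp_inv_smul K
            (fun x => ‖taylorRem m h x (r⁻¹ • y)‖ₑ) hr]
      _ ≤ ENNReal.ofReal (c ^ (K + N)) * ENNReal.ofReal (r ^ N)⁻¹ *
          (ENNReal.ofReal (r ^ (K + N)) * (C * ENNReal.ofReal (taylorMod K m 1 (r⁻¹ • y)))) := by
          gcongr
          exact (h1 _).2
      _ = ENNReal.ofReal (c ^ (K + N)) * (C * ((ENNReal.ofReal (r ^ (K + N)) *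
          ENNReal.ofReal (r ^ N)⁻¹) * ENNReal.ofReal (taylorMod K m 1 (r⁻¹ • y)))) := by ring
      _ ≤ _ := by
          rw [hpow, mul_assoc]
          exact mul_le_mul_right hmod _

/-- The integrated modulus tends to zero as the scale grows. -/
theorem tendsto_lintegral_taylorMod_mul {N m : ℕ} {K : ℝ} (hKm : K < m + 1)
    {ν : Measure (ℝ × EuclideanSpace ℝ (Fin N))} {g : ℝ × EuclideanSpace ℝ (Fin N) → ℝ≥0∞}
    (hg : Measurable g) (hg' : ∀ p, g p ≠ ⊤)
    (hfin : ∫⁻ p, ENNReal.ofReal (‖p.2‖ ^ K) * g p ∂ν ≠ ⊤) :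
    Tendsto (fun ρ : ℝ => ∫⁻ p, ENNReal.ofReal (taylorMod K m ρ p.2) * g p ∂ν) atTop (𝓝 0) := by
  have h0 : ∫⁻ _, 0 ∂ν = 0 := lintegral_zero
  rw [← h0]
  refine tendsto_lintegral_filter_of_dominated_convergence
    (fun p => ENNReal.ofReal (‖p.2‖ ^ K) * g p) (.of_forall fun ρ => ?_)
    (.of_forall fun ρ => .of_forall fun p => ?_) hfin (.of_forall fun p => ?_)
  · exact ((measurable_taylorMod K m ρ).comp measurable_snd).ennreal_ofReal.mul hg
  · gcongr
    exact min_le_left _ _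
  · have h1 : Tendsto (fun ρ : ℝ => ‖p.2‖ ^ (m + 1) * ρ ^ (K - (m + 1))) atTop (𝓝 0) := by
      have := (tendsto_rpow_neg_atTop (y := m + 1 - K) (by linarith)).const_mul (‖p.2‖ ^ (m + 1))
      simpa using this
    have h2 : Tendsto (fun ρ : ℝ => ENNReal.ofReal (‖p.2‖ ^ (m + 1) * ρ ^ (K - (m + 1))) * g p)
        atTop (𝓝 0) := by
      simpa using ENNReal.Tendsto.mul_const (ENNReal.tendsto_ofReal h1) (Or.inr (hg' p))
    refine tendsto_of_tendsto_of_tendsto_of_le_of_le tendsto_const_nhds h2 (fun _ => zero_le)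
      fun ρ => ?_
    simp only
    gcongr
    exact min_le_right _ _

theorem ofReal_rpow_mul_eLpNorm_le {N : ℕ} {K ρ : ℝ} {V : EuclideanSpace ℝ (Fin N) → ℝ≥0∞}
    {M q : ℝ≥0∞} (hK : 0 ≤ K) (hρ : 0 < ρ) (h1 : ∫⁻ x, radWeight K ρ x * V x ≤ M)
    (h2 : ∀ x, ENNReal.ofReal (ρ ^ (K + N)) * V x ≤ M) (hq : 1 ≤ q) :
    ENNReal.ofReal (ρ ^ K) * (ENNReal.ofReal (ρ ^ (N * (1 - q.toReal⁻¹))) *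
      eLpNorm V q volume) ≤ M := by
  have hc : ENNReal.ofReal (ρ ^ K) ≠ 0 := by simpa using Real.rpow_pos_of_pos hρ K
  rw [mul_comm, ← ENNReal.le_div_iff_mul_le (Or.inl hc) (Or.inl ENNReal.ofReal_ne_top),
    Real.rpow_mul hρ.le]
  refine eLpNorm_le_of_lintegral_le_of_sup_le (by positivity) ?_ (fun x => ?_) hq <;>
    rw [ENNReal.le_div_iff_mul_le (Or.inl hc) (Or.inl ENNReal.ofReal_ne_top), mul_comm]
  · rw [← lintegral_const_mul' _ _ ENNReal.ofReal_ne_top]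
    refine (lintegral_mono fun x => ?_).trans h1
    refine mul_le_mul_left (ENNReal.ofReal_le_ofReal ?_) _
    exact Real.rpow_le_rpow hρ.le (by linarith [norm_nonneg x]) hK
  · rw [← mul_assoc, ← ENNReal.ofReal_mul (by positivity), ← Real.rpow_add hρ]
    exact h2 x

/-- Taylor remainder of the kernel of the semigroup, at time `t - p.1` and in the direction of
`-p.2`. -/
noncomputable def taylorKer {N : ℕ} (m : ℕ) (d : ℝ) (h : EuclideanSpace ℝ (Fin N) → ℝ) (t : ℝ)
    (z : EuclideanSpace ℝ (Fin N) × ℝ × EuclideanSpace ℝ (Fin N)) : ℝ≥0∞ :=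
  ENNReal.ofReal ((((t - z.2.1) ^ (1 / d)) ^ N)⁻¹) *
    ‖taylorRem m h (((t - z.2.1) ^ (1 / d))⁻¹ • z.1) (((t - z.2.1) ^ (1 / d))⁻¹ • z.2.2)‖ₑ

theorem measurable_taylorKer {N m : ℕ} {d : ℝ} {h : EuclideanSpace ℝ (Fin N) → ℝ}
    (hh : ContDiff ℝ m h) (t : ℝ) : Measurable (taylorKer m d h t) := by
  have h1 := (continuous_taylorRem hh).measurable
  have h2 : Measurable fun z : EuclideanSpace ℝ (Fin N) × ℝ × EuclideanSpace ℝ (Fin N) =>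
      ((((t - z.2.1) ^ (1 / d))⁻¹ • z.1), (((t - z.2.1) ^ (1 / d))⁻¹ • z.2.2)) := by fun_prop
  have h3 := (h1.comp h2).enorm
  have h4 : Measurable fun z : EuclideanSpace ℝ (Fin N) × ℝ × EuclideanSpace ℝ (Fin N) =>
      ENNReal.ofReal ((((t - z.2.1) ^ (1 / d)) ^ N)⁻¹) := by fun_prop
  exact h4.mul h3

/-- Contribution of the times far from `t`. -/
theorem DecayE.exists_taylorKer_le {N m : ℕ} {a d K : ℝ} {h : EuclideanSpace ℝ (Fin N) → ℝ}
    (H : DecayE (m + 1) a h) (hd : 0 < d) (hK0 : 0 ≤ K) (hmK : m ≤ K) (hKm : K < m + 1)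
    (hab : K + N < a) :
    ∃ C : ℝ≥0∞, C ≠ ⊤ ∧ ∀ g : ℝ × EuclideanSpace ℝ (Fin N) → ℝ≥0∞, Measurable g → ∀ t, 0 < t →
      (∀ x, ENNReal.ofReal ((t ^ (1 / d)) ^ (K + N)) *
        ∫⁻ p, taylorKer m d h t (x, p) * g p ∂(volume.restrict (Set.Ioo 0 (t / 2))).prod volume ≤
        C * ∫⁻ p, ENNReal.ofReal (taylorMod K m (t ^ (1 / d)) p.2) * g p
          ∂(volume.restrict (Set.Ioi 0)).prod volume) ∧
      ∫⁻ x, radWeight K (t ^ (1 / d)) x *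
        ∫⁻ p, taylorKer m d h t (x, p) * g p ∂(volume.restrict (Set.Ioo 0 (t / 2))).prod volume ≤
        C * ∫⁻ p, ENNReal.ofReal (taylorMod K m (t ^ (1 / d)) p.2) * g p
          ∂(volume.restrict (Set.Ioi 0)).prod volume := by
  obtain ⟨C, hC, h1⟩ := H.exists_scaled_taylorRem_le hK0 hmK hKm hab (c := 2 ^ (1 / d))
    (Real.one_le_rpow one_le_two (by positivity))
  refine ⟨C, hC, fun g hg t ht => ?_⟩
  have hρ : 0 < t ^ (1 / d) := by positivity
  have hker : Measurable (taylorKer m d h t) :=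
    measurable_taylorKer (H.contDiff.of_le (by norm_cast; omega)) t
  have hmod : Measurable fun p : ℝ × EuclideanSpace ℝ (Fin N) =>
      ENNReal.ofReal (taylorMod K m (t ^ (1 / d)) p.2) :=
    ((measurable_taylorMod K m _).comp measurable_snd).ennreal_ofReal
  have hs : ∀ᵐ p ∂(volume.restrict (Set.Ioo 0 (t / 2))).prod
      (volume : Measure (EuclideanSpace ℝ (Fin N))), p.1 ∈ Set.Ioo 0 (t / 2) := by
    rw [Measure.restrict_prod_eq_prod_univ]
    exact ae_restrict_of_forall_mem (measurableSet_Ioo.prod .univ) fun p hp => hp.1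
  have hr {s : ℝ} (hs : s ∈ Set.Ioo 0 (t / 2)) : 0 < (t - s) ^ (1 / d) ∧
      t ^ (1 / d) ≤ 2 ^ (1 / d) * (t - s) ^ (1 / d) := by
    have h2 : 0 < t - s := by linarith [hs.2]
    refine ⟨by positivity, ?_⟩
    rw [← Real.mul_rpow (by norm_num) h2.le]
    exact Real.rpow_le_rpow ht.le (by linarith [hs.2]) (by positivity)
  have hmono : ∫⁻ p, C * ENNReal.ofReal (taylorMod K m (t ^ (1 / d)) p.2) * g p
      ∂(volume.restrict (Set.Ioo 0 (t / 2))).prod volume ≤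
      C * ∫⁻ p, ENNReal.ofReal (taylorMod K m (t ^ (1 / d)) p.2) * g p
          ∂(volume.restrict (Set.Ioi 0)).prod volume := by
    simp_rw [mul_assoc]
    rw [lintegral_const_mul' _ _ hC, Measure.restrict_prod_eq_prod_univ,
      Measure.restrict_prod_eq_prod_univ]
    gcongr
    exact Set.Ioo_subset_Ioi_self
  refine ⟨fun x => ?_, ?_⟩
  · refine le_trans ?_ hmono
    rw [← lintegral_const_mul' _ _ ENNReal.ofReal_ne_top]
    refine lintegral_mono_ae ?_
    filter_upwards [hs] with p hp
    rw [← mul_assoc]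
    exact mul_le_mul_left ((h1 _ _ (hr hp).1 hρ (hr hp).2 p.2).1 x) _
  · refine le_trans (lintegral_mul_lintegral_le (measurable_radWeight _ _) hker hg ?_) hmono
    filter_upwards [hs] with p hp
    exact (h1 _ _ (hr hp).1 hρ (hr hp).2 p.2).2

theorem radWeight_le_ofReal_rpow_mul {N : ℕ} {K c ρ r : ℝ} (hK : 0 ≤ K) (hc : 1 ≤ c) (hρ : 0 ≤ ρ)
    (hr : 0 ≤ r) (h : ρ ≤ c * r) (x : EuclideanSpace ℝ (Fin N)) :
    radWeight K ρ x ≤ ENNReal.ofReal (c ^ K) * radWeight K r x := by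
  have hx := norm_nonneg x
  unfold radWeight
  rw [← ENNReal.ofReal_mul (by positivity), ← Real.mul_rpow (by positivity) (by positivity)]
  exact ENNReal.ofReal_le_ofReal (Real.rpow_le_rpow (by positivity) (by nlinarith) hK)

theorem lintegral_radWeight_mul_scaled_le {N : ℕ} {K r ρ : ℝ} (hK : 0 ≤ K) (hr : 0 < r)
    (hρ : r ≤ ρ) (F : EuclideanSpace ℝ (Fin N) → ℝ≥0∞) :
    ∫⁻ x, radWeight K ρ x * (ENNReal.ofReal ((r ^ N)⁻¹) * F (r⁻¹ • x)) ≤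
      ENNReal.ofReal (ρ ^ K) * ∫⁻ x, radWeight K 1 x * F x := by
  have hρ0 : 0 < ρ := hr.trans_le hρ
  calc _ ≤ ∫⁻ x, ENNReal.ofReal ((ρ / r) ^ K) * ENNReal.ofReal ((r ^ N)⁻¹) *
        (radWeight K r x * F (r⁻¹ • x)) := by
        refine lintegral_mono fun x => (mul_le_mul_left (radWeight_le_ofReal_rpow_mul hK
          ((one_le_div hr).2 hρ) hρ0.le hr.le (div_mul_cancel₀ ρ hr.ne').ge x) _).trans
          (le_of_eq ?_)
        ring
    _ = _ := by
        rw [lintegral_const_mul' _ _ (by finiteness), lintegral_radWeight_mul_comp_inv_smul K F hr,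
          ← mul_assoc, ← ENNReal.ofReal_mul (by positivity), ← ENNReal.ofReal_mul (by positivity),
          Real.div_rpow hρ0.le hr.le, Real.rpow_add hr, Real.rpow_natCast]
        congr 2
        have : 0 < r ^ K := by positivity
        field_simp

/-- Kernel of the semigroup at time `t - p.1` and at the point `p.2`. -/
noncomputable def heatKer {N : ℕ} (d : ℝ) (h : EuclideanSpace ℝ (Fin N) → ℝ) (t : ℝ)
    (p : ℝ × EuclideanSpace ℝ (Fin N)) : ℝ≥0∞ :=
  ENNReal.ofReal ((((t - p.1) ^ (1 / d)) ^ N)⁻¹) * ‖h (((t - p.1) ^ (1 / d))⁻¹ • p.2)‖ₑ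

theorem measurable_heatKer {N : ℕ} {d : ℝ} {h : EuclideanSpace ℝ (Fin N) → ℝ}
    (hh : Continuous h) (t : ℝ) : Measurable (heatKer d h t) := by
  have h2 : Measurable fun p : ℝ × EuclideanSpace ℝ (Fin N) =>
      ((t - p.1) ^ (1 / d))⁻¹ • p.2 := by fun_prop
  have h3 := (hh.measurable.comp h2).enorm
  have h4 : Measurable fun p : ℝ × EuclideanSpace ℝ (Fin N) =>
      ENNReal.ofReal ((((t - p.1) ^ (1 / d)) ^ N)⁻¹) := by fun_prop
  exact h4.mul h3

theorem lintegral_prod_mul_fst {X Y : Type*} [MeasurableSpace X] [MeasurableSpace Y]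
    {ν : Measure X} {μ : Measure Y} [SFinite μ] {F : X × Y → ℝ≥0∞} {n : X → ℝ≥0∞}
    (hF : Measurable F) (hn : Measurable n) :
    ∫⁻ p, F p * n p.1 ∂ν.prod μ = ∫⁻ s, (∫⁻ z, F (s, z) ∂μ) * n s ∂ν := by
  rw [lintegral_prod _ (by fun_prop)]
  exact lintegral_congr fun s => lintegral_mul_const (n s) (hF.comp measurable_prodMk_left)

/-- Weighted `L¹` bound of a space-time convolution. -/
theorem lintegral_radWeight_mul_conv_le {N : ℕ} {K ρ : ℝ} {W : ℝ≥0∞} (hK : 0 ≤ K) (hρ : 0 < ρ)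
    {ν : Measure ℝ} [SFinite ν] {κ g : ℝ × EuclideanSpace ℝ (Fin N) → ℝ≥0∞} (hκ : Measurable κ)
    (hg : Measurable g)
    (h : ∀ᵐ s ∂ν, ∫⁻ z, radWeight K ρ z * κ (s, z) ≤ ENNReal.ofReal (ρ ^ K) * W) :
    ∫⁻ x, radWeight K ρ x * ∫⁻ p, κ p * g (p.1, x - p.2) ∂ν.prod volume ≤
      W * ∫⁻ s, (∫⁻ y, radWeight K ρ y * g (s, y)) ∂ν := by
  have hc : ENNReal.ofReal (ρ ^ K) ≠ 0 := by simpa using Real.rpow_pos_of_pos hρ K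
  have hwm := measurable_radWeight (N := N) K ρ
  rw [← ENNReal.mul_le_mul_iff_right hc ENNReal.ofReal_ne_top]
  have hm : Measurable fun z : EuclideanSpace ℝ (Fin N) × ℝ × EuclideanSpace ℝ (Fin N) =>
      radWeight K ρ z.1 * (κ z.2 * g (z.2.1, z.1 - z.2.2)) := by fun_prop
  have hgy (s : ℝ) : Measurable fun y => radWeight K ρ y * g (s, y) := by fun_prop
  have hn : Measurable fun s => ∫⁻ y, radWeight K ρ y * g (s, y) :=
    Measurable.lintegral_prod_right' (f := fun p : ℝ × EuclideanSpace ℝ (Fin N) =>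
      radWeight K ρ p.2 * g p) (by fun_prop)
  calc _ = ENNReal.ofReal (ρ ^ K) * ∫⁻ p, ∫⁻ x, radWeight K ρ x * (κ p * g (p.1, x - p.2))
          ∂volume ∂ν.prod volume := by
        rw [← lintegral_lintegral_swap hm.aemeasurable]
        congr 1
        refine lintegral_congr fun x => ?_
        rw [lintegral_const_mul _ (by fun_prop)]
    _ = ∫⁻ p, ∫⁻ y, ENNReal.ofReal (ρ ^ K) * radWeight K ρ (p.2 + y) * (κ p * g (p.1, y))
          ∂volume ∂ν.prod volume := by
        rw [← lintegral_const_mul' _ _ ENNReal.ofReal_ne_top]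
        refine lintegral_congr fun p => ?_
        rw [← lintegral_const_mul' _ _ ENNReal.ofReal_ne_top, ← lintegral_sub_right_eq_self
          (fun y => ENNReal.ofReal (ρ ^ K) * radWeight K ρ (p.2 + y) * (κ p * g (p.1, y))) p.2]
        refine lintegral_congr fun x => ?_
        rw [add_sub_cancel, mul_assoc]
    _ ≤ ∫⁻ p, radWeight K ρ p.2 * κ p * (∫⁻ y, radWeight K ρ y * g (p.1, y)) ∂ν.prod volume := by
        refine lintegral_mono fun p => ?_
        rw [← lintegral_const_mul _ (hgy _)]
        refine lintegral_mono fun y => ?_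
        refine (mul_le_mul_left (ofReal_rpow_mul_radWeight_add_le hK hρ.le p.2 y) _).trans
          (le_of_eq ?_)
        ring
    _ = ∫⁻ s, (∫⁻ z, radWeight K ρ z * κ (s, z)) * (∫⁻ y, radWeight K ρ y * g (s, y)) ∂ν :=
        lintegral_prod_mul_fst (by fun_prop) hn
    _ ≤ ∫⁻ s, ENNReal.ofReal (ρ ^ K) * (W * ∫⁻ y, radWeight K ρ y * g (s, y)) ∂ν := by
        refine lintegral_mono_ae ?_
        filter_upwards [h] with s hs
        rw [← mul_assoc]
        exact mul_le_mul_left hs _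
    _ = _ := by
        rw [lintegral_const_mul' _ _ ENNReal.ofReal_ne_top, lintegral_const_mul _ hn]

theorem eLpNorm_const_mul_le {X : Type*} [MeasurableSpace X] {μ : Measure X} {c : ℝ≥0∞}
    (hc : c ≠ ⊤) (w : X → ℝ≥0∞) (q : ℝ≥0∞) :
    eLpNorm (fun x => c * w x) q μ ≤ c * eLpNorm w q μ := by
  lift c to NNReal using hc
  exact eLpNorm_le_nnreal_smul_eLpNorm_of_ae_le_mul' (.of_forall fun x => by simp) q

/-- `L^q` bound of a space-time convolution. -/
theorem eLpNorm_conv_le {N : ℕ} {W q : ℝ≥0∞} (hq : 1 ≤ q)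
    {ν : Measure ℝ} [SFinite ν] {κ g : ℝ × EuclideanSpace ℝ (Fin N) → ℝ≥0∞} (hκ : Measurable κ)
    (hκ' : ∀ p, κ p ≠ ⊤) (hg : Measurable g) (h : ∀ᵐ s ∂ν, ∫⁻ z, κ (s, z) ≤ W) :
    eLpNorm (fun x => ∫⁻ p, κ p * g (p.1, x - p.2) ∂ν.prod volume) q volume ≤
      W * ∫⁻ s, eLpNorm (fun y => g (s, y)) q volume ∂ν := by
  have hn : Measurable fun s => eLpNorm (fun y => g (s, y)) q volume :=
    measurable_eLpNorm_section (F := fun z => g (z.2, z.1)) (by fun_prop) q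
  calc _ ≤ ∫⁻ p, eLpNorm (fun x => κ p * g (p.1, x - p.2)) q volume ∂ν.prod volume :=
        eLpNorm_lintegral_le (F := fun z : EuclideanSpace ℝ (Fin N) × ℝ × EuclideanSpace ℝ (Fin N) =>
          κ z.2 * g (z.2.1, z.1 - z.2.2)) (by fun_prop) hq
    _ ≤ ∫⁻ p, κ p * eLpNorm (fun y => g (p.1, y)) q volume ∂ν.prod volume := by
        refine lintegral_mono fun p => (eLpNorm_const_mul_le (hκ' p) _ q).trans (le_of_eq ?_)
        congr 1
        have hgy : Measurable fun y => g (p.1, y) := by fun_prop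
        exact eLpNorm_comp_measurePreserving hgy.aestronglyMeasurable
          (measurePreserving_sub_right volume p.2)
    _ = ∫⁻ s, (∫⁻ z, κ (s, z)) * eLpNorm (fun y => g (s, y)) q volume ∂ν :=
        lintegral_prod_mul_fst hκ hn
    _ ≤ ∫⁻ s, W * eLpNorm (fun y => g (s, y)) q volume ∂ν := by
        refine lintegral_mono_ae ?_
        filter_upwards [h] with s hs
        exact mul_le_mul_left hs _
    _ = _ := lintegral_const_mul _ hn

theorem tendsto_setLIntegral_Ico_half {e : ℝ → ℝ≥0∞} (he : ∫⁻ s in Set.Ioi 0, e s < ⊤) :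
    Tendsto (fun t : ℝ => ∫⁻ s in Set.Ico (t / 2) t, e s) atTop (𝓝 0) := by
  have hfin : IsFiniteMeasure ((volume.restrict (Set.Ioi 0)).withDensity e) :=
    isFiniteMeasure_withDensity he.ne
  have h1 := tendsto_measure_iInter_atTop (s := fun t : ℝ => Set.Ici t)
    (μ := (volume.restrict (Set.Ioi (0 : ℝ))).withDensity e)
    (fun t => measurableSet_Ici.nullMeasurableSet) (fun _ _ h => Set.Ici_subset_Ici.2 h)
    ⟨0, measure_ne_top _ _⟩
  have h3 : ⋂ t : ℝ, Set.Ici t = ∅ :=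
    Set.eq_empty_of_forall_notMem fun x hx => (lt_add_one x).not_ge (Set.mem_iInter.1 hx (x + 1))
  rw [h3, measure_empty] at h1
  have h2 := h1.comp (tendsto_id.atTop_div_const (two_pos (α := ℝ)))
  refine tendsto_of_tendsto_of_tendsto_of_le_of_le' tendsto_const_nhds h2
    (.of_forall fun _ => zero_le) ?_
  filter_upwards [eventually_gt_atTop 0] with t ht
  simp only [Function.comp, id]
  rw [withDensity_apply _ measurableSet_Ici, Measure.restrict_restrict measurableSet_Ici]
  exact lintegral_mono_set fun s hs => ⟨hs.1, lt_of_lt_of_le (by positivity) hs.1⟩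

/-- Contribution of the times close to `t`. -/
theorem DecayE.exists_heatKer_le {N k : ℕ} {a d K : ℝ} {q : ℝ≥0∞}
    {h : EuclideanSpace ℝ (Fin N) → ℝ} (H : DecayE k a h) (hd : 0 < d) (hK0 : 0 ≤ K)
    (hab : K + N < a) (hq : 1 ≤ q) :
    ∃ C : ℝ≥0∞, C ≠ ⊤ ∧ ∀ (g : ℝ × EuclideanSpace ℝ (Fin N) → ℝ≥0∞) (e : ℝ → ℝ≥0∞),
      Measurable g →
      (∀ s, 0 < s → ∫⁻ y, radWeight K ((1 + s) ^ (1 / d)) y * g (s, y) ≤ e s) →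
      (∀ s, 0 < s → ENNReal.ofReal (((1 + s) ^ (1 / d)) ^ K) *
        (ENNReal.ofReal (s ^ ((N / d) * (1 - q.toReal⁻¹))) *
          eLpNorm (fun y => g (s, y)) q volume) ≤ e s) → ∀ t, 0 < t →
      ENNReal.ofReal ((t ^ (1 / d)) ^ K) * (ENNReal.ofReal ((t ^ (1 / d)) ^ (N * (1 - q.toReal⁻¹))) *
        eLpNorm (fun x => ∫⁻ p, heatKer d h t p * g (p.1, x - p.2)
          ∂(volume.restrict (Set.Ico (t / 2) t)).prod volume) q volume) ≤
        C * ∫⁻ s in Set.Ico (t / 2) t, e s ∧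
      ∫⁻ x, radWeight K (t ^ (1 / d)) x * ∫⁻ p, heatKer d h t p * g (p.1, x - p.2)
          ∂(volume.restrict (Set.Ico (t / 2) t)).prod volume ≤
        C * ∫⁻ s in Set.Ico (t / 2) t, e s := by
  set W := ∫⁻ x, radWeight K 1 x * ‖h x‖ₑ with hWdef
  have hW : W ≠ ⊤ := (H.lintegral_radWeight_lt_top hab).ne
  have hθ := one_sub_inv_toReal_nonneg hq
  set θ := 1 - q.toReal⁻¹
  set c : ℝ := 2 ^ (1 / d)
  have hc : 1 ≤ c := Real.one_le_rpow one_le_two (by positivity)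
  have hc0 : 0 < c := by positivity
  refine ⟨W * ENNReal.ofReal (c ^ K) * ENNReal.ofReal (c ^ (N * θ)), by finiteness,
    fun g e hg he1 he2 t ht => ?_⟩
  have hh := H.contDiff.continuous
  have hκ := measurable_heatKer (d := d) hh t
  have hρ : 0 < t ^ (1 / d) := by positivity
  set ρ := t ^ (1 / d) with hρdef
  have hs {s : ℝ} (hs : s ∈ Set.Ico (t / 2) t) : 0 < s ∧ ρ ≤ c * s ^ (1 / d) ∧
      ρ ≤ c * (1 + s) ^ (1 / d) ∧ 0 < (t - s) ^ (1 / d) ∧ (t - s) ^ (1 / d) ≤ ρ := by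
    have h0 : 0 < s := lt_of_lt_of_le (by positivity) hs.1
    have h1 : 0 < t - s := by linarith [hs.2]
    refine ⟨h0, ?_, ?_, by positivity, Real.rpow_le_rpow h1.le (by linarith) (by positivity)⟩
    · rw [← Real.mul_rpow (by norm_num) h0.le]
      exact Real.rpow_le_rpow ht.le (by linarith [hs.1]) (by positivity)
    · rw [← Real.mul_rpow (by norm_num) (by linarith)]
      exact Real.rpow_le_rpow ht.le (by linarith [hs.1]) (by positivity)
  have hker : ∀ s ∈ Set.Ico (t / 2) t,
      ∫⁻ z, radWeight K ρ z * heatKer d h t (s, z) ≤ ENNReal.ofReal (ρ ^ K) * W := fun s hs' =>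
    lintegral_radWeight_mul_scaled_le hK0 (hs hs').2.2.2.1 (hs hs').2.2.2.2 fun z => ‖h z‖ₑ
  have hker' : ∀ s ∈ Set.Ico (t / 2) t, ∫⁻ z, heatKer d h t (s, z) ≤ W := fun s hs' => by
    have hρK : ENNReal.ofReal (ρ ^ K) ≠ 0 := by simpa using Real.rpow_pos_of_pos hρ K
    rw [← ENNReal.mul_le_mul_iff_right hρK ENNReal.ofReal_ne_top,
      ← lintegral_const_mul' _ _ ENNReal.ofReal_ne_top]
    refine (lintegral_mono fun z => mul_le_mul_left (ENNReal.ofReal_le_ofReal ?_) _).trans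
      (hker s hs')
    exact Real.rpow_le_rpow hρ.le (by linarith [norm_nonneg z]) hK0
  have hcθ : 1 ≤ ENNReal.ofReal (c ^ (N * θ)) := by
    rw [ENNReal.one_le_ofReal]
    exact Real.one_le_rpow hc (by positivity)
  have hn : Measurable fun s => eLpNorm (fun y => g (s, y)) q volume :=
    measurable_eLpNorm_section (F := fun z => g (z.2, z.1)) (by fun_prop) q
  constructor
  · calc _ ≤ ENNReal.ofReal (ρ ^ K) * (ENNReal.ofReal (ρ ^ (N * θ)) *
          (W * ∫⁻ s in Set.Ico (t / 2) t, eLpNorm (fun y => g (s, y)) q volume)) := by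
          gcongr
          exact eLpNorm_conv_le hq hκ (fun p => by unfold heatKer; finiteness) hg
            (ae_restrict_of_forall_mem measurableSet_Ico hker')
      _ = W * ∫⁻ s in Set.Ico (t / 2) t, ENNReal.ofReal (ρ ^ K) * ENNReal.ofReal (ρ ^ (N * θ)) *
          eLpNorm (fun y => g (s, y)) q volume := by
          rw [lintegral_const_mul _ hn]
          ring
      _ ≤ W * ∫⁻ s in Set.Ico (t / 2) t,
          ENNReal.ofReal (c ^ K) * ENNReal.ofReal (c ^ (N * θ)) * e s := by
          refine mul_le_mul_right (setLIntegral_mono' measurableSet_Ico fun s hs' => ?_) _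
          obtain ⟨h0, h1, h2, -, -⟩ := hs hs'
          have h3 : s ^ ((N / d) * θ) = (s ^ (1 / d)) ^ (N * θ) := by
            rw [← Real.rpow_mul h0.le]
            congr 1
            ring
          have h4 := he2 s h0
          rw [h3] at h4
          have h5 : ENNReal.ofReal (ρ ^ K) ≤
              ENNReal.ofReal (c ^ K) * ENNReal.ofReal (((1 + s) ^ (1 / d)) ^ K) := by
            rw [← ENNReal.ofReal_mul (by positivity), ← Real.mul_rpow hc0.le (by positivity)]
            exact ENNReal.ofReal_le_ofReal (Real.rpow_le_rpow hρ.le h2 hK0)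
          have h6 : ENNReal.ofReal (ρ ^ (N * θ)) ≤
              ENNReal.ofReal (c ^ (N * θ)) * ENNReal.ofReal ((s ^ (1 / d)) ^ (N * θ)) := by
            rw [← ENNReal.ofReal_mul (by positivity), ← Real.mul_rpow hc0.le (by positivity)]
            exact ENNReal.ofReal_le_ofReal (Real.rpow_le_rpow hρ.le h1 (by positivity))
          calc _ ≤ ENNReal.ofReal (c ^ K) * ENNReal.ofReal (((1 + s) ^ (1 / d)) ^ K) *
                (ENNReal.ofReal (c ^ (N * θ)) * ENNReal.ofReal ((s ^ (1 / d)) ^ (N * θ))) *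
                eLpNorm (fun y => g (s, y)) q volume := mul_le_mul_left (mul_le_mul' h5 h6) _
            _ = ENNReal.ofReal (c ^ K) * ENNReal.ofReal (c ^ (N * θ)) *
                (ENNReal.ofReal (((1 + s) ^ (1 / d)) ^ K) *
                (ENNReal.ofReal ((s ^ (1 / d)) ^ (N * θ)) *
                eLpNorm (fun y => g (s, y)) q volume)) := by ring
            _ ≤ _ := mul_le_mul_right h4 _
      _ = _ := by
          rw [lintegral_const_mul' _ _ (by finiteness)]
          ring
  · calc _ ≤ W * ∫⁻ s in Set.Ico (t / 2) t, ∫⁻ y, radWeight K ρ y * g (s, y) :=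
          lintegral_radWeight_mul_conv_le hK0 hρ hκ hg
            (ae_restrict_of_forall_mem measurableSet_Ico hker)
      _ ≤ W * ∫⁻ s in Set.Ico (t / 2) t, ENNReal.ofReal (c ^ K) * e s := by
          refine mul_le_mul_right (setLIntegral_mono' measurableSet_Ico fun s hs' => ?_) _
          obtain ⟨h0, -, h2, -, -⟩ := hs hs'
          refine le_trans ?_ (mul_le_mul_right (he1 s h0) _)
          rw [← lintegral_const_mul' _ _ ENNReal.ofReal_ne_top]
          refine lintegral_mono fun y => ?_
          rw [← mul_assoc]
          exact mul_le_mul_left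
            (radWeight_le_ofReal_rpow_mul hK0 hc hρ.le (by positivity) h2 y) _
      _ = W * ENNReal.ofReal (c ^ K) * ∫⁻ s in Set.Ico (t / 2) t, e s := by
          rw [lintegral_const_mul' _ _ (by finiteness), mul_assoc]
      _ ≤ _ := by
          exact mul_le_mul_left (le_mul_of_one_le_right' hcθ) _

theorem integrable_mpowE_mul_of_radNorm {N : ℕ} {K τ : ℝ} (hτ : 1 ≤ τ)
    {α : Fin N → ℕ} (hα : ((∑ i, α i : ℕ) : ℝ) ≤ K) {φ : EuclideanSpace ℝ (Fin N) → ℝ}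
    (hφ : Measurable φ) (h : radNorm K τ φ ≠ ⊤) : Integrable fun x => mpowE N α x * φ x := by
  refine ⟨((continuous_mpowE N α).measurable.mul hφ).aestronglyMeasurable, ?_⟩
  refine lt_of_le_of_lt (lintegral_mono fun x => ?_) h.lt_top
  have hx := norm_nonneg x
  rw [enorm_mul]
  refine mul_le_mul_left ?_ _
  rw [Real.enorm_eq_ofReal_abs]
  refine ENNReal.ofReal_le_ofReal ((abs_mpowE_le N α x).trans ?_)
  calc ‖x‖ ^ (∑ i, α i) ≤ (τ + ‖x‖) ^ (∑ i, α i) := by gcongr; linarith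
    _ = (τ + ‖x‖) ^ ((∑ i, α i : ℕ) : ℝ) := (Real.rpow_natCast _ _).symm
    _ ≤ _ := Real.rpow_le_rpow_of_exponent_le (by linarith) hα

theorem ofReal_rpow_mul_wnorm_le {N : ℕ} {d K ℓ t : ℝ} (hd : 0 < d) (hℓ : ℓ ∈ Set.Icc 0 K)
    (ht : 1 ≤ t) (w : EuclideanSpace ℝ (Fin N) → ℝ) :
    ENNReal.ofReal (t ^ (K / d)) * (ENNReal.ofReal (t ^ (-ℓ / d)) * wnorm N ℓ w) ≤
      2 * ∫⁻ x, radWeight K (t ^ (1 / d)) x * ‖w x‖ₑ := by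
  have ht0 : 0 < t := by linarith
  have hρ : 1 ≤ t ^ (1 / d) := Real.one_le_rpow ht (by positivity)
  have h1 : t ^ (K / d) * t ^ (-ℓ / d) = (t ^ (1 / d)) ^ (K - ℓ) := by
    rw [← Real.rpow_add ht0, ← Real.rpow_mul ht0.le]
    congr 1
    ring
  rw [← mul_assoc, ← ENNReal.ofReal_mul (by positivity), h1, wnorm,
    ← lintegral_const_mul' _ _ ENNReal.ofReal_ne_top, ← lintegral_const_mul' _ _ (by simp)]
  refine lintegral_mono fun x => ?_
  have hx := norm_nonneg x
  have h2 : (1 : ℝ) ≤ (t ^ (1 / d) + ‖x‖) ^ ℓ := Real.one_le_rpow (by linarith) hℓ.1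
  have h3 : ‖x‖ ^ ℓ ≤ (t ^ (1 / d) + ‖x‖) ^ ℓ := Real.rpow_le_rpow hx (by linarith) hℓ.1
  have h4 : (t ^ (1 / d)) ^ (K - ℓ) ≤ (t ^ (1 / d) + ‖x‖) ^ (K - ℓ) :=
    Real.rpow_le_rpow (by positivity) (by linarith) (by linarith [hℓ.2])
  have h5 : (t ^ (1 / d) + ‖x‖) ^ K =
      (t ^ (1 / d) + ‖x‖) ^ (K - ℓ) * (t ^ (1 / d) + ‖x‖) ^ ℓ := by
    rw [← Real.rpow_add (by linarith)]
    congr 1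
    ring
  rw [radWeight, ← ofReal_norm, ← ENNReal.ofReal_mul (by positivity),
    ← ENNReal.ofReal_mul (by positivity), h5]
  refine (ENNReal.ofReal_le_ofReal (q := 2 * ((t ^ (1 / d) + ‖x‖) ^ (K - ℓ) *
    (t ^ (1 / d) + ‖x‖) ^ ℓ * ‖w x‖)) ?_).trans
      (by rw [ENNReal.ofReal_mul zero_le_two, ENNReal.ofReal_ofNat])
  calc (t ^ (1 / d)) ^ (K - ℓ) * ((1 + ‖x‖ ^ ℓ) * ‖w x‖)
      ≤ (t ^ (1 / d) + ‖x‖) ^ (K - ℓ) * (((t ^ (1 / d) + ‖x‖) ^ ℓ +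
          (t ^ (1 / d) + ‖x‖) ^ ℓ) * ‖w x‖) := by gcongr
    _ = _ := by ring

/-- A function dominated by a sum satisfies the sum of the bounds. -/
theorem ofReal_rpow_mul_dist_le {N : ℕ} {d K ℓ t : ℝ} {q M₁ M₂ : ℝ≥0∞} (hd : 0 < d)
    (hq : 1 ≤ q) (hℓ : ℓ ∈ Set.Icc 0 K) (ht : 1 ≤ t) {w : EuclideanSpace ℝ (Fin N) → ℝ}
    {V₁ V₂ : EuclideanSpace ℝ (Fin N) → ℝ≥0∞} (hV₁ : Measurable V₁) (hV₂ : Measurable V₂)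
    (hw : ∀ x, ‖w x‖ₑ ≤ V₁ x + V₂ x)
    (h1 : ENNReal.ofReal ((t ^ (1 / d)) ^ K) *
      (ENNReal.ofReal ((t ^ (1 / d)) ^ (N * (1 - q.toReal⁻¹))) * eLpNorm V₁ q volume) ≤ M₁)
    (h1' : ∫⁻ x, radWeight K (t ^ (1 / d)) x * V₁ x ≤ M₁)
    (h2 : ENNReal.ofReal ((t ^ (1 / d)) ^ K) *
      (ENNReal.ofReal ((t ^ (1 / d)) ^ (N * (1 - q.toReal⁻¹))) * eLpNorm V₂ q volume) ≤ M₂)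
    (h2' : ∫⁻ x, radWeight K (t ^ (1 / d)) x * V₂ x ≤ M₂) :
    ENNReal.ofReal (t ^ (K / d)) *
      (ENNReal.ofReal (t ^ ((N / d) * (1 - q.toReal⁻¹))) * eLpNorm w q volume +
        ENNReal.ofReal (t ^ (-ℓ / d)) * wnorm N ℓ w) ≤ 3 * (M₁ + M₂) := by
  have ht0 : 0 < t := by linarith
  have e1 : t ^ (K / d) = (t ^ (1 / d)) ^ K := by
    rw [← Real.rpow_mul ht0.le]
    congr 1
    ring
  have e2 : t ^ ((N / d) * (1 - q.toReal⁻¹)) = (t ^ (1 / d)) ^ (N * (1 - q.toReal⁻¹)) := by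
    rw [← Real.rpow_mul ht0.le]
    congr 1
    ring
  have hwq : eLpNorm w q volume ≤ eLpNorm V₁ q volume + eLpNorm V₂ q volume :=
    (eLpNorm_mono_enorm fun x => by simpa using hw x).trans
      (eLpNorm_add_le hV₁.aestronglyMeasurable hV₂.aestronglyMeasurable hq)
  have hwr : ∫⁻ x, radWeight K (t ^ (1 / d)) x * ‖w x‖ₑ ≤ M₁ + M₂ := by
    refine (lintegral_mono fun x => mul_le_mul_right (hw x) _).trans ?_
    have hm : Measurable fun x => radWeight K (t ^ (1 / d)) x * V₁ x :=
      (measurable_radWeight _ _).mul hV₁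
    simp_rw [mul_add]
    rw [lintegral_add_left hm]
    exact add_le_add h1' h2'
  rw [mul_add]
  calc _ ≤ (M₁ + M₂) + 2 * (M₁ + M₂) := by
        refine add_le_add ?_ ((ofReal_rpow_mul_wnorm_le hd hℓ ht w).trans (mul_le_mul_right hwr _))
        rw [e1, e2]
        refine (mul_le_mul_right (mul_le_mul_right hwq _) _).trans ?_
        rw [mul_add, mul_add]
        exact add_le_add h1 h2
    _ = _ := by ring

/-- Pointwise bound of the Duhamel integral by the contributions of far and close times. -/
theorem CondG.enorm_integral_sgOp_le {N γ m : ℕ} {d L t : ℝ} {G : EuclideanSpace ℝ (Fin N) → ℝ → ℝ}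
    (hG : CondG N G γ d L) (hL : 0 < L) (ht : 0 < t) (hmγ : m ≤ γ)
    {φ : ℝ → EuclideanSpace ℝ (Fin N) → ℝ} {g : ℝ × EuclideanSpace ℝ (Fin N) → ℝ≥0∞}
    (hg : Measurable g) (hφg : ∀ s y, 0 < s → ‖φ s y‖ₑ = g (s, y))
    (hφ : ∀ᵐ s ∂volume.restrict (Set.Ioo 0 (t / 2)), ∀ α : Fin N → ℕ, ∑ i, α i ≤ m →
      Integrable (fun x => mpowE N α x * φ s x) ∧ ∫ x, mpowE N α x * φ s x = 0)
    (x : EuclideanSpace ℝ (Fin N)) :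
    ‖∫ s in Set.Ioo 0 t, sgOp N G (t - s) (φ s) x‖ₑ ≤
      ∫⁻ p, taylorKer m d (fun z => G z 1) t (x, p) * g p
        ∂(volume.restrict (Set.Ioo 0 (t / 2))).prod volume +
      ∫⁻ p, heatKer d (fun z => G z 1) t p * g (p.1, x - p.2)
        ∂(volume.restrict (Set.Ico (t / 2) t)).prod volume := by
  have hker : Measurable (taylorKer m d (fun z => G z 1) t) :=
    measurable_taylorKer (hG.decayE.contDiff.of_le (by exact_mod_cast hmγ)) t
  have hker' : Measurable (heatKer d (fun z => G z 1) t) :=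
    measurable_heatKer hG.decayE.contDiff.continuous t
  rw [lintegral_prod _ (by fun_prop), lintegral_prod _ (by fun_prop)]
  calc _ ≤ ∫⁻ s in Set.Ioo 0 t, ‖sgOp N G (t - s) (φ s) x‖ₑ := enorm_integral_le_lintegral_enorm _
    _ ≤ ∫⁻ s in Set.Ioo 0 (t / 2) ∪ Set.Ico (t / 2) t, ‖sgOp N G (t - s) (φ s) x‖ₑ := by
        refine lintegral_mono_set fun s hs => ?_
        rcases lt_or_ge s (t / 2) with h | h
        · exact Or.inl ⟨hs.1, h⟩
        · exact Or.inr ⟨h, hs.2⟩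
    _ ≤ _ := lintegral_union_le _ _ _
    _ ≤ _ := by
        refine add_le_add (lintegral_mono_ae ?_) (setLIntegral_mono' measurableSet_Ico ?_)
        · filter_upwards [hφ, ae_restrict_mem measurableSet_Ioo] with s hs hs'
          refine (hG.enorm_sgOp_le hL hs (by linarith [hs'.2]) x).trans (le_of_eq ?_)
          refine lintegral_congr fun y => ?_
          rw [hφg s y hs'.1]
          rfl
        · intro s hs
          have h0 : 0 < s := lt_of_lt_of_le (by positivity) hs.1
          have h1 : 0 < t - s := by linarith [hs.2]
          have hr : 0 < (t - s) ^ (1 / d) := by positivity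
          refine (enorm_integral_le_lintegral_enorm _).trans (le_of_eq ?_)
          rw [← lintegral_sub_left_eq_self _ x]
          refine lintegral_congr fun y => ?_
          rw [sub_sub_cancel, enorm_mul, hφg s _ h0, hG.eq_scaled _ h1, enorm_mul,
            Real.enorm_of_nonneg (r := (((t - s) ^ (1 / d)) ^ N)⁻¹) (by positivity)]
          rfl

/-- Theorem 1.2 (ii), second part: if moreover `∫_0^∞ E_{K,q}[f](s) ds < ∞`, then
`t^{K/d}[t^{(N/d)(1-1/q)}‖R_K[f](t)‖_q + t^{-ℓ/d}|||R_K[f](t)|||_ℓ] → 0` as `t → ∞`. -/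
theorem stmt4 (N γ : ℕ) (hN : 1 ≤ N) (d L : ℝ) (hd : 0 < d) (hL : 0 < L)
    (G : EuclideanSpace ℝ (Fin N) → ℝ → ℝ) (hG : CondG N G γ d L)
    (K : ℝ) (hK0 : 0 ≤ K) (hKL : K < L) (hKγ : ⌈K⌉₊ + 1 ≤ γ)
    (q : ℝ≥0∞) (hq : 1 ≤ q) (ℓ : ℝ) (hℓ : ℓ ∈ Set.Icc 0 K)
    (f : EuclideanSpace ℝ (Fin N) → ℝ → ℝ)
    (hf : Measurable fun p : EuclideanSpace ℝ (Fin N) × ℝ => f p.1 p.2)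
    (hE : ∀ T : ℝ, 0 < T → ∃ C : ℝ,
      ∀ᵐ t ∂(volume.restrict (Set.Ioo (0 : ℝ) T)), Efun N d K q f t ≤ ENNReal.ofReal C)
    (hEint : ∫⁻ s in Set.Ioi (0 : ℝ), Efun N d K q f s < ⊤) :
    Tendsto (fun t : ℝ =>
      ENNReal.ofReal (t ^ (K / d)) *
        (ENNReal.ofReal (t ^ (((N : ℝ) / d) * (1 - q.toReal⁻¹))) *
            eLpNorm (fun x => ∫ s in Set.Ioo (0 : ℝ) t,
              sgOp N G (t - s) (PKop N G K s fun z => f z s) x) q volume +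
          ENNReal.ofReal (t ^ (-ℓ / d)) *
            wnorm N ℓ (fun x => ∫ s in Set.Ioo (0 : ℝ) t,
              sgOp N G (t - s) (PKop N G K s fun z => f z s) x)))
      atTop (nhds 0) := by
  have hm1 : ⌊K⌋₊ + 1 ≤ γ := (Nat.add_le_add_right (Nat.floor_le_ceil K) 1).trans hKγ
  have hm : ⌊K⌋₊ ≤ γ := by omega
  rcases hG.eq_zero_or_integral_eq_one hd hL with h0 | hmass
  · have hzero (t : ℝ) (x : EuclideanSpace ℝ (Fin N)) : ∫ s in Set.Ioo (0 : ℝ) t,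
        sgOp N G (t - s) (PKop N G K s fun z => f z s) x = 0 := by
      refine setIntegral_eq_zero_of_forall_eq_zero fun s hs => ?_
      have hs' : 0 < t - s := by linarith [hs.2]
      simp [sgOp, h0 _ _ hs']
    simp [hzero, wnorm]
  obtain ⟨Φ, hΦ, hΦP⟩ := hG.exists_measurable_PKop hm hf
  obtain ⟨C₁, hC₁, hP₁⟩ := hG.exists_radNorm_PKop_le hK0 hKL hm
  obtain ⟨C₂, hC₂, hP₂⟩ := hG.exists_eLpNorm_PKop_le hd hL hK0 hm hq
  obtain ⟨D₁, hD₁, hV₁⟩ := (hG.decayE.mono hm1).exists_taylorKer_le hd hK0 (Nat.floor_le hK0)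
    (Nat.lt_floor_add_one K) (by linarith)
  obtain ⟨D₂, hD₂, hV₂⟩ := hG.decayE.exists_heatKer_le (K := K) hd hK0 (by linarith) hq
  have hfs (s : ℝ) : Measurable fun x => f x s := hf.comp (measurable_id.prodMk measurable_const)
  set g : ℝ × EuclideanSpace ℝ (Fin N) → ℝ≥0∞ := fun p => ‖Φ (p.2, p.1)‖ₑ with hgdef
  have hg : Measurable g := (hΦ.comp measurable_swap).enorm
  have hφg (s : ℝ) (y : EuclideanSpace ℝ (Fin N)) (hs : 0 < s) :
      ‖PKop N G K s (fun z => f z s) y‖ₑ = g (s, y) := by rw [hgdef, ← hΦP y s hs]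
  set A := C₁ * ENNReal.ofReal (2 ^ K) + C₂
  have hA : A ≠ ⊤ := by finiteness
  set e : ℝ → ℝ≥0∞ := fun s => A * Efun N d K q f s
  have he : ∫⁻ s in Set.Ioi 0, e s < ⊤ := by
    rw [lintegral_const_mul' _ _ hA]
    exact ENNReal.mul_lt_top hA.lt_top hEint
  have hrad (s : ℝ) (hs : 0 < s) : radNorm K ((1 + s) ^ (1 / d)) (PKop N G K s fun z => f z s) ≤
      C₁ * ENNReal.ofReal (2 ^ K) * Efun N d K q f s := by
    refine (hP₁ s (by linarith) _).trans ?_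
    rw [mul_assoc]
    exact mul_le_mul_right (radNorm_le_Efun hK0 q f (by linarith) (hfs s).aemeasurable) _
  have hge (s : ℝ) (hs : 0 < s) : ∫⁻ y, radWeight K ((1 + s) ^ (1 / d)) y * g (s, y) ≤ e s := by
    simp_rw [← hφg s _ hs]
    exact (hrad s hs).trans (mul_le_mul_left le_self_add _)
  have hgq (s : ℝ) (hs : 0 < s) : ENNReal.ofReal (((1 + s) ^ (1 / d)) ^ K) *
      (ENNReal.ofReal (s ^ ((N / d) * (1 - q.toReal⁻¹))) *
        eLpNorm (fun y => g (s, y)) q volume) ≤ e s := by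
    have h1 : eLpNorm (fun y => g (s, y)) q volume =
        eLpNorm (PKop N G K s fun z => f z s) q volume := by
      simp_rw [← hφg s _ hs]
      exact eLpNorm_enorm _
    rw [h1]
    exact (hP₂ f s hs (hfs s)).trans (mul_le_mul_left le_add_self _)
  have hmom (t : ℝ) (ht : 0 < t) : ∀ᵐ s ∂volume.restrict (Set.Ioo 0 (t / 2)), ∀ α : Fin N → ℕ,
      ∑ i, α i ≤ ⌊K⌋₊ → Integrable (fun x => mpowE N α x * PKop N G K s (fun z => f z s) x) ∧
        ∫ x, mpowE N α x * PKop N G K s (fun z => f z s) x = 0 := by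
    obtain ⟨C, hC⟩ := hE (t / 2) (by positivity)
    filter_upwards [hC, ae_restrict_mem measurableSet_Ioo] with s hs hs' α hα
    have hs0 : 0 < s := hs'.1
    have hEs : Efun N d K q f s ≠ ⊤ := ne_top_of_le_ne_top ENNReal.ofReal_ne_top hs
    have hτ : 1 ≤ (1 + s) ^ (1 / d) := Real.one_le_rpow (by linarith) (by positivity)
    have hαK : ((∑ i, α i : ℕ) : ℝ) ≤ K := le_trans (by exact_mod_cast hα) (Nat.floor_le hK0)
    have hPm : Measurable (PKop N G K s fun z => f z s) := by
      have : (PKop N G K s fun z => f z s) = fun y => Φ (y, s) :=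
        funext fun y => (hΦP y s hs0).symm
      rw [this]
      exact hΦ.comp (measurable_id.prodMk measurable_const)
    refine ⟨integrable_mpowE_mul_of_radNorm hτ hαK hPm ?_,
      hG.integral_mpowE_mul_PKop hmass hK0 hKL hm (by linarith) α hα
        (integrable_mpowE_mul_of_radNorm hτ hαK (hfs s) ?_)⟩
    · exact ne_top_of_le_ne_top (by finiteness) (hrad s hs0)
    · exact ne_top_of_le_ne_top (by finiteness)
        (radNorm_le_Efun hK0 q f (by linarith) (hfs s).aemeasurable)
  have hfin : ∫⁻ p, ENNReal.ofReal (‖p.2‖ ^ K) * g p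
      ∂(volume.restrict (Set.Ioi (0 : ℝ))).prod volume ≠ ⊤ := by
    refine ne_top_of_le_ne_top he.ne ?_
    rw [lintegral_prod _ (by fun_prop)]
    refine setLIntegral_mono' measurableSet_Ioi fun s hs => ?_
    have hs0 : 0 < s := hs
    refine (lintegral_mono fun y => mul_le_mul_left (ENNReal.ofReal_le_ofReal ?_) _).trans
      (hge s hs)
    have hτ : 0 < (1 + s) ^ (1 / d) := by positivity
    exact Real.rpow_le_rpow (norm_nonneg y) (by linarith) hK0
  have hlim : Tendsto (fun t : ℝ => 3 * (D₁ * ∫⁻ p, ENNReal.ofReal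
        (taylorMod K ⌊K⌋₊ (t ^ (1 / d)) p.2) * g p
          ∂(volume.restrict (Set.Ioi (0 : ℝ))).prod volume +
      D₂ * ∫⁻ s in Set.Ico (t / 2) t, e s)) atTop (𝓝 0) := by
    have h1 := ENNReal.Tendsto.const_mul ((tendsto_lintegral_taylorMod_mul
      (Nat.lt_floor_add_one K) hg (fun p => enorm_ne_top) hfin).comp
        (tendsto_rpow_atTop (y := 1 / d) (by positivity))) (Or.inr hD₁)
    have h2 := ENNReal.Tendsto.const_mul (tendsto_setLIntegral_Ico_half he) (Or.inr hD₂)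
    have h3 := ENNReal.Tendsto.const_mul (a := 3) (h1.add h2) (Or.inr (by simp))
    simpa using h3
  refine tendsto_of_tendsto_of_tendsto_of_le_of_le' tendsto_const_nhds hlim
    (.of_forall fun _ => zero_le) ?_
  filter_upwards [eventually_ge_atTop 1] with t ht
  have ht0 : 0 < t := by linarith
  have hker : Measurable (taylorKer ⌊K⌋₊ d (fun z => G z 1) t) :=
    measurable_taylorKer (hG.decayE.contDiff.of_le (by exact_mod_cast hm)) t
  have hker' : Measurable (heatKer d (fun z => G z 1) t) :=
    measurable_heatKer hG.decayE.contDiff.continuous t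
  obtain ⟨h1, h1'⟩ := hV₁ g hg t ht0
  obtain ⟨h2, h2'⟩ := hV₂ g e hg hge hgq t ht0
  exact ofReal_rpow_mul_dist_le hd hq hℓ ht
    (Measurable.lintegral_prod_right' (f := fun p : EuclideanSpace ℝ (Fin N) ×
      (ℝ × EuclideanSpace ℝ (Fin N)) => taylorKer ⌊K⌋₊ d (fun z => G z 1) t p * g p.2)
      (by fun_prop))
    (Measurable.lintegral_prod_right' (f := fun p : EuclideanSpace ℝ (Fin N) ×
      (ℝ × EuclideanSpace ℝ (Fin N)) => heatKer d (fun z => G z 1) t p.2 *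
        g (p.2.1, p.1 - p.2.2)) (by fun_prop))
    (hG.enorm_integral_sgOp_le hL ht0 hm hg hφg (hmom t ht0))
    (ofReal_rpow_mul_eLpNorm_le hK0 (by positivity) h1' h1 hq) h1' h2 h2'
end

section
/- Assume condition (G) for some γ ∈ ℕ, d > 0 and L > 0. Let 0 ≤ K < L with [K]+1 ≤ γ, 1 ≤ q ≤ ∞, and let f be a measurable function on ℝ^N × (0,∞) such that E_{K,q}[f] ∈ L^∞(0,T) for every T > 0. Then for every multi-index α with |α| ≤ K there exists a constant C such that |M_α(f(·,t),t)| ≤ C (1+t)^{−K/d + |α|/d} E_{K,q}[f](t) for almost all t > 0. -/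
open MeasureTheory Filter Asymptotics Topology
open scoped ENNReal BigOperators

theorem pderivE_comp_smul (N : ℕ) (i : Fin N) (a c : ℝ)
    (h : EuclideanSpace ℝ (Fin N) → ℝ) :
    pderivE N i (fun x => a * h (c • x)) = fun x => (a * c) * pderivE N i h (c • x) := by
  funext x
  have h1 : fderiv ℝ (fun x => a * h (c • x)) x = a • fderiv ℝ (fun x => h (c • x)) x :=
    congrFun (fderiv_const_smul_field (𝕜 := ℝ) (f := fun x => h (c • x)) a) x
  have h2 : fderiv ℝ (fun x => h (c • x)) x = c • fderiv ℝ h (c • x) :=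
    fderiv_comp_smul (𝕜 := ℝ) (f := h) (x := x) c
  simp only [pderivE, h1, h2, smul_apply, smul_eq_mul, mul_assoc]

theorem pderivE_iterate_comp_smul (N : ℕ) (i : Fin N) (n : ℕ) (a c : ℝ)
    (h : EuclideanSpace ℝ (Fin N) → ℝ) :
    (pderivE N i)^[n] (fun x => a * h (c • x)) =
      fun x => (a * c ^ n) * (pderivE N i)^[n] h (c • x) := by
  induction n generalizing a h with
  | zero => simp
  | succ n ih =>
    rw [Function.iterate_succ_apply, pderivE_comp_smul, ih]
    funext x
    rw [Function.iterate_succ_apply]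
    ring

theorem foldr_pderivE_comp_smul (N : ℕ) (α : Fin N → ℕ) (l : List (Fin N)) (a c : ℝ)
    (h : EuclideanSpace ℝ (Fin N) → ℝ) :
    (l.map fun i => (pderivE N i)^[α i]).foldr (fun T h => T h) (fun x => a * h (c • x)) =
      fun x => (a * c ^ (l.map α).sum) *
        (l.map fun i => (pderivE N i)^[α i]).foldr (fun T h => T h) h (c • x) := by
  induction l with
  | nil => simp
  | cons i l ih =>
    simp only [List.map_cons, List.foldr_cons, List.sum_cons]
    rw [ih, pderivE_iterate_comp_smul]
    funext x
    ring

theorem mderivE_comp_smul (N : ℕ) (α : Fin N → ℕ) (a c : ℝ)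
    (h : EuclideanSpace ℝ (Fin N) → ℝ) :
    mderivE N α (fun x => a * h (c • x)) =
      fun x => (a * c ^ (∑ i, α i)) * mderivE N α h (c • x) := by
  have hs : ((List.finRange N).map α).sum = ∑ i, α i := by
    rw [← List.ofFn_eq_map, List.sum_ofFn]
  simp only [mderivE, List.ofFn_eq_map]
  rw [foldr_pderivE_comp_smul, hs]

/-- The moments of `g_β(·,t)` scale like a power of `1 + t`. -/
theorem integral_mpowE_mul_gA (N : ℕ) (d : ℝ)
    (G : EuclideanSpace ℝ (Fin N) → ℝ → ℝ)
    (hscale : ∀ x : EuclideanSpace ℝ (Fin N), ∀ t : ℝ, 0 < t →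
      G x t = t ^ (-(N : ℝ) / d) * G ((t ^ (-(1 : ℝ) / d)) • x) 1)
    (α β : Fin N → ℕ) {t : ℝ} (ht : 0 < t) :
    ∫ x, mpowE N α x * gA N G β x t =
      (1 + t) ^ ((∑ i, α i : ℕ) / d - (∑ i, β i : ℕ) / d) *
        ∫ x, mpowE N α x * gA N G β x 0 := by
  have hs : 0 < 1 + t := by linarith
  set c : ℝ := (1 + t) ^ (-(1 : ℝ) / d) with hc
  have hc0 : 0 < c := Real.rpow_pos_of_pos hs _
  have hfun : (fun y => G y (t + 1)) =
      fun y => (1 + t) ^ (-(N : ℝ) / d) * (fun y => G y 1) (c • y) := by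
    funext y
    rw [add_comm t 1, hscale y (1 + t) hs]
  have hcpow : ∀ n : ℕ, c ^ n = (1 + t) ^ (-((n : ℝ) / d)) := by
    intro n
    rw [hc, ← Real.rpow_mul_natCast hs.le]
    congr 1
    ring
  have hint : ∀ x, mpowE N α x * gA N G β x t =
      ((1 + t) ^ (-(N : ℝ) / d) * c ^ (∑ i, β i) * (c ^ (∑ i, α i))⁻¹) *
        (fun y => mpowE N α y * gA N G β y 0) (c • x) := by
    intro x
    have h1 : mpowE N α x = (c ^ (∑ i, α i))⁻¹ * mpowE N α (c • x) := by
      rw [mpowE_smul, inv_mul_cancel_left₀ (pow_pos hc0 _).ne']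
    simp only [gA, zero_add]
    rw [h1, hfun, mderivE_comp_smul N β _ c fun y => G y 1]
    ring
  rw [integral_congr_ae (Eventually.of_forall hint), integral_const_mul,
    Measure.integral_comp_smul volume (fun y => mpowE N α y * gA N G β y 0), finrank_euclideanSpace_fin, smul_eq_mul,
    abs_of_pos (inv_pos.2 (pow_pos hc0 N)), ← mul_assoc]
  congr 1
  simp only [hcpow]
  rw [← Real.rpow_neg hs.le, ← Real.rpow_neg hs.le, ← Real.rpow_add hs, ← Real.rpow_add hs,
    ← Real.rpow_add hs]
  congr 1
  ring

theorem rpow_interpolation {d K r s : ℝ} {n : ℕ} (hn : (n : ℝ) ≤ K)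
    (hr : 0 ≤ r) (hs : 0 < s) :
    r ^ n ≤ s ^ (-K / d + n / d) * (s ^ (K / d) + r ^ K) := by
  rcases le_or_gt r (s ^ (1 / d)) with h | h
  · have h1 : r ^ n ≤ s ^ (-K / d + n / d) * s ^ (K / d) := by
      calc r ^ n ≤ (s ^ (1 / d)) ^ n := pow_le_pow_left₀ hr h n
        _ = s ^ (-K / d + n / d) * s ^ (K / d) := by
          rw [← Real.rpow_mul_natCast hs.le, ← Real.rpow_add hs]
          congr 1
          ring
    refine h1.trans (mul_le_mul_of_nonneg_left ?_ (Real.rpow_nonneg hs.le _))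
    exact le_add_of_nonneg_right (Real.rpow_nonneg hr _)
  · have hb : 0 < s ^ (1 / d) := Real.rpow_pos_of_pos hs _
    have hr0 : 0 < r := hb.trans h
    have h1 : r ^ n ≤ s ^ (-K / d + n / d) * r ^ K := by
      calc r ^ n = r ^ ((n : ℝ) - K) * r ^ K := by
            rw [← Real.rpow_add hr0, sub_add_cancel, Real.rpow_natCast]
        _ ≤ (s ^ (1 / d)) ^ ((n : ℝ) - K) * r ^ K :=
            mul_le_mul_of_nonneg_right
              (Real.rpow_le_rpow_of_nonpos hb h.le (by linarith)) (Real.rpow_nonneg hr _)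
        _ = s ^ (-K / d + n / d) * r ^ K := by
            rw [← Real.rpow_mul hs.le]
            congr 2
            ring
    refine h1.trans (mul_le_mul_of_nonneg_left ?_ (Real.rpow_nonneg hs.le _))
    exact le_add_of_nonneg_left (Real.rpow_nonneg hs.le _)

theorem ofReal_abs_momE_le (N : ℕ) {d K : ℝ} (q : ℝ≥0∞)
    (f : EuclideanSpace ℝ (Fin N) → ℝ → ℝ) {t : ℝ} (ht : 0 < t)
    (hf : Measurable fun x => f x t)
    (α : Fin N → ℕ) (hα : ((∑ i, α i : ℕ) : ℝ) ≤ K) :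
    ENNReal.ofReal |momE N α (fun x => f x t)| ≤
      ENNReal.ofReal ((1 + t) ^ (-K / d + (∑ i, α i : ℕ) / d)) * Efun N d K q f t := by
  have hs : 0 < 1 + t := by linarith
  have hsK : 0 ≤ (1 + t) ^ (K / d) := Real.rpow_nonneg hs.le _
  have hpt : ∀ x, ‖mpowE N α x * f x t‖ₑ ≤
      ENNReal.ofReal ((1 + t) ^ (-K / d + (∑ i, α i : ℕ) / d)) *
        (ENNReal.ofReal ((1 + t) ^ (K / d)) * ‖f x t‖ₑ +
          ENNReal.ofReal ((1 + ‖x‖ ^ K) * ‖f x t‖)) := by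
    intro x
    have hxK : 0 ≤ ‖x‖ ^ K := Real.rpow_nonneg (norm_nonneg x) _
    rw [← ofReal_norm (mpowE N α x * f x t), ← ofReal_norm (f x t), ← ENNReal.ofReal_mul hsK,
      ← ENNReal.ofReal_add (by positivity) (by positivity),
      ← ENNReal.ofReal_mul (by positivity)]
    refine ENNReal.ofReal_le_ofReal ?_
    rw [norm_mul, Real.norm_eq_abs (mpowE N α x), ← add_mul, ← mul_assoc]
    refine mul_le_mul_of_nonneg_right ?_ (norm_nonneg _)
    refine (abs_mpowE_le N α x).trans
      ((rpow_interpolation (d := d) hα (norm_nonneg x) hs).trans ?_)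
    refine mul_le_mul_of_nonneg_left ?_ (Real.rpow_nonneg hs.le _)
    linarith
  have hfe : Measurable fun x => ‖f x t‖ₑ := hf.enorm
  calc ENNReal.ofReal |momE N α (fun x => f x t)|
      ≤ ∫⁻ x, ‖mpowE N α x * f x t‖ₑ := by
        rw [momE, ← Real.norm_eq_abs, ofReal_norm]
        exact enorm_integral_le_lintegral_enorm _
    _ ≤ ∫⁻ x, ENNReal.ofReal ((1 + t) ^ (-K / d + (∑ i, α i : ℕ) / d)) *
        (ENNReal.ofReal ((1 + t) ^ (K / d)) * ‖f x t‖ₑ +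
          ENNReal.ofReal ((1 + ‖x‖ ^ K) * ‖f x t‖)) := lintegral_mono hpt
    _ = ENNReal.ofReal ((1 + t) ^ (-K / d + (∑ i, α i : ℕ) / d)) *
        (ENNReal.ofReal ((1 + t) ^ (K / d)) * eLpNorm (fun x => f x t) 1 volume +
          wnorm N K (fun x => f x t)) := by
        rw [lintegral_const_mul' _ _ ENNReal.ofReal_ne_top,
          lintegral_add_left (hfe.const_mul _), lintegral_const_mul' _ _ ENNReal.ofReal_ne_top,
          eLpNorm_one_eq_lintegral_enorm, wnorm]
    _ ≤ _ := by
        rw [Efun]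
        gcongr
        exact le_add_self

theorem exists_ofReal_abs_McoefAux_le (N : ℕ) {d K : ℝ} (q : ℝ≥0∞) (G f : EuclideanSpace ℝ (Fin N) → ℝ → ℝ)
    (hscale : ∀ x : EuclideanSpace ℝ (Fin N), ∀ t : ℝ, 0 < t →
      G x t = t ^ (-(N : ℝ) / d) * G ((t ^ (-(1 : ℝ) / d)) • x) 1)
    (hf : ∀ t, Measurable fun x => f x t)
    (n : ℕ) (α : Fin N → ℕ) (hα : ((∑ i, α i : ℕ) : ℝ) ≤ K) :
    ∃ C : ℝ, 0 < C ∧ ∀ t : ℝ, 0 < t →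
      ENNReal.ofReal |McoefAux N G (fun x => f x t) t n α| ≤
        ENNReal.ofReal (C * (1 + t) ^ (-K / d + (∑ i, α i : ℕ) / d)) * Efun N d K q f t := by
  induction n generalizing α with
  | zero =>
    refine ⟨1, one_pos, fun t ht => ?_⟩
    rw [one_mul]
    exact ofReal_abs_momE_le N q f ht (hf t) α hα
  | succ n ih =>
    have hβ : ∀ β ∈ (Finset.Iic α).erase α, ((∑ i, β i : ℕ) : ℝ) ≤ K := fun β hβ =>
      le_trans (Nat.cast_le.2 (Finset.sum_le_sum fun i _ =>
        Finset.mem_Iic.1 (Finset.mem_of_mem_erase hβ) i)) hα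
    choose! C hC0 hC using fun β hβ' => ih β (hβ β hβ')
    set D : (Fin N → ℕ) → ℝ := fun β => |∫ x, mpowE N α x * gA N G β x 0| with hD
    have hsum : 0 ≤ ∑ β ∈ (Finset.Iic α).erase α, C β * D β :=
      Finset.sum_nonneg fun β hβ' => mul_nonneg (hC0 β hβ').le (abs_nonneg _)
    refine ⟨1 + ∑ β ∈ (Finset.Iic α).erase α, C β * D β, by linarith, fun t ht => ?_⟩
    have hs : 0 < 1 + t := by linarith
    set P : ℝ := (1 + t) ^ (-K / d + (∑ i, α i : ℕ) / d) with hP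
    have hP0 : 0 < P := Real.rpow_pos_of_pos hs _
    have hterm : ∀ β ∈ (Finset.Iic α).erase α,
        ENNReal.ofReal |McoefAux N G (fun x => f x t) t n β *
          ∫ x, mpowE N α x * gA N G β x t| ≤
        ENNReal.ofReal (C β * D β * P) * Efun N d K q f t := by
      intro β hβ'
      rw [integral_mpowE_mul_gA N d G hscale α β ht, abs_mul, abs_mul,
        ENNReal.ofReal_mul (abs_nonneg _), abs_of_pos (Real.rpow_pos_of_pos hs _)]
      refine (mul_le_mul_left (hC β hβ' t ht) _).trans_eq ?_
      rw [mul_right_comm, ← ENNReal.ofReal_mul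
        (mul_nonneg (hC0 β hβ').le (Real.rpow_nonneg hs.le _))]
      congr 2
      have : P = (1 + t) ^ (-K / d + (∑ i, β i : ℕ) / d) *
          (1 + t) ^ ((∑ i, α i : ℕ) / d - (∑ i, β i : ℕ) / d) := by
        rw [hP, ← Real.rpow_add hs]
        congr 1
        ring
      rw [this]
      ring
    calc ENNReal.ofReal |McoefAux N G (fun x => f x t) t (n + 1) α|
        ≤ ENNReal.ofReal (|momE N α (fun x => f x t)| +
            ∑ β ∈ (Finset.Iic α).erase α, |McoefAux N G (fun x => f x t) t n β *
              ∫ x, mpowE N α x * gA N G β x t|) := by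
          refine ENNReal.ofReal_le_ofReal ?_
          rw [McoefAux]
          exact (abs_sub _ _).trans (add_le_add_right (Finset.abs_sum_le_sum_abs _ _) _)
      _ = ENNReal.ofReal |momE N α (fun x => f x t)| +
            ∑ β ∈ (Finset.Iic α).erase α,
              ENNReal.ofReal |McoefAux N G (fun x => f x t) t n β *
                ∫ x, mpowE N α x * gA N G β x t| := by
          rw [ENNReal.ofReal_add (abs_nonneg _) (Finset.sum_nonneg fun _ _ => abs_nonneg _),
            ENNReal.ofReal_sum_of_nonneg fun _ _ => abs_nonneg _]
      _ ≤ ENNReal.ofReal P * Efun N d K q f t +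
            ∑ β ∈ (Finset.Iic α).erase α,
              ENNReal.ofReal (C β * D β * P) * Efun N d K q f t :=
          add_le_add (ofReal_abs_momE_le N q f ht (hf t) α hα) (Finset.sum_le_sum hterm)
      _ = _ := by
          rw [← Finset.sum_mul, ← add_mul, ← ENNReal.ofReal_sum_of_nonneg fun β hβ' =>
              mul_nonneg (mul_nonneg (hC0 β hβ').le (abs_nonneg _)) hP0.le,
            ← Finset.sum_mul, ← ENNReal.ofReal_add hP0.le (mul_nonneg hsum hP0.le)]
          congr 2
          ring

/-- Lemma 2.2, second part: for each multi-index `α` with `|α| ≤ K` there is `C` with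
`|M_α(f(t),t)| ≤ C (1+t)^{-K/d+|α|/d} E_{K,q}[f](t)` for a.e. `t > 0`. -/
theorem stmt11 (N γ : ℕ) (hN : 1 ≤ N) (d L : ℝ) (hd : 0 < d) (hL : 0 < L)
    (G : EuclideanSpace ℝ (Fin N) → ℝ → ℝ) (hG : CondG N G γ d L)
    (K : ℝ) (hK0 : 0 ≤ K) (hKL : K < L) (hKγ : ⌈K⌉₊ + 1 ≤ γ)
    (q : ℝ≥0∞) (hq : 1 ≤ q)
    (f : EuclideanSpace ℝ (Fin N) → ℝ → ℝ)
    (hf : Measurable fun p : EuclideanSpace ℝ (Fin N) × ℝ => f p.1 p.2)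
    (hE : ∀ T : ℝ, 0 < T → ∃ C : ℝ,
      ∀ᵐ t ∂(volume.restrict (Set.Ioo (0 : ℝ) T)), Efun N d K q f t ≤ ENNReal.ofReal C)
    (α : Fin N → ℕ) (hα : (∑ i, α i) ≤ ⌊K⌋₊) :
    ∃ C : ℝ, 0 < C ∧
      ∀ᵐ t ∂(volume.restrict (Set.Ioi (0 : ℝ))),
        ENNReal.ofReal |Mcoef N G (fun x => f x t) t α| ≤
          ENNReal.ofReal (C * (1 + t) ^ (-K / d + (∑ i, α i : ℕ) / d)) *
            Efun N d K q f t := by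
  have hαK : ((∑ i, α i : ℕ) : ℝ) ≤ K := (Nat.cast_le.2 hα).trans (Nat.floor_le hK0)
  obtain ⟨C, hC0, hC⟩ := exists_ofReal_abs_McoefAux_le N q G f hG.scaling
    (fun t => hf.comp measurable_prodMk_right) (∑ i, α i) α hαK
  refine ⟨C, hC0, ?_⟩
  filter_upwards [ae_restrict_mem measurableSet_Ioi] with t ht
  exact hC t ht
end
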